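/- Let H be a bounded hyperbolic component of S_p of Type A, i.e., for (c,a) ∈ H the critical point −c lies in the Fatou component U_{c,a}(c) containing c. Then the map Φ: H → 𝔻 defined by Φ(c,a) = B_{c,a}(−c), where B_{c,a} is the Böttcher coordinate of f_{c,a}^p at its superattracting fixed point c, is a proper double cover onto the unit disk ramified at exactly one point. -/

import Mathlib

open Set Function Filter Topology Metric

noncomputable section

/-- The cubic polynomial `f_{c,a}(z) = z^3 - 3c^2 z + a`, with critical points `c` and `-c`. -/
def cubic (c a : ℂ) : ℂ → ℂ := fun z => z ^ 3 - 3 * c ^ 2 * z + a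

/-- The critically periodic curve `S_p`: parameters for which the critical point `c`
has exact period `p`. -/
def Sp (p : ℕ) : Set (ℂ × ℂ) :=
  {w | (cubic w.1 w.2)^[p] w.1 = w.1 ∧ ∀ k, 1 ≤ k → k < p → (cubic w.1 w.2)^[k] w.1 ≠ w.1}

/-- `S_p^*`: the curve `S_p` minus the finitely many parameters for which `-c` meets
the orbit of `c`. -/
def SpStar (p : ℕ) : Set (ℂ × ℂ) :=
  {w ∈ Sp p | ∀ k, 0 < k → k ≤ p → (cubic w.1 w.2)^[k] w.1 ≠ -w.1}

/-- The filled Julia set of a polynomial: points with bounded forward orbit. -/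
def filledJulia (f : ℂ → ℂ) : Set ℂ :=
  {z | Bornology.IsBounded (range fun n => f^[n] z)}

/-- The Julia set of a polynomial: the boundary of the filled Julia set. -/
def juliaSet (f : ℂ → ℂ) : Set ℂ := frontier (filledJulia f)

/-- The Fatou set of a polynomial. -/
def fatouSet (f : ℂ → ℂ) : Set ℂ := (juliaSet f)ᶜ

/-- The Fatou component containing a point `z`. -/
def fatouComponent (f : ℂ → ℂ) (z : ℂ) : Set ℂ := connectedComponentIn (fatouSet f) z

/-- The orbit of `z` converges to an attracting periodic cycle of `f`. -/
def AttractedToAttractingCycle (f : ℂ → ℂ) (z : ℂ) : Prop :=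
  ∃ n : ℕ, 0 < n ∧ ∃ w : ℂ, f^[n] w = w ∧ ‖deriv (f^[n]) w‖ < 1 ∧
    Tendsto (fun k => f^[n * k] z) atTop (𝓝 w)

/-- A parameter `(c,a)` is hyperbolic if both critical points `c`, `-c` of `f_{c,a}`
are attracted to attracting cycles. -/
def IsHyperbolicParam (w : ℂ × ℂ) : Prop :=
  AttractedToAttractingCycle (cubic w.1 w.2) w.1 ∧
    AttractedToAttractingCycle (cubic w.1 w.2) (-w.1)

/-- The hyperbolic locus on `S_p`. -/
def hypLocus (p : ℕ) : Set (ℂ × ℂ) := {w ∈ Sp p | IsHyperbolicParam w}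

/-- A hyperbolic component on `S_p`: a connected component of the hyperbolic locus. -/
def IsHyperbolicComponent (p : ℕ) (H : Set (ℂ × ℂ)) : Prop :=
  ∃ w ∈ hypLocus p, H = connectedComponentIn (hypLocus p) w

/-- A Jordan curve: a homeomorphic image of the unit circle. -/
def IsJordanCurve {X : Type*} [TopologicalSpace X] (Γ : Set X) : Prop :=
  ∃ φ : ↥(sphere (0 : ℂ) 1) → X, Continuous φ ∧ Injective φ ∧ range φ = Γ

/-- A Jordan disk in `ℂ`: an open connected set bounded by a Jordan curve. -/
def IsJordanDisk (S : Set ℂ) : Prop :=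
  IsOpen S ∧ IsConnected S ∧ IsJordanCurve (frontier S)

/-- `A_{c,a}`: the union of the `p` Fatou components containing the superattracting
orbit of `c`. -/
def critBasin (p : ℕ) (w : ℂ × ℂ) : Set ℂ :=
  ⋃ k ∈ Finset.range p, fatouComponent (cubic w.1 w.2) ((cubic w.1 w.2)^[k] w.1)

/-- The connectedness locus `C(S_p)`. -/
def connLocus (p : ℕ) : Set (ℂ × ℂ) :=
  {w ∈ Sp p | IsConnected (juliaSet (cubic w.1 w.2))}

/-- `C₀(S_p)`: parameters in `C(S_p)` whose free critical orbit never enters `A_{c,a}`. -/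
def connLocus0 (p : ℕ) : Set (ℂ × ℂ) :=
  {w ∈ connLocus p | ∀ k : ℕ, (cubic w.1 w.2)^[k] (-w.1) ∉ critBasin p w}

/-- A Böttcher coordinate of `g` at a superattracting fixed point `z₀`, defined on an
open set `U`, conjugating `g` to `z ↦ z^d`, injective near `z₀`. -/
structure IsBottcherAt (g : ℂ → ℂ) (z₀ : ℂ) (B : ℂ → ℂ) (U : Set ℂ) (d : ℕ) : Prop where
  open_dom : IsOpen U
  mem : z₀ ∈ U
  mapsTo : MapsTo g U U
  analytic : AnalyticOnNhd ℂ B U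
  zero : B z₀ = 0
  two_le : 2 ≤ d
  conj : ∀ z ∈ U, B (g z) = B z ^ d
  inj : ∃ V ⊆ U, IsOpen V ∧ z₀ ∈ V ∧ InjOn B V

/-- A Böttcher coordinate of `g` defined on a whole (super)attracting Fatou
component `U`, a conformal isomorphism onto the unit disk conjugating `g` to `z ↦ z^d`. -/
structure IsFullBottcher (g : ℂ → ℂ) (z₀ : ℂ) (U : Set ℂ) (B : ℂ → ℂ) (d : ℕ) : Prop where
  two_le : 2 ≤ d
  analytic : AnalyticOnNhd ℂ B U
  bij : BijOn B U (ball (0 : ℂ) 1)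
  zero : B z₀ = 0
  conj : ∀ z ∈ U, B (g z) = B z ^ d

/-- The basin of infinity of a polynomial. -/
def basinInf (f : ℂ → ℂ) : Set ℂ := {z | Tendsto (fun n => ‖f^[n] z‖) atTop atTop}

/-- A Böttcher coordinate of a cubic polynomial near infinity, tangent to the identity. -/
structure IsBottcherInf (f : ℂ → ℂ) (B : ℂ → ℂ) (R₀ : ℝ) : Prop where
  one_le : 1 ≤ R₀
  analytic : AnalyticOnNhd ℂ B {z : ℂ | R₀ < ‖z‖}
  inj : InjOn B {z : ℂ | R₀ < ‖z‖}
  mapsTo : ∀ z : ℂ, R₀ < ‖z‖ → R₀ < ‖f z‖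
  conj : ∀ z : ℂ, R₀ < ‖z‖ → B (f z) = B z ^ 3
  asymp : Tendsto (fun z => B z / z) (Bornology.cobounded ℂ) (𝓝 1)

/-- A Böttcher coordinate of a cubic polynomial defined on the whole basin of infinity
(available when the Julia set is connected). -/
structure IsFullBottcherInf (f : ℂ → ℂ) (B : ℂ → ℂ) : Prop where
  analytic : AnalyticOnNhd ℂ B (basinInf f)
  inj : InjOn B (basinInf f)
  conj : ∀ z ∈ basinInf f, B (f z) = B z ^ 3
  asymp : Tendsto (fun z => B z / z) (Bornology.cobounded ℂ) (𝓝 1)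

/-- The external ray of angle `θ` (for a cubic polynomial), described through a Böttcher
coordinate `B` near infinity: points whose large iterates lie on the straight part of the
ray of angle `3^n θ`. -/
def extRaySet (f B : ℂ → ℂ) (R₀ : ℝ) (θ : ℝ) : Set ℂ :=
  {z | ∃ N : ℕ, ∀ n, N ≤ n → R₀ < ‖f^[n] z‖ ∧
    ∃ r : ℝ, 1 < r ∧
      B (f^[n] z) = (r : ℂ) * Complex.exp (2 * Real.pi * Complex.I * ((3 : ℂ) ^ n * (θ : ℂ)))}

/-- `R` is the external ray of angle `θ` of `f`. -/
def IsExternalRaySet (f : ℂ → ℂ) (θ : ℝ) (R : Set ℂ) : Prop :=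
  ∃ B R₀, IsBottcherInf f B R₀ ∧ R = extRaySet f B R₀ θ

/-- The internal ray of angle `θ` (w.r.t. a Böttcher coordinate `B` of `f^p` at the
superattracting periodic point `z₀`) in the Fatou component of `z₀`. -/
def intRaySet (p : ℕ) (f : ℂ → ℂ) (z₀ : ℂ) (B : ℂ → ℂ) (U : Set ℂ) (θ : ℝ) : Set ℂ :=
  {z ∈ fatouComponent f z₀ | ∃ N : ℕ, ∀ n, N ≤ n → f^[p * n] z ∈ U ∧
    ∃ r : ℝ, 0 ≤ r ∧ r < 1 ∧
      B (f^[p * n] z) = (r : ℂ) * Complex.exp (2 * Real.pi * Complex.I * ((2 : ℂ) ^ n * (θ : ℂ)))}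

/-- `R` is the internal ray of angle `θ` of `f` in the periodic Fatou component of `z₀`. -/
def IsInternalRaySet (p : ℕ) (f : ℂ → ℂ) (z₀ : ℂ) (θ : ℝ) (R : Set ℂ) : Prop :=
  ∃ B U d, IsBottcherAt (f^[p]) z₀ B U d ∧ R = intRaySet p f z₀ B U θ

/-- A ray `R` (as a set) lands at the point `q`. -/
def LandsAt (R : Set ℂ) (q : ℂ) : Prop := IsConnected R ∧ closure R \ R = {q}

/-- `q` is a repelling periodic point of `f`. -/
def IsRepellingPeriodicPt (f : ℂ → ℂ) (q : ℂ) : Prop :=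
  ∃ n : ℕ, 0 < n ∧ f^[n] q = q ∧ 1 < ‖deriv (f^[n]) q‖

/-- `q` is a parabolic periodic point of `f`: its multiplier is a root of unity. -/
def IsParabolicPeriodicPt (f : ℂ → ℂ) (q : ℂ) : Prop :=
  ∃ n : ℕ, 0 < n ∧ f^[n] q = q ∧ ∃ m : ℕ, 0 < m ∧ (deriv (f^[n]) q) ^ m = 1

/-- `f` has a parabolic periodic point. -/
def HasParabolicPoint (f : ℂ → ℂ) : Prop := ∃ q, IsParabolicPeriodicPt f q

/-- The Green function of the basin of infinity. -/
def greenInf (f : ℂ → ℂ) (z : ℂ) : ℝ :=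
  limUnder atTop fun n : ℕ => Real.log ‖f^[n] z‖ / 3 ^ n

/-- The Green function of a periodic Fatou component containing the orbit point `w₀`. -/
def greenComp (p : ℕ) (f : ℂ → ℂ) (w₀ z : ℂ) : ℝ :=
  limUnder atTop fun n : ℕ => Real.log ‖f^[p * n] z - w₀‖ / 2 ^ n

/-- The truncated plane `X_{c,a}`: the plane minus the equipotential trap near infinity
and near the superattracting cycle. -/
def Xset (p : ℕ) (c a : ℂ) : Set ℂ :=
  {z | ¬ (z ∈ basinInf (cubic c a) ∧ 1 ≤ greenInf (cubic c a) z) ∧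
    ∀ k, k < p → ¬ (z ∈ fatouComponent (cubic c a) ((cubic c a)^[k] c) ∧
      greenComp p (cubic c a) ((cubic c a)^[k] c) z ≤ -1)}

/-- `G = γ_{c,a}(θ)`: the forward invariant graph generated by the closed internal ray of
angle `θ` in `U_{c,a}(c)` together with the closures of all external rays landing at its
landing point. -/
def IsGammaGraph (p : ℕ) (c a : ℂ) (θ : ℝ) (G : Set ℂ) : Prop :=
  ∃ (Rint : Set ℂ) (ζ : ℂ), IsInternalRaySet p (cubic c a) c θ Rint ∧
    closure Rint \ Rint = {ζ} ∧
    G = ⋃ k : ℕ, (cubic c a)^[k] ''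
      (closure Rint ∪ ⋃₀ {S | ∃ t R, IsExternalRaySet (cubic c a) t R ∧
        closure R \ R = {ζ} ∧ S = closure R})

/-- A puzzle for `f` (with periodic critical point of period `p`) relative to the
truncated plane `X`. -/
structure IsPuzzle (p : ℕ) (f : ℂ → ℂ) (X Γ : Set ℂ) : Prop where
  subset_closure : Γ ⊆ closure X
  boundary_subset : frontier X ⊆ Γ
  compact : IsCompact Γ
  forward_inv : f '' (Γ ∩ f^[p] ⁻¹' X) ⊆ Γ
  crit_avoid : ∀ c' : ℂ, deriv f c' = 0 → ∀ k : ℕ, f^[k] c' ∉ Γ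

/-- The puzzle piece of depth `n` containing `z`. -/
def pieceAt (f : ℂ → ℂ) (X Γ : Set ℂ) (n : ℕ) (z : ℂ) : Set ℂ :=
  connectedComponentIn (f^[n] ⁻¹' (X \ Γ)) z

/-- An `ℓ`-admissible puzzle. -/
structure IsAdmissiblePuzzle (ℓ p : ℕ) (f : ℂ → ℂ) (X Γ : Set ℂ) : Prop where
  puzzle : IsPuzzle p f X Γ
  nondeg : ∀ c' : ℂ, deriv f c' = 0 → c' ∈ juliaSet f →
    ∃ d : ℕ, closure (pieceAt f X Γ (d + ℓ) c') ⊆ pieceAt f X Γ d c'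
  repelling : ∀ z ∈ Γ ∩ juliaSet f, ∀ n : ℕ, 0 < n → f^[n] z = z →
    1 < ‖deriv (f^[n]) z‖
  jordan : ∀ (n : ℕ) (z : ℂ), z ∈ f^[n] ⁻¹' (X \ Γ) → IsJordanDisk (pieceAt f X Γ n z)

/-- The tableau `T_f(z)` is periodic. -/
def TableauPeriodic (f : ℂ → ℂ) (X Γ : Set ℂ) (z : ℂ) : Prop :=
  ∃ k : ℕ, 1 ≤ k ∧ ∀ n : ℕ, pieceAt f X Γ n z = f^[k] '' pieceAt f X Γ (n + k) z

/-- `x` combinatorially accumulates to `y` (for `f`). -/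
def CombAcc (f : ℂ → ℂ) (X Γ : Set ℂ) (x y : ℂ) : Prop :=
  ∀ n : ℕ, ∃ j : ℕ, 0 < j ∧ f^[j] '' pieceAt f X Γ (n + j) x = pieceAt f X Γ n y

/-- `x` combinatorially accumulates to `y` for `g = f^p` (puzzle depths in `pℕ`). -/
def CombAccG (p : ℕ) (f : ℂ → ℂ) (X Γ : Set ℂ) (x y : ℂ) : Prop :=
  ∀ n : ℕ, ∃ j : ℕ, 0 < j ∧
    f^[p * j] '' pieceAt f X Γ (p * n + p * j) x = pieceAt f X Γ (p * n) y

/-- Critical points of `f` on the Julia set. -/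
def critJulia (f : ℂ → ℂ) : Set ℂ := {z | deriv f z = 0 ∧ z ∈ juliaSet f}

/-- `[x]_f`: critical points combinatorially bi-accumulating with `x`. -/
def critClass (f : ℂ → ℂ) (X Γ : Set ℂ) (x : ℂ) : Set ℂ :=
  {c' ∈ critJulia f | CombAcc f X Γ x c' ∧ CombAcc f X Γ c' x}

/-- `P_{n+k}(c')` is a child of `P_n(c₁)`: the map
`f^(k-1) : P_{n+k-1}(f(c')) → P_n(c₁)` is conformal. -/
def IsChild (f : ℂ → ℂ) (X Γ : Set ℂ) (n k : ℕ) (c' c₁ : ℂ) : Prop :=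
  0 < k ∧ f^[k - 1] '' pieceAt f X Γ (n + k - 1) (f c') = pieceAt f X Γ n c₁ ∧
    InjOn (f^[k - 1]) (pieceAt f X Γ (n + k - 1) (f c'))

/-- The critical piece `P_n(c₁)` has only finitely many children. -/
def FinitelyManyChildren (f : ℂ → ℂ) (X Γ : Set ℂ) (n : ℕ) (c₁ : ℂ) : Prop :=
  Set.Finite {q : ℂ × ℕ | q.1 ∈ critJulia f ∧ IsChild f X Γ n q.2 q.1 c₁}

/-- The tableau of `x` is persistently recurrent. -/
def PersistentlyRecurrent (f : ℂ → ℂ) (X Γ : Set ℂ) (x : ℂ) : Prop :=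
  CombAcc f X Γ x x ∧ ∀ c₁ ∈ critClass f X Γ x, ∀ n : ℕ, FinitelyManyChildren f X Γ n c₁

/-- A function on a subset of `ℂ²` is analytic along every analytic disc contained in it
(this expresses holomorphy of a function on an analytic curve in `ℂ²`). -/
def AnalyticOnSlice (Φ : ℂ × ℂ → ℂ) (H : Set (ℂ × ℂ)) : Prop :=
  ∀ (U : Set ℂ) (γ : ℂ → ℂ × ℂ), IsOpen U →
    AnalyticOnNhd ℂ (fun t => (γ t).1) U → AnalyticOnNhd ℂ (fun t => (γ t).2) U →
    (∀ t ∈ U, γ t ∈ H) → AnalyticOnNhd ℂ (fun t => Φ (γ t)) U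

/-- A quasiconformal homeomorphism of the plane (metric definition: bounded circular
distortion). -/
def IsQCHomeo (φ : ℂ → ℂ) : Prop :=
  Continuous φ ∧ Bijective φ ∧ ∃ K : ℝ, ∀ x : ℂ,
    Filter.limsup (fun r : ℝ =>
        sSup ((fun y => dist (φ y) (φ x)) '' sphere x r) /
          sInf ((fun y => dist (φ y) (φ x)) '' sphere x r)) (𝓝[>] (0 : ℝ)) ≤ K

/-- The sector of the parameter disk coordinate `Φ`, of radii `> 1 - 1/(k+1)` and
angles within `1/(k+1)` of `t`. -/
def paramSector (Φ : ℂ × ℂ → ℂ) (H : Set (ℂ × ℂ)) (t : ℝ) (k : ℕ) : Set (ℂ × ℂ) :=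
  {w ∈ H | ∃ r θ' : ℝ, 1 - 1 / (k + 1) < r ∧ r < 1 ∧ |θ' - t| < 1 / (k + 1) ∧
    Φ w = (r : ℂ) * Complex.exp (2 * Real.pi * Complex.I * (θ' : ℂ))}

/-- The impression of the parameter ray of angle `t`. -/
def impression (Φ : ℂ × ℂ → ℂ) (H : Set (ℂ × ℂ)) (t : ℝ) : Set (ℂ × ℂ) :=
  ⋂ k : ℕ, closure (paramSector Φ H t k)

end

section Continuation

variable {E : Type*} [NormedAddCommGroup E] [NormedSpace ℂ E]

lemma exists_mem_ball_inter_of_dist_lt {b₁ b₂ : ℂ} {d₁ d₂ r : ℝ} (h₁ : 0 < d₁) (h₂ : 0 < d₂)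
    (hr : 0 < r) (n₁ : ‖b₁‖ ≤ r) (n₂ : ‖b₂‖ ≤ r) (h : dist b₁ b₂ < d₁ + d₂) :
    (ball b₁ d₁ ∩ ball b₂ d₂ ∩ ball (0 : ℂ) r).Nonempty := by
  have hs : 0 < d₁ + d₂ := by positivity
  set m : ℂ := (d₂ / (d₁ + d₂)) • b₁ + (d₁ / (d₁ + d₂)) • b₂ with hm
  have hc : m ∈ closedBall (0 : ℂ) r :=
    (convex_closedBall (0 : ℂ) r) (by simpa using n₁) (by simpa using n₂)
      (by positivity) (by positivity) (by field_simp; ring)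
  rw [← closure_ball (0 : ℂ) hr.ne'] at hc
  have hsum : d₂ / (d₁ + d₂) + d₁ / (d₁ + d₂) = 1 := by field_simp; ring
  have e₁ : m - b₁ = (d₁ / (d₁ + d₂)) • (b₂ - b₁) := by
    have : b₁ = (d₂ / (d₁ + d₂) + d₁ / (d₁ + d₂)) • b₁ := by rw [hsum, one_smul]
    rw [hm]; nth_rewrite 2 [this]; rw [add_smul, smul_sub]; abel
  have e₂ : m - b₂ = (d₂ / (d₁ + d₂)) • (b₁ - b₂) := by
    have : b₂ = (d₂ / (d₁ + d₂) + d₁ / (d₁ + d₂)) • b₂ := by rw [hsum, one_smul]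
    rw [hm]; nth_rewrite 2 [this]; rw [add_smul, smul_sub]; abel
  have hm₁ : m ∈ ball b₁ d₁ := by
    rw [mem_ball, dist_eq_norm, e₁, norm_smul, Real.norm_of_nonneg (by positivity), ← dist_eq_norm,
      dist_comm, div_mul_eq_mul_div, div_lt_iff₀ hs]
    exact mul_lt_mul_of_pos_left h h₁
  have hm₂ : m ∈ ball b₂ d₂ := by
    rw [mem_ball, dist_eq_norm, e₂, norm_smul, Real.norm_of_nonneg (by positivity), ← dist_eq_norm,
      div_mul_eq_mul_div, div_lt_iff₀ hs]
    exact mul_lt_mul_of_pos_left h h₂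
  exact mem_closure_iff.1 hc _ (isOpen_ball.inter isOpen_ball) ⟨hm₁, hm₂⟩

/-- One step of radial analytic continuation, keeping a pointwise property `Q`. -/
lemma analytic_extension_step (Q : ℂ → E → Prop) {r : ℝ} (hr : 0 < r) {f : ℂ → E}
    (hf : AnalyticOnNhd ℂ f (ball 0 r)) (hQ : ∀ b ∈ ball (0 : ℂ) r, Q b (f b))
    (ext : ∀ b₀ : ℂ, ‖b₀‖ = r → ∃ δ > 0, ∃ φ : ℂ → E, AnalyticOnNhd ℂ φ (ball b₀ δ) ∧
      (∀ b ∈ ball b₀ δ, Q b (φ b)) ∧ ∀ b ∈ ball b₀ δ, ‖b‖ < r → φ b = f b) :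
    ∃ r' > r, ∃ f' : ℂ → E, AnalyticOnNhd ℂ f' (ball 0 r') ∧
      (∀ b ∈ ball (0 : ℂ) r', Q b (f' b)) ∧ ∀ b ∈ ball (0 : ℂ) r, f' b = f b := by
  classical
  choose! δ hδ φ hφ hφQ hφf using ext
  set U : Set ℂ := ball 0 r ∪ ⋃ b₀ ∈ sphere (0 : ℂ) r, ball b₀ (δ b₀) with hU
  have hUo : IsOpen U := isOpen_ball.union (isOpen_biUnion fun _ _ => isOpen_ball)
  have hcU : closedBall (0 : ℂ) r ⊆ U := by
    intro b hb
    rcases (mem_closedBall_zero_iff.1 hb).lt_or_eq with h | h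
    · exact Or.inl (mem_ball_zero_iff.2 h)
    · exact Or.inr (mem_biUnion (mem_sphere_zero_iff_norm.2 h) (mem_ball_self (hδ b h)))
  obtain ⟨η, hη, hηU⟩ := (isCompact_closedBall (0 : ℂ) r).exists_thickening_subset_open hUo hcU
  rw [thickening_closedBall hη hr.le] at hηU
  have key : ∀ b₁ b₂ b : ℂ, ‖b₁‖ = r → ‖b₂‖ = r → b ∈ ball b₁ (δ b₁) → b ∈ ball b₂ (δ b₂) →
      φ b₁ b = φ b₂ b := by
    intro b₁ b₂ b h₁ h₂ hb₁ hb₂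
    have hd : dist b₁ b₂ < δ b₁ + δ b₂ := by
      have := dist_triangle_left b₁ b₂ b
      rw [mem_ball] at hb₁ hb₂
      linarith
    obtain ⟨m, ⟨hm₁, hm₂⟩, hm⟩ :=
      exists_mem_ball_inter_of_dist_lt (hδ _ h₁) (hδ _ h₂) hr h₁.le h₂.le hd
    have hconv : Convex ℝ (ball b₁ (δ b₁) ∩ ball b₂ (δ b₂)) :=
      (convex_ball _ _).inter (convex_ball _ _)
    have a₁ : AnalyticOnNhd ℂ (φ b₁) (ball b₁ (δ b₁) ∩ ball b₂ (δ b₂)) :=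
      (hφ b₁ h₁).mono inter_subset_left
    have a₂ : AnalyticOnNhd ℂ (φ b₂) (ball b₁ (δ b₁) ∩ ball b₂ (δ b₂)) :=
      (hφ b₂ h₂).mono inter_subset_right
    refine a₁.eqOn_of_preconnected_of_eventuallyEq a₂ hconv.isPreconnected ⟨hm₁, hm₂⟩ ?_
      ⟨hb₁, hb₂⟩
    filter_upwards [isOpen_ball.mem_nhds hm₁, isOpen_ball.mem_nhds hm₂, isOpen_ball.mem_nhds hm]
      with z z₁ z₂ z₃
    rw [hφf _ h₁ z z₁ (mem_ball_zero_iff.1 z₃), hφf _ h₂ z z₂ (mem_ball_zero_iff.1 z₃)]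
  have hidx : ∀ b : ℂ, b ∈ U → ¬ ‖b‖ < r → ∃ i : ℂ, ‖i‖ = r ∧ b ∈ ball i (δ i) := by
    intro b hb hn
    rcases hb with hb | hb
    · exact absurd (mem_ball_zero_iff.1 hb) hn
    · simp only [mem_iUnion] at hb
      obtain ⟨i, hi, hbi⟩ := hb
      exact ⟨i, mem_sphere_zero_iff_norm.1 hi, hbi⟩
  choose! i hi hib using hidx
  set f' : ℂ → E := fun b => if ‖b‖ < r then f b else φ (i b) b with hf'
  have f'in : ∀ b : ℂ, ‖b‖ < r → f' b = f b := fun b hb => by simp only [hf', if_pos hb]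
  have f'out : ∀ j : ℂ, ‖j‖ = r → ∀ b ∈ ball j (δ j), b ∈ U → f' b = φ j b := by
    intro j hj b hb hbU
    by_cases h : ‖b‖ < r
    · rw [f'in b h, hφf j hj b hb h]
    · simp only [hf', if_neg h]
      exact key _ _ _ (hi b hbU h) hj (hib b hbU h) hb
  refine ⟨η + r, by linarith, f', ?_, ?_, fun b hb => f'in b (mem_ball_zero_iff.1 hb)⟩
  · intro b hb
    have hbU := hηU hb
    by_cases h : ‖b‖ < r
    · have hb' : b ∈ ball (0 : ℂ) r := mem_ball_zero_iff.2 h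
      refine (hf b hb').congr ?_
      filter_upwards [isOpen_ball.mem_nhds hb'] with z hz
      exact (f'in z (mem_ball_zero_iff.1 hz)).symm
    · refine (hφ _ (hi b hbU h) b (hib b hbU h)).congr ?_
      filter_upwards [isOpen_ball.mem_nhds (hib b hbU h), hUo.mem_nhds hbU] with z hz hzU
      exact (f'out _ (hi b hbU h) z hz hzU).symm
  · intro b hb
    have hbU := hηU hb
    by_cases h : ‖b‖ < r
    · rw [f'in b h]; exact hQ b (mem_ball_zero_iff.2 h)
    · rw [f'out _ (hi b hbU h) b (hib b hbU h) hbU]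
      exact hφQ _ (hi b hbU h) b (hib b hbU h)

/-- Radial analytic continuation, keeping a pointwise property `Q`. -/
theorem analytic_continuation_ball (Q : ℂ → E → Prop) {ε R : ℝ} (hε : 0 < ε) (hεR : ε ≤ R)
    {f₀ : ℂ → E} (hf₀ : AnalyticOnNhd ℂ f₀ (ball 0 ε)) (hQ₀ : ∀ b ∈ ball (0 : ℂ) ε, Q b (f₀ b))
    (ext : ∀ r, ε ≤ r → r < R → ∀ f : ℂ → E, AnalyticOnNhd ℂ f (ball 0 r) →
      (∀ b ∈ ball (0 : ℂ) r, Q b (f b)) → (∀ b ∈ ball (0 : ℂ) ε, f b = f₀ b) →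
      ∀ b₀ : ℂ, ‖b₀‖ = r → ∃ δ > 0, ∃ φ : ℂ → E, AnalyticOnNhd ℂ φ (ball b₀ δ) ∧
        (∀ b ∈ ball b₀ δ, Q b (φ b)) ∧ ∀ b ∈ ball b₀ δ, ‖b‖ < r → φ b = f b) :
    ∃ f : ℂ → E, AnalyticOnNhd ℂ f (ball 0 R) ∧ (∀ b ∈ ball (0 : ℂ) R, Q b (f b)) ∧
      ∀ b ∈ ball (0 : ℂ) ε, f b = f₀ b := by
  classical
  set S : Set ℝ := {r | ε ≤ r ∧ r ≤ R ∧ ∃ f : ℂ → E, AnalyticOnNhd ℂ f (ball 0 r) ∧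
    (∀ b ∈ ball (0 : ℂ) r, Q b (f b)) ∧ ∀ b ∈ ball (0 : ℂ) ε, f b = f₀ b} with hS
  have hεS : ε ∈ S := ⟨le_rfl, hεR, f₀, hf₀, hQ₀, fun _ _ => rfl⟩
  have hbdd : BddAbove S := ⟨R, fun r hr => hr.2.1⟩
  set s := sSup S with hs
  have hεs : ε ≤ s := le_csSup hbdd hεS
  have hsR : s ≤ R := csSup_le ⟨ε, hεS⟩ fun r hr => hr.2.1
  have hsS : s ∈ S := by
    refine ⟨hεs, hsR, ?_⟩
    have hch : ∀ r : ℝ, r ∈ S → ∃ f : ℂ → E, AnalyticOnNhd ℂ f (ball 0 r) ∧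
      (∀ b ∈ ball (0 : ℂ) r, Q b (f b)) ∧ ∀ b ∈ ball (0 : ℂ) ε, f b = f₀ b := fun r hr => hr.2.2
    choose! F hFa hFQ hF0 using hch
    have hex : ∀ b : ℂ, ‖b‖ < s → ∃ r ∈ S, ‖b‖ < r := fun b hb => exists_lt_of_lt_csSup ⟨ε, hεS⟩ hb
    choose! ρ hρS hρ using hex
    have hcons : ∀ r₁ ∈ S, ∀ r₂ ∈ S, r₁ ≤ r₂ → ∀ b ∈ ball (0 : ℂ) r₁, F r₁ b = F r₂ b := by
      intro r₁ h₁ r₂ h₂ h12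
      have hεr : (0 : ℂ) ∈ ball (0 : ℂ) ε := mem_ball_self hε
      refine (hFa r₁ h₁).eqOn_of_preconnected_of_eventuallyEq
        ((hFa r₂ h₂).mono (ball_subset_ball h12)) (convex_ball _ _).isPreconnected
        (ball_subset_ball h₁.1 hεr) ?_
      filter_upwards [isOpen_ball.mem_nhds hεr] with z hz
      rw [hF0 r₁ h₁ z hz, hF0 r₂ h₂ z hz]
    have hcons' : ∀ r₁ ∈ S, ∀ r₂ ∈ S, ∀ b : ℂ, ‖b‖ < r₁ → ‖b‖ < r₂ → F r₁ b = F r₂ b := by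
      intro r₁ h₁ r₂ h₂ b hb₁ hb₂
      rcases le_total r₁ r₂ with h | h
      · exact hcons r₁ h₁ r₂ h₂ h b (mem_ball_zero_iff.2 hb₁)
      · exact (hcons r₂ h₂ r₁ h₁ h b (mem_ball_zero_iff.2 hb₂)).symm
    refine ⟨fun b => F (ρ b) b, ?_, ?_, ?_⟩
    · intro b hb
      have hb' : ‖b‖ < s := mem_ball_zero_iff.1 hb
      have hbρ : b ∈ ball (0 : ℂ) (ρ b) := mem_ball_zero_iff.2 (hρ b hb')
      refine (hFa _ (hρS b hb') b hbρ).congr ?_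
      filter_upwards [isOpen_ball.mem_nhds hb, isOpen_ball.mem_nhds hbρ] with z hz hz'
      have hz2 : ‖z‖ < s := mem_ball_zero_iff.1 hz
      exact hcons' _ (hρS b hb') _ (hρS z hz2) z (mem_ball_zero_iff.1 hz') (hρ z hz2)
    · intro b hb
      have hb' : ‖b‖ < s := mem_ball_zero_iff.1 hb
      exact hFQ _ (hρS b hb') b (mem_ball_zero_iff.2 (hρ b hb'))
    · intro b hb
      have hb' : ‖b‖ < s := (mem_ball_zero_iff.1 hb).trans_le hεs
      exact hF0 _ (hρS b hb') b hb
  rcases hsR.lt_or_eq with hlt | heq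
  · exfalso
    obtain ⟨-, -, f, hfa, hfQ, hf0⟩ := hsS
    obtain ⟨r', hr', f', hf'a, hf'Q, hf'f⟩ := analytic_extension_step Q (hε.trans_le hεs) hfa hfQ
      (ext s hεs hlt f hfa hfQ hf0)
    have hmem : min r' R ∈ S := by
      refine ⟨le_min (hεs.trans hr'.le) hεR, min_le_right _ _, f',
        hf'a.mono (ball_subset_ball (min_le_left _ _)),
        fun b hb => hf'Q b (ball_subset_ball (min_le_left _ _) hb), fun b hb => ?_⟩
      rw [hf'f b (ball_subset_ball hεs hb), hf0 b hb]
    have : s < min r' R := lt_min hr' hlt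
    exact absurd (le_csSup hbdd hmem) (not_le.2 this)
  · rw [← heq]; exact hsS.2.2

end Continuation

section BottcherProduct

/-- The series `∑ j, d ^ (-(j + 1)) * ℓ (n + j)` of logarithmic corrections in a Böttcher
product. -/
noncomputable def logSum (d : ℕ) (l : ℕ → ℂ) (n : ℕ) : ℂ :=
  ∑' j : ℕ, ((d : ℂ)⁻¹) ^ (j + 1) * l (n + j)

variable {d : ℕ} {C : ℝ} {l : ℕ → ℂ}

lemma norm_logSum_term_le (hd : 2 ≤ d) (hl : ∀ k, ‖l k‖ ≤ C) (n j : ℕ) :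
    ‖((d : ℂ)⁻¹) ^ (j + 1) * l (n + j)‖ ≤ (1 / 2 : ℝ) ^ (j + 1) * C := by
  rw [norm_mul, norm_pow, norm_inv, Complex.norm_natCast]
  have h2 : (2 : ℝ) ≤ d := by exact_mod_cast hd
  have : ((d : ℝ)⁻¹) ≤ 1 / 2 := by rw [one_div]; exact inv_anti₀ (by norm_num) h2
  gcongr
  exact hl _

lemma hasSum_half_mul (C : ℝ) : HasSum (fun j : ℕ => (1 / 2 : ℝ) ^ (j + 1) * C) C := by
  have h := (hasSum_geometric_two.mul_left (1 / 2 : ℝ)).mul_right C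
  rw [show 1 / 2 * 2 * C = C by ring] at h
  simpa only [pow_succ'] using h

lemma summable_logSum (hd : 2 ≤ d) (hl : ∀ k, ‖l k‖ ≤ C) (n : ℕ) :
    Summable fun j : ℕ => ((d : ℂ)⁻¹) ^ (j + 1) * l (n + j) :=
  .of_norm_bounded (hasSum_half_mul C).summable (norm_logSum_term_le hd hl n)

lemma norm_logSum_le (hd : 2 ≤ d) (n : ℕ) (hl : ∀ k, ‖l (n + k)‖ ≤ C) : ‖logSum d l n‖ ≤ C :=
  tsum_of_norm_bounded (hasSum_half_mul C) fun j => by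
    simpa using norm_logSum_term_le (l := fun k => l (n + k)) hd hl 0 j

lemma mul_logSum (hd : 2 ≤ d) (hl : ∀ k, ‖l k‖ ≤ C) (n : ℕ) :
    (d : ℂ) * logSum d l n = l n + logSum d l (n + 1) := by
  have hd0 : (d : ℂ) ≠ 0 := by exact_mod_cast (by omega : d ≠ 0)
  rw [logSum, (summable_logSum hd hl n).tsum_eq_zero_add, mul_add, ← tsum_mul_left, logSum]
  congr 1
  · simp [mul_inv_cancel_left₀ hd0]
  · congr 1; ext j
    rw [pow_succ' _ (j + 1), ← mul_assoc, mul_inv_cancel_left₀ hd0]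
    ring_nf

lemma tendsto_logSum (hd : 2 ≤ d) (hl0 : Tendsto l atTop (𝓝 0)) :
    Tendsto (logSum d l) atTop (𝓝 0) := by
  rw [Metric.tendsto_atTop] at hl0 ⊢
  intro ε hε
  obtain ⟨N, hN⟩ := hl0 (ε / 2) (by positivity)
  refine ⟨N, fun n hn => ?_⟩
  rw [dist_zero_right]
  have := norm_logSum_le (C := ε / 2) (l := l) hd n fun k => by
    simpa using (hN (n + k) (by omega)).le
  linarith

lemma bottcher_pow (hd : 2 ≤ d) (hl : ∀ k, ‖l k‖ ≤ C) {β : ℕ → ℂ}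
    (hβ : ∀ k, β (k + 1) = β k ^ d * Complex.exp (l k)) (n : ℕ) :
    (β 0 * Complex.exp (logSum d l 0)) ^ d ^ n = β n * Complex.exp (logSum d l n) := by
  induction n with
  | zero => simp
  | succ n ih =>
    rw [pow_succ, pow_mul, ih, mul_pow, ← Complex.exp_nat_mul, mul_logSum hd hl, Complex.exp_add,
      hβ]
    ring

lemma differentiableOn_logSum {O : Set ℂ} (hO : IsOpen O) (hd : 2 ≤ d) {L : ℕ → ℂ → ℂ}
    (hL : ∀ k, DifferentiableOn ℂ (L k) O) (hC : ∀ k, ∀ z ∈ O, ‖L k z‖ ≤ C) (n : ℕ) :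
    DifferentiableOn ℂ (fun z => logSum d (fun k => L k z) n) O := by
  refine Complex.differentiableOn_tsum_of_summable_norm (hasSum_half_mul C).summable
    (fun j => ((hL (n + j)).const_mul _)) hO fun j z hz => ?_
  exact norm_logSum_term_le (l := fun k => L k z) hd (fun k => hC k z hz) n j

lemma deriv_bound_of_bounded {O : Set ℂ} (hO : IsOpen O) {z₀ : ℂ} (hz₀ : z₀ ∈ O)
    {S : ℕ → ℂ → ℂ} (hS : ∀ n, DifferentiableOn ℂ (S n) O) (hC : ∀ n, ∀ z ∈ O, ‖S n z‖ ≤ C) :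
    ∃ M, ∀ n, ‖deriv (S n) z₀‖ ≤ M := by
  obtain ⟨r, hr, hrO⟩ := Metric.isOpen_iff.1 hO z₀ hz₀
  refine ⟨C / (r / 2), fun n => ?_⟩
  have hsub : closedBall z₀ (r / 2) ⊆ O :=
    (closedBall_subset_ball (by linarith)).trans hrO
  refine Complex.norm_deriv_le_of_forall_mem_sphere_norm_le (by positivity) ?_ fun z hz =>
    hC n z (hsub (sphere_subset_closedBall hz))
  refine DifferentiableOn.diffContOnCl ?_
  rw [closure_ball _ (by positivity)]
  exact (hS n).mono hsub

/-- A squaring sequence converging to `1` is eventually equal to `1`. -/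
lemma eventually_eq_one_of_sq {u : ℕ → ℂ} (hu : ∀ n, u (n + 1) = u n ^ 2)
    (h : Tendsto u atTop (𝓝 1)) : ∃ N, ∀ n ≥ N, u n = 1 := by
  rw [Metric.tendsto_atTop] at h
  obtain ⟨N, hN⟩ := h (1 / 2) (by norm_num)
  have key : ∀ k m, N ≤ m → (3 / 2 : ℝ) ^ k * ‖u m - 1‖ ≤ 1 / 2 := by
    intro k
    induction k with
    | zero => intro m hm; simpa [dist_eq_norm] using (hN m hm).le
    | succ k ih =>
      intro m hm
      have h1 : u (m + 1) - 1 = (u m + 1) * (u m - 1) := by rw [hu]; ring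
      have h2 : (3 / 2 : ℝ) ≤ ‖u m + 1‖ := by
        have h3 := hN m hm
        rw [dist_eq_norm] at h3
        have h4 : ‖(2 : ℂ)‖ ≤ ‖u m + 1‖ + ‖u m - 1‖ := by
          have : (2 : ℂ) = (u m + 1) - (u m - 1) := by ring
          rw [this]; exact norm_sub_le _ _
        rw [Complex.norm_ofNat] at h4
        linarith
      have h5 := ih (m + 1) (by omega)
      rw [h1, norm_mul] at h5
      calc (3 / 2 : ℝ) ^ (k + 1) * ‖u m - 1‖ = (3 / 2 : ℝ) ^ k * (3 / 2 * ‖u m - 1‖) := by ring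
        _ ≤ (3 / 2 : ℝ) ^ k * (‖u m + 1‖ * ‖u m - 1‖) := by gcongr
        _ ≤ 1 / 2 := h5
  refine ⟨N, fun n hn => ?_⟩
  by_contra hne
  have hpos : 0 < ‖u n - 1‖ := norm_pos_iff.2 (sub_ne_zero.2 hne)
  obtain ⟨k, hk⟩ := pow_unbounded_of_one_lt (1 / ‖u n - 1‖) (by norm_num : (1 : ℝ) < 3 / 2)
  have := key k n hn
  rw [div_lt_iff₀ hpos] at hk
  linarith

end BottcherProduct

section CubicAlgebra

lemma hasStrictDerivAt_cubic (c a z : ℂ) :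
    HasStrictDerivAt (cubic c a) (3 * (z ^ 2 - c ^ 2)) z := by
  have h := (((hasStrictDerivAt_id z).pow 3).sub ((hasStrictDerivAt_id z).const_mul
    (3 * c ^ 2))).add
    (hasStrictDerivAt_const z a)
  refine h.congr_deriv ?_
  simp; ring

lemma hasDerivAt_cubic (c a z : ℂ) : HasDerivAt (cubic c a) (3 * (z ^ 2 - c ^ 2)) z :=
  (hasStrictDerivAt_cubic c a z).hasDerivAt

lemma cubic_roots (c a w : ℂ) : ∃ z₁ z₂ z₃ : ℂ, z₁ + z₂ + z₃ = 0 ∧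
    3 * c ^ 2 = z₁ ^ 2 + z₁ * z₂ + z₂ ^ 2 ∧ w = a + z₁ * z₂ * z₃ := by
  obtain ⟨z₁, h₁⟩ : ∃ z₁ : ℂ, z₁ ^ 3 - 3 * c ^ 2 * z₁ + (a - w) = 0 := by
    obtain ⟨z, hz⟩ := IsAlgClosed.exists_root
      (Polynomial.X ^ 3 + (Polynomial.C (-(3 * c ^ 2)) * Polynomial.X + Polynomial.C (a - w)) :
        Polynomial ℂ) (by
        have : (Polynomial.X ^ 3 + (Polynomial.C (-(3 * c ^ 2)) * Polynomial.X
          + Polynomial.C (a - w)) : Polynomial ℂ).degree = 3 := by compute_degree!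
        rw [this]; norm_num)
    refine ⟨z, ?_⟩
    simp [Polynomial.IsRoot] at hz
    linear_combination hz
  obtain ⟨s, hs⟩ := IsAlgClosed.exists_pow_nat_eq (12 * c ^ 2 - 3 * z₁ ^ 2) (n := 2) (by norm_num)
  refine ⟨z₁, (-z₁ + s) / 2, (-z₁ - s) / 2, by ring, by linear_combination (-1/4 : ℂ) * hs, ?_⟩
  linear_combination -h₁ + z₁ / 4 * hs

lemma cubic_sub_eq {c a w z₁ z₂ z₃ : ℂ} (h : z₁ + z₂ + z₃ = 0)
    (h' : 3 * c ^ 2 = z₁ ^ 2 + z₁ * z₂ + z₂ ^ 2) (hw : w = a + z₁ * z₂ * z₃) (z : ℂ) :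
    cubic c a z - w = (z - z₁) * (z - z₂) * (z - z₃) := by
  have e3 : z₃ = -z₁ - z₂ := by linear_combination h
  subst e3
  simp only [cubic]
  rw [hw, h']
  ring

/-- The push-forward under the cubic of the quadratic differential `dζ² / (ζ - z)`, in terms of
the roots. -/
lemma sum_roots_inv {z₁ z₂ z₃ z c e : ℂ} (h : z₁ + z₂ + z₃ = 0)
    (h' : 3 * c ^ 2 = z₁ ^ 2 + z₁ * z₂ + z₂ ^ 2) (he : e = z₁ * z₂ * z₃)
    (h12 : z₁ ≠ z₂) (h13 : z₁ ≠ z₃) (h23 : z₂ ≠ z₃) (h1 : z₁ ≠ z) (h2 : z₂ ≠ z) (h3 : z₃ ≠ z)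
    (hc : c ≠ 0) (hz : z ^ 2 ≠ c ^ 2) (he1 : e ≠ -2 * c ^ 3) (he2 : e ≠ 2 * c ^ 3) :
    1 / ((z₁ - z) * (3 * (z₁ ^ 2 - c ^ 2)) ^ 2) + 1 / ((z₂ - z) * (3 * (z₂ ^ 2 - c ^ 2)) ^ 2)
      + 1 / ((z₃ - z) * (3 * (z₃ ^ 2 - c ^ 2)) ^ 2)
    = 1 / (3 * (z ^ 2 - c ^ 2)) * (1 / ((z₁ - z) * (z₂ - z) * (z₃ - z)))
      + 1 / (6 * c * (c - z)) * (1 / (e + 2 * c ^ 3))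
      + 1 / (6 * c * (c + z)) * (1 / (e - 2 * c ^ 3)) := by
  have e3 : z₃ = -z₁ - z₂ := by linear_combination h
  have d1 : 3 * (z₁ ^ 2 - c ^ 2) = (z₁ - z₂) * (z₁ - z₃) := by rw [e3]; linear_combination -h'
  have d2 : 3 * (z₂ ^ 2 - c ^ 2) = (z₂ - z₁) * (z₂ - z₃) := by rw [e3]; linear_combination -h'
  have d3 : 3 * (z₃ ^ 2 - c ^ 2) = (z₃ - z₁) * (z₃ - z₂) := by rw [e3]; linear_combination -h'
  have hcz : c - z ≠ 0 := fun hh => hz (by rw [sub_eq_zero.1 hh])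
  have hcz' : c + z ≠ 0 := fun hh => hz (by rw [eq_neg_of_add_eq_zero_left hh]; ring)
  have hE1 : e + 2 * c ^ 3 ≠ 0 := fun hh => he1 (by linear_combination hh)
  have hE2 : e - 2 * c ^ 3 ≠ 0 := fun hh => he2 (by linear_combination hh)
  have hdisc : (e + 2 * c ^ 3) * (e - 2 * c ^ 3) =
      -((z₁ - z₂) * (z₁ - z₃) * (z₂ - z₃)) ^ 2 / 27 := by
    have : (e + 2 * c ^ 3) * (e - 2 * c ^ 3) = e ^ 2 - 4 / 27 * (3 * c ^ 2) ^ 3 := by ring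
    rw [this, h', he, e3]; ring
  have hcomb : 1 / (6 * c * (c - z)) * (1 / (e + 2 * c ^ 3))
      + 1 / (6 * c * (c + z)) * (1 / (e - 2 * c ^ 3))
      = (3 * e - 2 * (3 * c ^ 2) * z) / ((9 * (c ^ 2 - z ^ 2)) *
        ((e + 2 * c ^ 3) * (e - 2 * c ^ 3))) := by
    rw [show c ^ 2 - z ^ 2 = (c - z) * (c + z) by ring]
    obtain ⟨A, hA⟩ : ∃ A, A = e + 2 * c ^ 3 := ⟨_, rfl⟩
    obtain ⟨B, hB⟩ : ∃ B, B = e - 2 * c ^ 3 := ⟨_, rfl⟩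
    rw [← hA] at hE1; rw [← hB] at hE2
    rw [← hA, ← hB]
    field_simp
    rw [hA, hB]; ring
  rw [add_assoc (1 / (3 * (z ^ 2 - c ^ 2)) * _), hcomb, hdisc, d1, d2, d3, he,
    show 9 * (c ^ 2 - z ^ 2) = 3 * (3 * c ^ 2 - 3 * z ^ 2) by ring, h',
    show 3 * (z ^ 2 - c ^ 2) = 3 * z ^ 2 - 3 * c ^ 2 by ring, h']
  have hne : 3 * z ^ 2 - (z₁ ^ 2 + z₁ * z₂ + z₂ ^ 2) ≠ 0 := by
    rw [← h']; intro hh; exact hz (by linear_combination hh / 3)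
  have hne' : z₁ ^ 2 + z₁ * z₂ + z₂ ^ 2 - 3 * z ^ 2 ≠ 0 := by
    intro hh; exact hne (by linear_combination -hh)
  obtain ⟨p, hp⟩ : ∃ p, p = z₁ - z₂ := ⟨_, rfl⟩
  obtain ⟨q, hq⟩ : ∃ q, q = z₁ - z₃ := ⟨_, rfl⟩
  obtain ⟨s, hs⟩ : ∃ s, s = z₂ - z₃ := ⟨_, rfl⟩
  obtain ⟨u, hu⟩ : ∃ u, u = z₁ - z := ⟨_, rfl⟩
  obtain ⟨v, hv⟩ : ∃ v, v = z₂ - z := ⟨_, rfl⟩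
  obtain ⟨y, hy⟩ : ∃ y, y = z₃ - z := ⟨_, rfl⟩
  obtain ⟨D, hD⟩ : ∃ D, D = 3 * z ^ 2 - (z₁ ^ 2 + z₁ * z₂ + z₂ ^ 2) := ⟨_, rfl⟩
  have n1 : p ≠ 0 := hp ▸ sub_ne_zero.2 h12
  have n2 : q ≠ 0 := hq ▸ sub_ne_zero.2 h13
  have n3 : s ≠ 0 := hs ▸ sub_ne_zero.2 h23
  have m1 : u ≠ 0 := hu ▸ sub_ne_zero.2 h1
  have m2 : v ≠ 0 := hv ▸ sub_ne_zero.2 h2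
  have m3 : y ≠ 0 := hy ▸ sub_ne_zero.2 h3
  rw [← hD] at hne
  rw [show z₁ ^ 2 + z₁ * z₂ + z₂ ^ 2 - 3 * z ^ 2 = -D by rw [hD]; ring, show z₂ - z₁ = -p by
    rw [hp]; ring, show z₃ - z₁ = -q by rw [hq]; ring, show z₃ - z₂ = -s by rw [hs]; ring, ← hD,
    ← hp, ← hq, ← hs, ← hu, ← hv, ← hy]
  field_simp
  rw [hp, hq, hs, hu, hv, hy, hD, e3]
  ring

lemma sum_roots_inv_crit {z₁ z₂ z₃ c e : ℂ} (h : z₁ + z₂ + z₃ = 0)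
    (h' : 3 * c ^ 2 = z₁ ^ 2 + z₁ * z₂ + z₂ ^ 2) (he : e = z₁ * z₂ * z₃)
    (h12 : z₁ ≠ z₂) (h13 : z₁ ≠ z₃) (h23 : z₂ ≠ z₃)
    (hc : c ≠ 0) (he1 : e ≠ -2 * c ^ 3) (he2 : e ≠ 2 * c ^ 3) :
    1 / ((z₁ - c) * (3 * (z₁ ^ 2 - c ^ 2)) ^ 2) + 1 / ((z₂ - c) * (3 * (z₂ ^ 2 - c ^ 2)) ^ 2)
      + 1 / ((z₃ - c) * (3 * (z₃ ^ 2 - c ^ 2)) ^ 2)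
    = 1 / (12 * c ^ 2) * (1 / (e - 2 * c ^ 3)) - 1 / (12 * c ^ 2) * (1 / (e + 2 * c ^ 3)) := by
  have e3 : z₃ = -z₁ - z₂ := by linear_combination h
  have d1 : 3 * (z₁ ^ 2 - c ^ 2) = (z₁ - z₂) * (z₁ - z₃) := by rw [e3]; linear_combination -h'
  have d2 : 3 * (z₂ ^ 2 - c ^ 2) = (z₂ - z₁) * (z₂ - z₃) := by rw [e3]; linear_combination -h'
  have d3 : 3 * (z₃ ^ 2 - c ^ 2) = (z₃ - z₁) * (z₃ - z₂) := by rw [e3]; linear_combination -h'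
  have hE1 : e + 2 * c ^ 3 ≠ 0 := fun hh => he1 (by linear_combination hh)
  have hE2 : e - 2 * c ^ 3 ≠ 0 := fun hh => he2 (by linear_combination hh)
  have hdisc : (e + 2 * c ^ 3) * (e - 2 * c ^ 3) =
      -((z₁ - z₂) * (z₁ - z₃) * (z₂ - z₃)) ^ 2 / 27 := by
    have : (e + 2 * c ^ 3) * (e - 2 * c ^ 3) = e ^ 2 - 4 / 27 * (3 * c ^ 2) ^ 3 := by ring
    rw [this, h', he, e3]; ring
  have hcomb : 1 / (12 * c ^ 2) * (1 / (e - 2 * c ^ 3)) - 1 / (12 * c ^ 2) * (1 / (e + 2 * c ^ 3))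
      = c / (3 * ((e + 2 * c ^ 3) * (e - 2 * c ^ 3))) := by
    obtain ⟨A, hA⟩ : ∃ A, A = e + 2 * c ^ 3 := ⟨_, rfl⟩
    obtain ⟨B, hB⟩ : ∃ B, B = e - 2 * c ^ 3 := ⟨_, rfl⟩
    rw [← hA] at hE1; rw [← hB] at hE2
    rw [← hA, ← hB]
    field_simp
    rw [hA, hB]; ring
  have hprod : (z₁ - c) * (z₂ - c) * (z₃ - c) = e + 2 * c ^ 3 := by
    rw [e3, he, e3]; linear_combination -c * h'
  have m1 : z₁ - c ≠ 0 := fun hh => hE1 (by rw [← hprod, hh]; ring)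
  have m2 : z₂ - c ≠ 0 := fun hh => hE1 (by rw [← hprod, hh]; ring)
  have m3 : z₃ - c ≠ 0 := fun hh => hE1 (by rw [← hprod, hh]; ring)
  have key : (z₂ - z₃) ^ 2 * ((z₂ - c) * (z₃ - c)) + (z₁ - z₃) ^ 2 * ((z₁ - c) * (z₃ - c)) +
      (z₁ - z₂) ^ 2 * ((z₁ - c) * (z₂ - c)) = -9 * c * ((z₁ - c) * (z₂ - c) * (z₃ - c)) := by
    subst e3
    linear_combination -(3 * c ^ 2 - 4 * (z₁ ^ 2 + z₁ * z₂ + z₂ ^ 2)) * h'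
  obtain ⟨p, hp⟩ : ∃ p, p = z₁ - z₂ := ⟨_, rfl⟩
  obtain ⟨q, hq⟩ : ∃ q, q = z₁ - z₃ := ⟨_, rfl⟩
  obtain ⟨s, hs⟩ : ∃ s, s = z₂ - z₃ := ⟨_, rfl⟩
  obtain ⟨u, hu⟩ : ∃ u, u = z₁ - c := ⟨_, rfl⟩
  obtain ⟨v, hv⟩ : ∃ v, v = z₂ - c := ⟨_, rfl⟩
  obtain ⟨y, hy⟩ : ∃ y, y = z₃ - c := ⟨_, rfl⟩
  have n1 : p ≠ 0 := hp ▸ sub_ne_zero.2 h12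
  have n2 : q ≠ 0 := hq ▸ sub_ne_zero.2 h13
  have n3 : s ≠ 0 := hs ▸ sub_ne_zero.2 h23
  rw [← hu] at m1
  rw [← hv] at m2
  rw [← hy] at m3
  rw [hcomb, hdisc, d1, d2, d3, show z₂ - z₁ = -p by rw [hp]; ring,
    show z₃ - z₁ = -q by rw [hq]; ring, show z₃ - z₂ = -s by rw [hs]; ring,
    ← hp, ← hq, ← hs, ← hu, ← hv, ← hy]
  rw [← hp, ← hq, ← hs, ← hu, ← hv, ← hy] at key
  field_simp
  linear_combination 3 * key

end CubicAlgebra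

section Transfer

lemma roots_of_distinct {c a w z₁ z₂ z₃ : ℂ} (h₁ : cubic c a z₁ = w) (h₂ : cubic c a z₂ = w)
    (h₃ : cubic c a z₃ = w) (h12 : z₁ ≠ z₂) (h13 : z₁ ≠ z₃) (h23 : z₂ ≠ z₃) :
    z₁ + z₂ + z₃ = 0 ∧ 3 * c ^ 2 = z₁ ^ 2 + z₁ * z₂ + z₂ ^ 2 ∧ w - a = z₁ * z₂ * z₃ := by
  simp only [cubic] at h₁ h₂ h₃
  have e1 : z₁ ^ 2 + z₁ * z₂ + z₂ ^ 2 - 3 * c ^ 2 = 0 := by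
    refine (mul_eq_zero.1 (?_ : (z₁ - z₂) * _ = 0)).resolve_left (sub_ne_zero.2 h12)
    linear_combination h₁ - h₂
  have e2 : z₁ ^ 2 + z₁ * z₃ + z₃ ^ 2 - 3 * c ^ 2 = 0 := by
    refine (mul_eq_zero.1 (?_ : (z₁ - z₃) * _ = 0)).resolve_left (sub_ne_zero.2 h13)
    linear_combination h₁ - h₃
  have e3 : z₁ + z₂ + z₃ = 0 := by
    refine (mul_eq_zero.1 (?_ : (z₂ - z₃) * _ = 0)).resolve_left (sub_ne_zero.2 h23)
    linear_combination e1 - e2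
  refine ⟨e3, by linear_combination -e1, ?_⟩
  linear_combination -h₁ + z₁ * e1 - z₁ * z₂ * e3

/-- The quadratic differential with simple poles encoded by a finitely supported function. -/
noncomputable def simplePoles (α : ℂ →₀ ℂ) (ζ : ℂ) : ℂ :=
  Finsupp.linearCombination ℂ (fun z => (ζ - z)⁻¹) α

/-- The push-forward under the cubic of the quadratic differential with one simple pole `z`. -/
noncomputable def transferBasis (c a z : ℂ) : ℂ →₀ ℂ :=
  if z = c then
    Finsupp.single (cubic c a (-c)) (1 / (12 * c ^ 2)) -
      Finsupp.single (cubic c a c) (1 / (12 * c ^ 2))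
  else
    Finsupp.single (cubic c a z) (1 / (3 * (z ^ 2 - c ^ 2)))
      + Finsupp.single (cubic c a c) (1 / (6 * c * (c - z)))
      + Finsupp.single (cubic c a (-c)) (1 / (6 * c * (c + z)))

/-- The push-forward operator on quadratic differentials with simple poles. -/
noncomputable def transfer (c a : ℂ) : (ℂ →₀ ℂ) →ₗ[ℂ] (ℂ →₀ ℂ) :=
  Finsupp.linearCombination ℂ (transferBasis c a)

lemma transfer_eq_sum (c a : ℂ) (α : ℂ →₀ ℂ) :
    transfer c a α = ∑ z ∈ α.support, α z • transferBasis c a z := rfl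

lemma support_transfer {c a : ℂ} {X : Set ℂ} (hfX : MapsTo (cubic c a) X X) (h1 : cubic c a c ∈ X)
    (h2 : cubic c a (-c) ∈ X) {α : ℂ →₀ ℂ} (hα : (α.support : Set ℂ) ⊆ X) :
    ((transfer c a α).support : Set ℂ) ⊆ X := by
  have hs : ∀ z ∈ X, ∀ x : ℂ, Finsupp.single z x ∈ Finsupp.supported ℂ ℂ X :=
    fun z hz x => Finsupp.single_mem_supported ℂ x hz
  rw [← Finsupp.mem_supported ℂ, transfer_eq_sum]
  refine Submodule.sum_mem _ fun z hz => Submodule.smul_mem _ _ ?_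
  rw [transferBasis]
  split_ifs
  · exact Submodule.sub_mem _ (hs _ h2 _) (hs _ h1 _)
  · exact Submodule.add_mem _ (Submodule.add_mem _ (hs _ (hfX (hα hz)) _) (hs _ h1 _)) (hs _ h2 _)

lemma simplePoles_transfer {c a w z₁ z₂ z₃ : ℂ} (hc : c ≠ 0) {α : ℂ →₀ ℂ}
    (hα : -c ∉ α.support) (h1 : w ≠ cubic c a c) (h2 : w ≠ cubic c a (-c))
    (h₁ : cubic c a z₁ = w) (h₂ : cubic c a z₂ = w)
    (h₃ : cubic c a z₃ = w) (h12 : z₁ ≠ z₂) (h13 : z₁ ≠ z₃) (h23 : z₂ ≠ z₃)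
    (hw : ∀ z ∈ α.support, cubic c a z ≠ w) :
    simplePoles (transfer c a α) w = simplePoles α z₁ / (3 * (z₁ ^ 2 - c ^ 2)) ^ 2
      + simplePoles α z₂ / (3 * (z₂ ^ 2 - c ^ 2)) ^ 2
      + simplePoles α z₃ / (3 * (z₃ ^ 2 - c ^ 2)) ^ 2 := by
  obtain ⟨hs, hs', he⟩ := roots_of_distinct h₁ h₂ h₃ h12 h13 h23
  have e1 : w - cubic c a c = (w - a) + 2 * c ^ 3 := by simp only [cubic]; ring
  have e2 : w - cubic c a (-c) = (w - a) - 2 * c ^ 3 := by simp only [cubic]; ring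
  have n1 : w - a ≠ -2 * c ^ 3 := fun h => h1 (sub_eq_zero.1 (by rw [e1, h]; ring))
  have n2 : w - a ≠ 2 * c ^ 3 := fun h => h2 (sub_eq_zero.1 (by rw [e2, h]; ring))
  simp only [simplePoles, transfer_eq_sum, map_sum, map_smul]
  rw [Finsupp.linearCombination_apply, Finsupp.linearCombination_apply,
    Finsupp.linearCombination_apply, Finsupp.sum, Finsupp.sum, Finsupp.sum, Finset.sum_div,
    Finset.sum_div, Finset.sum_div, ← Finset.sum_add_distrib, ← Finset.sum_add_distrib]
  refine Finset.sum_congr rfl fun z hz => ?_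
  have hwz := hw z hz
  simp only [smul_eq_mul]
  rw [mul_div_assoc, mul_div_assoc, mul_div_assoc, ← mul_add, ← mul_add]
  congr 1
  rw [transferBasis]
  split_ifs with hzc
  · subst hzc
    have := sum_roots_inv_crit hs hs' he h12 h13 h23 hc n1 n2
    simp only [map_sub, Finsupp.linearCombination_single, smul_eq_mul, e1, e2]
    simp only [one_div, mul_inv] at this
    simp only [mul_inv, div_eq_mul_inv, one_mul] at this ⊢
    rw [← this]
  · have m1 : z₁ ≠ z := fun h => hwz (h ▸ h₁)
    have m2 : z₂ ≠ z := fun h => hwz (h ▸ h₂)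
    have m3 : z₃ ≠ z := fun h => hwz (h ▸ h₃)
    have hz2 : z ^ 2 ≠ c ^ 2 := by
      intro h
      rcases sq_eq_sq_iff_eq_or_eq_neg.1 h with h | h
      · exact hzc h
      · exact hα (h ▸ hz)
    have key := sum_roots_inv hs hs' he h12 h13 h23 m1 m2 m3 hc hz2 n1 n2
    have hprod : (z₁ - z) * (z₂ - z) * (z₃ - z) = w - cubic c a z := by
      have := cubic_sub_eq (a := a) hs hs' (by linear_combination he : w = a + z₁ * z₂ * z₃) z
      linear_combination this
    rw [hprod] at key
    simp only [map_add, Finsupp.linearCombination_single, smul_eq_mul, e1, e2]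
    simp only [mul_inv, div_eq_mul_inv, one_mul] at key ⊢
    rw [← key]

lemma pairing_transfer {c a c' a' : ℂ} (hc : c ≠ 0) {X : Set ℂ} (hcX : -c ∉ X) {ξ : ℂ → ℂ}
    (hξ : ∀ z ∈ X, ξ (cubic c a z) = 3 * (z ^ 2 - c ^ 2) * ξ z + (-6 * c * c' * z + a'))
    (h1 : ξ (cubic c a c) = -6 * c * c' * c + a')
    (h2 : ξ (cubic c a (-c)) = -6 * c * c' * (-c) + a') (hξc : c ∈ X → ξ c = c')
    {α : ℂ →₀ ℂ} (hα : (α.support : Set ℂ) ⊆ X) :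
    Finsupp.linearCombination ℂ ξ (transfer c a α) = Finsupp.linearCombination ℂ ξ α := by
  simp only [transfer_eq_sum, map_sum, map_smul]
  rw [Finsupp.linearCombination_apply, Finsupp.sum]
  refine Finset.sum_congr rfl fun z hz => ?_
  congr 1
  have hzX : z ∈ X := hα hz
  rw [transferBasis]
  split_ifs with hzc
  · subst hzc
    simp only [map_sub, Finsupp.linearCombination_single, smul_eq_mul, h1, h2, hξc hzX]
    field_simp
    ring
  · have hz2 : z ^ 2 ≠ c ^ 2 := by
      intro h
      rcases sq_eq_sq_iff_eq_or_eq_neg.1 h with h | h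
      · exact hzc h
      · exact hcX (h ▸ hzX)
    have hcz : c - z ≠ 0 := fun hh => hz2 (by rw [sub_eq_zero.1 hh])
    have hcz' : c + z ≠ 0 := fun hh => hz2 (by rw [eq_neg_of_add_eq_zero_left hh]; ring)
    simp only [map_add, Finsupp.linearCombination_single, smul_eq_mul, h1, h2, hξ z hzX]
    rw [show z ^ 2 - c ^ 2 = -((c - z) * (c + z)) by ring]
    field_simp
    ring

lemma exists_branches {c a w₀ : ℂ} (h1 : w₀ ≠ cubic c a c)
    (h2 : w₀ ≠ cubic c a (-c)) :
    ∃ r > 0, ∃ s : Fin 3 → ℂ → ℂ, ∀ w ∈ ball w₀ r, w ≠ cubic c a c ∧ w ≠ cubic c a (-c) ∧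
      Injective (fun k => s k w) ∧
      ∀ k, cubic c a (s k w) = w ∧ HasDerivAt (s k) (3 * ((s k w) ^ 2 - c ^ 2))⁻¹ w := by
  obtain ⟨z₁, z₂, z₃, hs, hs', he⟩ := cubic_roots c a w₀
  have hroot := cubic_sub_eq hs hs' he
  have hcrit : ∀ z, cubic c a z = w₀ → 3 * (z ^ 2 - c ^ 2) ≠ 0 := by
    intro z hz h
    have : z ^ 2 = c ^ 2 := by linear_combination h / 3
    rcases sq_eq_sq_iff_eq_or_eq_neg.1 this with h | h
    · exact h1 (by rw [← hz, h])
    · exact h2 (by rw [← hz, h])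
  have e3 : z₃ = -z₁ - z₂ := by linear_combination hs
  have r1 : cubic c a z₁ = w₀ := sub_eq_zero.1 (by rw [hroot]; ring)
  have r2 : cubic c a z₂ = w₀ := sub_eq_zero.1 (by rw [hroot]; ring)
  have r3 : cubic c a z₃ = w₀ := sub_eq_zero.1 (by rw [hroot]; ring)
  have h12 : z₁ ≠ z₂ := by
    intro h; exact hcrit _ r1 (by rw [← h] at hs'; linear_combination -hs')
  have h13 : z₁ ≠ z₃ := by
    intro h; exact hcrit _ r1 (by rw [e3] at h; linear_combination -hs' + (z₁ - z₂) * h)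
  have h23 : z₂ ≠ z₃ := by
    intro h; exact hcrit _ r2 (by rw [e3] at h; linear_combination -hs' + (z₂ - z₁) * h)
  set ζ : Fin 3 → ℂ := ![z₁, z₂, z₃] with hζ
  have hζr : ∀ k, cubic c a (ζ k) = w₀ := by
    intro k; fin_cases k <;> simp [hζ, r1, r2, r3]
  have hζi : Injective ζ := by
    intro i j hij
    fin_cases i <;> fin_cases j <;> simp_all [eq_comm]
  have hsd : ∀ k, HasStrictDerivAt (cubic c a) (3 * ((ζ k) ^ 2 - c ^ 2)) (ζ k) :=
    fun k => hasStrictDerivAt_cubic c a _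
  set s : Fin 3 → ℂ → ℂ := fun k => (hsd k).localInverse _ _ _ (hcrit _ (hζr k)) with hsdef
  have hsw : ∀ k, s k w₀ = ζ k := by
    intro k
    have := ((hsd k).eventually_left_inverse (hcrit _ (hζr k))).self_of_nhds
    rwa [hζr k] at this
  have hev : ∀ k, ∀ᶠ w in 𝓝 w₀, cubic c a (s k w) = w := by
    intro k
    have := (hsd k).eventually_right_inverse (hcrit _ (hζr k))
    rwa [hζr k] at this
  have hsder : ∀ k, HasStrictDerivAt (s k) (3 * ((ζ k) ^ 2 - c ^ 2))⁻¹ w₀ := by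
    intro k
    have := (hsd k).to_localInverse (hcrit _ (hζr k))
    rwa [hζr k] at this
  have hcont : ∀ k, ContinuousAt (s k) w₀ := fun k => (hsder k).hasDerivAt.continuousAt
  have hcont' : ∀ k, ∀ᶠ w in 𝓝 w₀, ContinuousAt (s k) w := by
    intro k
    have he := (hsd k).hasStrictFDerivAt_equiv (hcrit _ (hζr k))
    have hmem := he.image_mem_toOpenPartialHomeomorph_target
    rw [hζr k] at hmem
    filter_upwards [(he.toOpenPartialHomeomorph _).open_target.mem_nhds hmem] with w hw
    exact (he.toOpenPartialHomeomorph _).continuousAt_symm hw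
  have hinj : ∀ᶠ w in 𝓝 w₀, Injective (fun k => s k w) := by
    have : ∀ i j, i ≠ j → ∀ᶠ w in 𝓝 w₀, s i w ≠ s j w := by
      intro i j hij
      have h := ((hcont i).sub (hcont j)).eventually_ne (y := 0)
        (by rw [Pi.sub_apply, hsw, hsw]; exact sub_ne_zero.2 fun h => hij (hζi h))
      exact h.mono fun w hw => sub_ne_zero.1 hw
    have h := (eventually_all.2 fun i => eventually_all.2 fun j =>
      (eventually_imp_distrib_left.2 (this i j)))
    filter_upwards [h] with w hw i j hij
    by_contra hne
    exact hw i j hne hij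
  have hne1 : ∀ᶠ w in 𝓝 w₀, w ≠ cubic c a c := eventually_ne_nhds h1
  have hne2 : ∀ᶠ w in 𝓝 w₀, w ≠ cubic c a (-c) := eventually_ne_nhds h2
  have hall := (eventually_all.2 hev).eventually_nhds.and ((eventually_all.2 hcont').and
    (hinj.and (hne1.and hne2)))
  obtain ⟨r, hr, hball⟩ := Metric.eventually_nhds_iff_ball.1 hall
  refine ⟨r, hr, s, fun w hw => ?_⟩
  obtain ⟨b1, b2, b3, b4, b5⟩ := hball w hw
  refine ⟨b4, b5, b3, fun k => ?_⟩
  have hroot' : ∀ᶠ w' in 𝓝 w, cubic c a (s k w') = w' := b1.mono fun w' h => h k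
  refine ⟨hroot'.self_of_nhds, ?_⟩
  refine (hasDerivAt_cubic c a (s k w)).of_local_left_inverse (b2 k) ?_ hroot'
  intro h
  have : (s k w) ^ 2 = c ^ 2 := by linear_combination h / 3
  rcases sq_eq_sq_iff_eq_or_eq_neg.1 this with h | h
  · exact b4 (by rw [← hroot'.self_of_nhds, h])
  · exact b5 (by rw [← hroot'.self_of_nhds, h])

end Transfer

section TransferNorm

open MeasureTheory

lemma det_restrictScalars_toSpanSingleton (u : ℂ) :
    ((ContinuousLinearMap.toSpanSingleton ℂ u).restrictScalars ℝ).det = ‖u‖ ^ 2 := by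
  simp [ContinuousLinearMap.det, LinearMap.det_restrictScalars,
    Algebra.norm_complex_eq, Complex.normSq_eq_norm_sq]

lemma lintegral_image_deriv {s s' : ℂ → ℂ} {D : Set ℂ} (hD : MeasurableSet D)
    (hs : ∀ w ∈ D, HasDerivAt s (s' w) w) (hi : InjOn s D) (q : ℂ → ENNReal) :
    ∫⁻ z in s '' D, q z = ∫⁻ w in D, ‖s' w‖ₑ ^ 2 * q (s w) := by
  rw [lintegral_image_eq_lintegral_abs_det_fderiv_mul volume hD
    (f' := fun w => (ContinuousLinearMap.toSpanSingleton ℂ (s' w)).restrictScalars ℝ)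
    (fun w hw => ((hs w hw).hasFDerivAt.restrictScalars ℝ).hasFDerivWithinAt) hi q]
  refine lintegral_congr fun w => ?_
  rw [det_restrictScalars_toSpanSingleton, abs_of_nonneg (by positivity),
    ENNReal.ofReal_pow (norm_nonneg _), ofReal_norm]

lemma lintegral_le_preimage_of_local {F G : ℂ → ENNReal} {f : ℂ → ℂ} (hf : Measurable f)
    {S : Set ℂ} (hSc : Sᶜ.Countable)
    (hloc : ∀ x ∈ S, ∃ r > 0, ∀ D ⊆ ball x r, MeasurableSet D →
      ∫⁻ w in D, F w ≤ ∫⁻ z in f ⁻¹' D, G z) {W : Set ℂ} (hW : MeasurableSet W) :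
    ∫⁻ w in W, F w ≤ ∫⁻ z in f ⁻¹' W, G z := by
  choose! r hr hD using hloc
  obtain ⟨t, htS, htc, hcov⟩ := TopologicalSpace.countable_cover_nhdsWithin
    (f := fun x => ball x (r x)) (s := S)
    (fun x hx => mem_nhdsWithin_of_mem_nhds (ball_mem_nhds x (hr x hx)))
  rcases t.eq_empty_or_nonempty with rfl | hne
  · have hS : S = ∅ := by simpa using hcov
    subst hS
    rw [compl_empty] at hSc
    have : (volume : Measure ℂ) W = 0 :=
      (hSc.mono (subset_univ W)).measure_zero _
    rw [setLIntegral_measure_zero _ _ this]; exact zero_le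
  obtain ⟨e, rfl⟩ := htc.exists_eq_range hne
  set V : ℕ → Set ℂ := fun n => disjointed (fun n => ball (e n) (r (e n))) n ∩ W with hV
  have hVm : ∀ n, MeasurableSet (V n) := fun n =>
    (MeasurableSet.disjointed (fun n => measurableSet_ball) n).inter hW
  have hVd : Pairwise (Disjoint on V) := fun i j hij =>
    (disjoint_disjointed _ hij).mono inter_subset_left inter_subset_left
  have hVW : W =ᵐ[volume] ⋃ n, V n := by
    refine ((EventuallyLE.antisymm ?_ ?_))
    · rw [ae_le_set]
      refine measure_mono_null ?_ (hSc.measure_zero volume)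
      rintro x ⟨hx, hxn⟩ hxS
      refine hxn ?_
      rw [hV, ← iUnion_inter, iUnion_disjointed]
      refine ⟨?_, hx⟩
      have := hcov hxS
      rw [biUnion_range] at this
      exact this
    · exact LE.le.eventuallyLE (iUnion_subset fun n => inter_subset_right)
  rw [setLIntegral_congr hVW, lintegral_iUnion hVm hVd]
  calc ∑' n, ∫⁻ w in V n, F w ≤ ∑' n, ∫⁻ z in f ⁻¹' (V n), G z := by
        refine ENNReal.tsum_le_tsum fun n => hD (e n) (htS (mem_range_self n)) _ ?_ (hVm n)
        exact inter_subset_left.trans (disjointed_subset _ _)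
    _ = ∫⁻ z in ⋃ n, f ⁻¹' (V n), G z :=
        (lintegral_iUnion (fun n => hf (hVm n))
          (fun i j hij => (hVd hij).preimage f) _).symm
    _ ≤ ∫⁻ z in f ⁻¹' W, G z := by
        refine lintegral_mono_set (iUnion_subset fun n => preimage_mono inter_subset_right)

lemma lintegral_simplePoles_transfer_le {c a : ℂ} (hc : c ≠ 0) {α : ℂ →₀ ℂ}
    (hα : -c ∉ α.support) {W : Set ℂ} (hW : MeasurableSet W) :
    ∫⁻ w in W, ‖simplePoles (transfer c a α) w‖ₑ ≤
      ∫⁻ z in cubic c a ⁻¹' W, ‖simplePoles α z‖ₑ := by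
  have hcont : Continuous (cubic c a) :=
    continuous_iff_continuousAt.2 fun z => (hasDerivAt_cubic c a z).continuousAt
  set bad : Set ℂ := {cubic c a c, cubic c a (-c)} ∪ cubic c a '' α.support with hbad
  have hbadf : bad.Finite := ((finite_singleton _).insert _).union (α.support.finite_toSet.image _)
  refine lintegral_le_preimage_of_local hcont.measurable (S := badᶜ)
    (by rw [compl_compl]; exact hbadf.countable) ?_ hW
  intro w₀ hw₀
  have h1 : w₀ ≠ cubic c a c := fun h => hw₀ (by rw [h]; simp [hbad])
  have h2 : w₀ ≠ cubic c a (-c) := fun h => hw₀ (by rw [h]; simp [hbad])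
  obtain ⟨r, hr, s, hs⟩ := exists_branches h1 h2
  obtain ⟨r', hr', hball⟩ := Metric.isOpen_iff.1 hbadf.isClosed.isOpen_compl w₀ hw₀
  refine ⟨min r r', lt_min hr hr', fun D hDsub hD => ?_⟩
  have hDr : ∀ w ∈ D, w ∈ ball w₀ r := fun w hw =>
    ball_subset_ball (min_le_left _ _) (hDsub hw)
  have hDb : ∀ w ∈ D, w ∉ bad := fun w hw =>
    hball (ball_subset_ball (min_le_right _ _) (hDsub hw))
  have hder : ∀ k, ∀ w ∈ D, HasDerivAt (s k) (3 * ((s k w) ^ 2 - c ^ 2))⁻¹ w :=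
    fun k w hw => ((hs w (hDr w hw)).2.2.2 k).2
  have hinv : ∀ k, ∀ w ∈ D, cubic c a (s k w) = w :=
    fun k w hw => ((hs w (hDr w hw)).2.2.2 k).1
  have hinj : ∀ k, InjOn (s k) D := fun k x hx y hy hxy => by
    rw [← hinv k x hx, ← hinv k y hy, hxy]
  have himm : ∀ k, MeasurableSet (s k '' D) := fun k =>
    hD.image_of_continuousOn_injOn
      (fun w hw => (hder k w hw).continuousAt.continuousWithinAt) (hinj k)
  have hdisj : Pairwise (Disjoint on fun k => s k '' D) := by
    intro i j hij
    rw [Function.onFun, Set.disjoint_left]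
    rintro _ ⟨x, hx, rfl⟩ ⟨y, hy, hxy⟩
    have hxy' : y = x := by rw [← hinv j y hy, hxy, hinv i x hx]
    subst hxy'
    exact hij ((hs y (hDr y hy)).2.2.1 hxy.symm)
  have hqm : ∀ β : ℂ →₀ ℂ, Measurable (simplePoles β) := by
    intro β
    have : simplePoles β = fun ζ => ∑ z ∈ β.support, β z * (ζ - z)⁻¹ := by
      ext ζ; simp [simplePoles, Finsupp.linearCombination_apply, Finsupp.sum]
    rw [this]
    fun_prop
  calc ∫⁻ w in D, ‖simplePoles (transfer c a α) w‖ₑ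
      ≤ ∫⁻ w in D, ∑ k, ‖(3 * ((s k w) ^ 2 - c ^ 2))⁻¹‖ₑ ^ 2 * ‖simplePoles α (s k w)‖ₑ := by
        refine setLIntegral_mono_ae' hD (ae_of_all _ fun w hw => ?_)
        have hsi := (hs w (hDr w hw)).2.2.1
        have hne : ∀ i j, i ≠ j → s i w ≠ s j w := fun i j hij h => hij (hsi h)
        rw [simplePoles_transfer hc hα (hs w (hDr w hw)).1 (hs w (hDr w hw)).2.1
          (hinv 0 w hw) (hinv 1 w hw) (hinv 2 w hw) (hne 0 1 (by decide)) (hne 0 2 (by decide))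
          (hne 1 2 (by decide))
          (fun z hz h => hDb w hw (Or.inr ⟨z, hz, h⟩))]
        rw [Fin.sum_univ_three]
        have hterm : ∀ A B : ℂ, ‖A⁻¹‖ₑ ^ 2 * ‖B‖ₑ = ‖B / A ^ 2‖ₑ := by
          intro A B
          rw [div_eq_mul_inv, enorm_mul, mul_comm, ← inv_pow, enorm_pow]
        rw [hterm, hterm, hterm]
        exact (enorm_add_le _ _).trans (add_le_add_left (enorm_add_le _ _) _)
    _ = ∑ k, ∫⁻ w in D, ‖(3 * ((s k w) ^ 2 - c ^ 2))⁻¹‖ₑ ^ 2 * ‖simplePoles α (s k w)‖ₑ := by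
        refine lintegral_finsetSum' _ fun k _ => ?_
        have hsm : AEMeasurable (s k) (volume.restrict D) :=
          ContinuousOn.aemeasurable
            (fun w hw => (hder k w hw).continuousAt.continuousWithinAt) hD
        have hqs : AEMeasurable (fun w => simplePoles α (s k w)) (volume.restrict D) :=
          (hqm α).comp_aemeasurable hsm
        fun_prop
    _ = ∑ k, ∫⁻ z in s k '' D, ‖simplePoles α z‖ₑ :=
        Finset.sum_congr rfl fun k _ =>
          (lintegral_image_deriv hD (hder k) (hinj k) fun z => ‖simplePoles α z‖ₑ).symm
    _ = ∫⁻ z in ⋃ k, s k '' D, ‖simplePoles α z‖ₑ := by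
        rw [lintegral_iUnion himm hdisj, tsum_fintype]
    _ ≤ ∫⁻ z in cubic c a ⁻¹' D, ‖simplePoles α z‖ₑ := by
        refine lintegral_mono_set (iUnion_subset fun k => ?_)
        rintro _ ⟨w, hw, rfl⟩
        rw [mem_preimage, hinv k w hw]; exact hw

end TransferNorm

section CircleAverage

open MeasureTheory

lemma simplePoles_apply (β : ℂ →₀ ℂ) (ζ : ℂ) :
    simplePoles β ζ = ∑ z ∈ β.support, β z * (ζ - z)⁻¹ := by
  simp [simplePoles, Finsupp.linearCombination_apply, Finsupp.sum]

lemma measurable_simplePoles (β : ℂ →₀ ℂ) : Measurable (simplePoles β) := by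
  rw [show simplePoles β = fun ζ => ∑ z ∈ β.support, β z * (ζ - z)⁻¹ from
    funext (simplePoles_apply β)]
  fun_prop

open Classical in
lemma circleIntegral_mul_simplePoles {P : ℂ} {ρ : ℝ} (hρ : 0 < ρ) {ξ : ℂ → ℂ}
    (hξ : DifferentiableOn ℂ ξ (closedBall P ρ)) {β : ℂ →₀ ℂ}
    (hβ : ∀ z ∈ β.support, dist z P ≠ ρ) :
    ∮ ζ in C(P, ρ), simplePoles β ζ * ξ ζ =
      2 * Real.pi * Complex.I * ∑ z ∈ β.support with dist z P < ρ, β z * ξ z := by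
  have hcz : ∀ z, dist z P ≠ ρ → ContinuousOn (fun ζ => (ζ - z)⁻¹ * ξ ζ) (sphere P ρ) := by
    intro z hz
    refine ContinuousOn.mul (ContinuousOn.inv₀ (by fun_prop) fun ζ hζ h => hz ?_)
      (hξ.continuousOn.mono sphere_subset_closedBall)
    rw [← sub_eq_zero.1 h]; exact hζ
  have hci : ∀ z ∈ β.support, CircleIntegrable (fun ζ => β z * ((ζ - z)⁻¹ * ξ ζ)) P ρ :=
    fun z hz => (continuousOn_const.mul (hcz z (hβ z hz))).circleIntegrable hρ.le
  have e1 : (fun ζ => simplePoles β ζ * ξ ζ) =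
      fun ζ => ∑ z ∈ β.support, β z * ((ζ - z)⁻¹ * ξ ζ) := by
    funext ζ; rw [simplePoles_apply, Finset.sum_mul]
    exact Finset.sum_congr rfl fun z _ => mul_assoc _ _ _
  rw [e1, circleIntegral.integral_fun_sum hci, Finset.sum_filter, Finset.mul_sum]
  refine Finset.sum_congr rfl fun z hz => ?_
  have e2 := circleIntegral.integral_const_mul (β z) (fun ζ => (ζ - z)⁻¹ * ξ ζ) P ρ
  rw [e2]
  split_ifs with hzρ
  · have := hξ.circleIntegral_sub_inv_smul (w := z) hzρ
    simp only [smul_eq_mul] at this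
    rw [this]; ring
  · have hz' : ρ < dist z P := lt_of_le_of_ne (not_lt.1 hzρ) (hβ z hz).symm
    have : DifferentiableOn ℂ (fun ζ => (ζ - z)⁻¹ * ξ ζ) (closedBall P ρ) := by
      refine DifferentiableOn.mul (DifferentiableOn.inv (by fun_prop) fun ζ hζ h => ?_) hξ
      rw [← sub_eq_zero.1 h] at hz'
      exact absurd (mem_closedBall.1 hζ) (not_le.2 hz')
    rw [(this.mono closure_ball_subset_closedBall).diffContOnCl.circleIntegral_eq_zero hρ.le]
    simp

lemma enorm_I : ‖Complex.I‖ₑ = 1 := by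
  rw [← ofReal_norm, Complex.norm_I, ENNReal.ofReal_one]

lemma enorm_circleIntegral_le {P : ℂ} {ρ : ℝ} (hρ : 0 < ρ) {g : ℂ → ℂ} :
    ‖∮ ζ in C(P, ρ), g ζ‖ₑ ≤
      ∫⁻ θ in Ioo (-Real.pi) Real.pi, ENNReal.ofReal ρ * ‖g (circleMap P ρ θ)‖ₑ := by
  have hper : Periodic (fun θ => deriv (circleMap P ρ) θ • g (circleMap P ρ θ)) (2 * Real.pi) := by
    intro θ
    simp only [deriv_circleMap, periodic_circleMap P ρ θ, periodic_circleMap 0 ρ θ]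
  have h1 : ∮ ζ in C(P, ρ), g ζ =
      ∫ θ in Ioo (-Real.pi) Real.pi, deriv (circleMap P ρ) θ • g (circleMap P ρ θ) := by
    have := hper.intervalIntegral_add_eq 0 (-Real.pi)
    rw [circleIntegral]
    simp only [zero_add] at this
    rw [this, show -Real.pi + 2 * Real.pi = Real.pi by ring,
      intervalIntegral.integral_of_le (by linarith [Real.pi_pos]), integral_Ioc_eq_integral_Ioo]
  rw [h1]
  refine (enorm_integral_le_lintegral_enorm _).trans (le_of_eq (lintegral_congr fun θ => ?_))
  rw [enorm_smul, deriv_circleMap, enorm_mul, enorm_I, mul_one]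
  congr 1
  rw [← ofReal_norm, norm_circleMap_zero, abs_of_pos hρ]

lemma lintegral_annulus (P : ℂ) {r r' : ℝ} (hr : 0 < r) {g : ℂ → ENNReal} (hg : Measurable g) :
    ∫⁻ ζ in {ζ | r < dist ζ P ∧ dist ζ P < r'}, g ζ =
      ∫⁻ ρ in Ioo r r', ∫⁻ θ in Ioo (-Real.pi) Real.pi, ENNReal.ofReal ρ * g (circleMap P ρ θ) := by
  set A : Set ℂ := {ζ | r < dist ζ P ∧ dist ζ P < r'} with hA
  have hAm : MeasurableSet A := by
    rw [hA]; measurability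
  have h1 : ∫⁻ ζ in A, g ζ = ∫⁻ ζ, A.indicator g (ζ + P) := by
    rw [lintegral_add_right_eq_self (fun ζ => A.indicator g ζ) P, lintegral_indicator hAm]
  have ht : polarCoord.target = Ioi (0 : ℝ) ×ˢ Ioo (-Real.pi) Real.pi := rfl
  rw [h1, ← Complex.lintegral_comp_polarCoord_symm, ht,
    Measure.volume_eq_prod, ← Measure.prod_restrict, lintegral_prod]
  · have h2 : ∀ ρ ∈ Ioi (0:ℝ), ∫⁻ θ in Ioo (-Real.pi) Real.pi, ENNReal.ofReal (ρ, θ).1 •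
        A.indicator g (Complex.polarCoord.symm (ρ, θ) + P) = (Ioo r r').indicator
        (fun ρ => ∫⁻ θ in Ioo (-Real.pi) Real.pi, ENNReal.ofReal ρ * g (circleMap P ρ θ)) ρ := by
      intro ρ hρ
      have e : ∀ θ, Complex.polarCoord.symm (ρ, θ) + P = circleMap P ρ θ := by
        intro θ
        rw [Complex.polarCoord_symm_apply, circleMap, Complex.exp_mul_I]; push_cast; ring
      have em : ∀ θ, circleMap P ρ θ ∈ A ↔ ρ ∈ Ioo r r' := by
        intro θ
        have : dist (circleMap P ρ θ) P = ρ := by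
          rw [dist_eq_norm, circleMap_sub_center, norm_circleMap_zero, abs_of_pos hρ]
        rw [hA, mem_ofPred_eq, this, mem_Ioo]
      by_cases hρ' : ρ ∈ Ioo r r'
      · rw [indicator_of_mem hρ']
        refine lintegral_congr fun θ => ?_
        rw [e, indicator_of_mem ((em θ).2 hρ'), smul_eq_mul]
      · rw [indicator_of_notMem hρ']
        refine (lintegral_congr fun θ => ?_).trans lintegral_zero
        rw [e, indicator_of_notMem (fun h => hρ' ((em θ).1 h)), smul_zero]
    rw [setLIntegral_congr_fun measurableSet_Ioi h2, lintegral_indicator measurableSet_Ioo,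
      Measure.restrict_restrict measurableSet_Ioo,
      inter_eq_left.2 (show Ioo r r' ⊆ Ioi 0 from fun x hx => hr.trans hx.1)]
  · have : Measurable fun p : ℝ × ℝ => Complex.polarCoord.symm p + P := by
      simp only [Complex.polarCoord_symm_apply]
      fun_prop
    have h3 : Measurable fun p : ℝ × ℝ => ENNReal.ofReal p.1 := by fun_prop
    exact (h3.smul ((hg.indicator hAm).comp this)).aemeasurable

open Classical in
lemma enorm_pairing_le {P : ℂ} {r r' M : ℝ} (hr : 0 < r) {ξ : ℂ → ℂ}
    (hξ : DifferentiableOn ℂ ξ (closedBall P r')) (hM : ∀ z ∈ closedBall P r', ‖ξ z‖ ≤ M)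
    {β : ℂ →₀ ℂ} (hβ : ∀ z ∈ β.support, dist z P < r ∨ r' < dist z P) :
    ENNReal.ofReal (2 * Real.pi * (r' - r)) *
        ‖∑ z ∈ β.support with dist z P < r, β z * ξ z‖ₑ ≤
      ENNReal.ofReal M * ∫⁻ ζ in {ζ | r < dist ζ P ∧ dist ζ P < r'}, ‖simplePoles β ζ‖ₑ := by
  rw [lintegral_annulus P hr (measurable_simplePoles β).enorm]
  set K := ‖∑ z ∈ β.support with dist z P < r, β z * ξ z‖ₑ with hK
  have key : ∀ ρ ∈ Ioo r r', ENNReal.ofReal (2 * Real.pi) * K ≤ ENNReal.ofReal M *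
      ∫⁻ θ in Ioo (-Real.pi) Real.pi,
        ENNReal.ofReal ρ * ‖simplePoles β (circleMap P ρ θ)‖ₑ := by
    intro ρ hρ
    have hρ0 := hr.trans hρ.1
    have h1 := circleIntegral_mul_simplePoles hρ0
      (hξ.mono (closedBall_subset_closedBall hρ.2.le)) (β := β) (fun z hz h => by
        rcases hβ z hz with h' | h' <;> linarith [hρ.1, hρ.2])
    have h2 : β.support.filter (fun z => dist z P < ρ) =
        β.support.filter (fun z => dist z P < r) := by
      refine Finset.filter_congr fun z hz => ⟨fun h => ?_, fun h => h.trans hρ.1⟩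
      rcases hβ z hz with h' | h'
      · exact h'
      · linarith [hρ.2]
    rw [h2] at h1
    have h3 := enorm_circleIntegral_le (P := P) hρ0 (g := fun ζ => simplePoles β ζ * ξ ζ)
    rw [h1, enorm_mul, enorm_mul, enorm_I, mul_one] at h3
    have h4 : ‖(2 * (Real.pi : ℂ))‖ₑ = ENNReal.ofReal (2 * Real.pi) := by
      rw [← ofReal_norm]; simp [abs_of_pos Real.pi_pos]
    rw [h4] at h3
    refine h3.trans ?_
    have hmm : Measurable fun θ => ENNReal.ofReal ρ * ‖simplePoles β (circleMap P ρ θ)‖ₑ :=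
      ((measurable_simplePoles β).comp (continuous_circleMap P ρ).measurable).enorm.const_mul _
    rw [← lintegral_const_mul _ hmm]
    refine lintegral_mono fun θ => ?_
    have h5 : ‖ξ (circleMap P ρ θ)‖ₑ ≤ ENNReal.ofReal M := by
      rw [← ofReal_norm]
      exact ENNReal.ofReal_le_ofReal (hM _ (closedBall_subset_closedBall hρ.2.le
        (circleMap_mem_closedBall P hρ0.le θ)))
    rw [enorm_mul]
    calc _ = ENNReal.ofReal ρ * ‖simplePoles β (circleMap P ρ θ)‖ₑ * ‖ξ (circleMap P ρ θ)‖ₑ := by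
          ring
      _ ≤ ENNReal.ofReal ρ * ‖simplePoles β (circleMap P ρ θ)‖ₑ * ENNReal.ofReal M := by gcongr
      _ = _ := by ring
  calc ENNReal.ofReal (2 * Real.pi * (r' - r)) * K
      = ∫⁻ ρ in Ioo r r', ENNReal.ofReal (2 * Real.pi) * K := by
        rw [setLIntegral_const, Real.volume_Ioo, ENNReal.ofReal_mul (by positivity)]; ring
    _ ≤ ∫⁻ ρ in Ioo r r', ENNReal.ofReal M * ∫⁻ θ in Ioo (-Real.pi) Real.pi,
        ENNReal.ofReal ρ * ‖simplePoles β (circleMap P ρ θ)‖ₑ :=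
        setLIntegral_mono_ae' measurableSet_Ioo (ae_of_all _ key)
    _ = _ := lintegral_const_mul' _ _ ENNReal.ofReal_ne_top

end CircleAverage

section Rigidity

open MeasureTheory

lemma two_mul_norm_le_norm_cubic {c a z : ℂ} (hz : 2 + 3 * ‖c‖ ^ 2 + ‖a‖ ≤ ‖z‖) :
    2 * ‖z‖ ≤ ‖cubic c a z‖ := by
  have h1 : ‖z‖ ^ 3 ≤ ‖cubic c a z‖ + 3 * ‖c‖ ^ 2 * ‖z‖ + ‖a‖ := by
    have e : z ^ 3 = cubic c a z + 3 * c ^ 2 * z - a := by simp only [cubic]; ring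
    calc ‖z‖ ^ 3 = ‖cubic c a z + 3 * c ^ 2 * z - a‖ := by rw [← e, norm_pow]
      _ ≤ ‖cubic c a z‖ + ‖3 * c ^ 2 * z‖ + ‖a‖ :=
        (norm_sub_le _ _).trans (by gcongr; exact norm_add_le _ _)
      _ = _ := by simp
  have hc := sq_nonneg ‖c‖
  have ha := norm_nonneg a
  have hz1 : 1 ≤ ‖z‖ := by linarith
  have h2 : (2 + 3 * ‖c‖ ^ 2 + ‖a‖) * ‖z‖ ≤ ‖z‖ * ‖z‖ := by gcongr
  have h3 : (2 + 3 * ‖c‖ ^ 2 + ‖a‖) * ‖z‖ ≤ ‖z‖ ^ 3 := by nlinarith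
  nlinarith

open Classical in
lemma exists_enorm_pairing_le {P : ℂ} {r r' : ℝ} (hr : 0 < r) (hr' : r < r') {ξ : ℂ → ℂ}
    (hξ : DifferentiableOn ℂ ξ (closedBall P r')) :
    ∃ C : ENNReal, C ≠ ⊤ ∧ ∀ β : ℂ →₀ ℂ, (∀ z ∈ β.support, dist z P < r ∨ r' < dist z P) →
      ‖∑ z ∈ β.support with dist z P < r, β z * ξ z‖ₑ ≤
        C * ∫⁻ ζ in {ζ | r < dist ζ P ∧ dist ζ P < r'}, ‖simplePoles β ζ‖ₑ := by
  obtain ⟨M, hM⟩ := (isCompact_closedBall P r').exists_bound_of_continuousOn hξ.continuousOn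
  have hpos : 0 < 2 * Real.pi * (r' - r) := by
    have := Real.pi_pos
    have := sub_pos.2 hr'
    positivity
  have h0 : ENNReal.ofReal (2 * Real.pi * (r' - r)) ≠ 0 := by simpa using hpos
  refine ⟨(ENNReal.ofReal (2 * Real.pi * (r' - r)))⁻¹ * ENNReal.ofReal M,
    ENNReal.mul_ne_top (ENNReal.inv_ne_top.2 h0) ENNReal.ofReal_ne_top, fun β hβ => ?_⟩
  have := enorm_pairing_le hr hξ hM hβ
  rw [mul_assoc]
  exact (ENNReal.mul_le_iff_le_inv h0 ENNReal.ofReal_ne_top).1 this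

/-- Infinitesimal rigidity of postcritical sets carried by a strictly invariant family of discs. -/
theorem infinitesimal_rigidity {c a c' a' : ℂ} (hc : c ≠ 0) {ι : Type*} [Fintype ι]
    {P : ι → ℂ} {r r' : ι → ℝ} (hr : ∀ i, 0 < r i) (hr' : ∀ i, r i < r' i)
    (hdisj : Pairwise (Disjoint on fun i => closedBall (P i) (r' i)))
    (hmap : ∀ i, MapsTo (cubic c a) (closedBall (P i) (r' i)) (⋃ j, closedBall (P j) (r j)))
    {X : Set ℂ} (hX : X ⊆ ⋃ i, ball (P i) (r i)) (hfX : MapsTo (cubic c a) X X)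
    (h1X : cubic c a c ∈ X) (h2X : cubic c a (-c) ∈ X) (hcX : -c ∉ X) {ξ : ℂ → ℂ}
    (hξd : ∀ i, DifferentiableOn ℂ ξ (closedBall (P i) (r' i)))
    (hξ : ∀ z ∈ X, ξ (cubic c a z) = 3 * (z ^ 2 - c ^ 2) * ξ z + (-6 * c * c' * z + a'))
    (h1 : ξ (cubic c a c) = -6 * c * c' * c + a')
    (h2 : ξ (cubic c a (-c)) = -6 * c * c' * (-c) + a') (hξc : c ∈ X → ξ c = c') :
    ∀ z ∈ X, ξ z = 0 := by
  classical
  intro z hz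
  set f := cubic c a with hf
  have hcont : Continuous f :=
    continuous_iff_continuousAt.2 fun z => (hasDerivAt_cubic c a z).continuousAt
  set q : ℕ → ℂ →₀ ℂ := fun n => (transfer c a)^[n] (Finsupp.single z 1) with hq
  have hqs : ∀ n, q (n + 1) = transfer c a (q n) := fun n => iterate_succ_apply' _ _ _
  have hsupp : ∀ n, ((q n).support : Set ℂ) ⊆ X := by
    intro n
    induction n with
    | zero =>
      intro x hx
      have hx' := Finsupp.support_single_subset hx
      rw [Finset.mem_singleton.1 hx']; exact hz
    | succ n ih => rw [hqs]; exact support_transfer hfX h1X h2X ih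
  have hpair : ∀ n, Finsupp.linearCombination ℂ ξ (q n) = ξ z := by
    intro n
    induction n with
    | zero => simp [hq]
    | succ n ih => rw [hqs, pairing_transfer hc hcX hξ h1 h2 hξc (hsupp n), ih]
  obtain ⟨R, hR1, hR2⟩ : ∃ R : ℝ, 2 + 3 * ‖c‖ ^ 2 + ‖a‖ ≤ R ∧ ∀ i, ‖P i‖ + r' i ≤ R := by
    refine ⟨max (2 + 3 * ‖c‖ ^ 2 + ‖a‖) (∑ i, (‖P i‖ + r' i)), le_max_left _ _, fun i => ?_⟩
    refine le_max_of_le_right (Finset.single_le_sum (f := fun i => ‖P i‖ + r' i)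
      (fun j _ => ?_) (Finset.mem_univ i))
    have := hr j; have := hr' j; have := norm_nonneg (P j)
    linarith
  set W : Set ℂ := ball 0 R \ ⋃ i, closedBall (P i) (r i) with hW
  have hWm : MeasurableSet W :=
    measurableSet_ball.diff (MeasurableSet.iUnion fun i => measurableSet_closedBall)
  set O : ι → Set ℂ := fun i => {ζ | r i < dist ζ (P i) ∧ dist ζ (P i) < r' i} with hO
  have hOm : ∀ i, MeasurableSet (O i) := fun i => by simp only [hO]; measurability
  have hfW : f ⁻¹' W ⊆ W := by
    rintro ζ ⟨hζ1, hζ2⟩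
    refine ⟨?_, fun h => hζ2 ?_⟩
    · by_contra hlt
      have hge : R ≤ ‖ζ‖ := by simpa using hlt
      have h3 := two_mul_norm_le_norm_cubic (hR1.trans hge)
      have h4 : ‖f ζ‖ < R := by simpa using hζ1
      have := norm_nonneg ζ
      rw [hf] at h4; linarith
    · obtain ⟨i, hi⟩ := mem_iUnion.1 h
      exact hmap i (closedBall_subset_closedBall (hr' i).le hi)
  have hOW : ∀ i, O i ⊆ W := by
    rintro i ζ ⟨hζ1, hζ2⟩
    refine ⟨?_, fun h => ?_⟩
    · rw [mem_ball_zero_iff]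
      have : ‖ζ‖ ≤ ‖P i‖ + dist ζ (P i) := by
        rw [dist_eq_norm]; simpa using norm_add_le (P i) (ζ - P i)
      linarith [hR2 i]
    · obtain ⟨j, hj⟩ := mem_iUnion.1 h
      by_cases hij : j = i
      · subst hij; exact absurd (mem_closedBall.1 hj) (not_le.2 hζ1)
      · exact Set.disjoint_left.1 (hdisj hij)
          (closedBall_subset_closedBall (hr' j).le hj) hζ2.le
  have hOf : ∀ i, Disjoint (f ⁻¹' W) (O i) := by
    intro i
    rw [Set.disjoint_left]
    rintro ζ hζ ⟨-, hζ2⟩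
    exact hζ.2 (hmap i hζ2.le)
  have hstep : ∀ i n, (∫⁻ ζ in W, ‖simplePoles (q (n + 1)) ζ‖ₑ) +
      ∫⁻ ζ in O i, ‖simplePoles (q n) ζ‖ₑ ≤ ∫⁻ ζ in W, ‖simplePoles (q n) ζ‖ₑ := by
    intro i n
    have h3 : -c ∉ (q n).support := fun h => hcX (hsupp n h)
    rw [hqs]
    calc _ ≤ (∫⁻ ζ in f ⁻¹' W, ‖simplePoles (q n) ζ‖ₑ) +
          ∫⁻ ζ in O i, ‖simplePoles (q n) ζ‖ₑ := by
          exact add_le_add_left (lintegral_simplePoles_transfer_le hc h3 hWm) _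
      _ = ∫⁻ ζ in f ⁻¹' W ∪ O i, ‖simplePoles (q n) ζ‖ₑ :=
          (lintegral_union (hOm i) (hOf i)).symm
      _ ≤ _ := lintegral_mono_set (union_subset hfW (hOW i))
  have hsum : ∀ i N, (∫⁻ ζ in W, ‖simplePoles (q N) ζ‖ₑ) +
      ∑ n ∈ Finset.range N, ∫⁻ ζ in O i, ‖simplePoles (q n) ζ‖ₑ ≤
        ∫⁻ ζ in W, ‖simplePoles (q 0) ζ‖ₑ := by
    intro i N
    induction N with
    | zero => simp
    | succ N ih =>
      rw [Finset.sum_range_succ]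
      calc _ = ((∫⁻ ζ in W, ‖simplePoles (q (N + 1)) ζ‖ₑ) +
            ∫⁻ ζ in O i, ‖simplePoles (q N) ζ‖ₑ) +
            ∑ n ∈ Finset.range N, ∫⁻ ζ in O i, ‖simplePoles (q n) ζ‖ₑ := by ring
        _ ≤ (∫⁻ ζ in W, ‖simplePoles (q N) ζ‖ₑ) +
            ∑ n ∈ Finset.range N, ∫⁻ ζ in O i, ‖simplePoles (q n) ζ‖ₑ := by
            gcongr; exact hstep i N
        _ ≤ _ := ih
  have hfin : ∫⁻ ζ in W, ‖simplePoles (q 0) ζ‖ₑ ≠ ⊤ := by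
    obtain ⟨i, hi⟩ := mem_iUnion.1 (hX hz)
    have hδ : 0 < r i - dist z (P i) := sub_pos.2 hi
    have hb : ∀ ζ ∈ W, ‖simplePoles (q 0) ζ‖ₑ ≤ ENNReal.ofReal (r i - dist z (P i))⁻¹ := by
      intro ζ hζ
      have h3 : simplePoles (q 0) ζ = (ζ - z)⁻¹ := by
        simp [simplePoles, hq]
      rw [h3, ← ofReal_norm, norm_inv]
      refine ENNReal.ofReal_le_ofReal (inv_anti₀ hδ ?_)
      have h4 : r i < dist ζ (P i) := by
        by_contra h
        exact hζ.2 (mem_iUnion.2 ⟨i, not_lt.1 h⟩)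
      have := dist_triangle ζ z (P i)
      rw [← dist_eq_norm]; linarith
    refine ne_top_of_le_ne_top ?_ (setLIntegral_mono_ae' hWm (ae_of_all _ hb))
    rw [setLIntegral_const]
    refine ENNReal.mul_ne_top ENNReal.ofReal_ne_top ?_
    exact ne_top_of_le_ne_top measure_ball_lt_top.ne (measure_mono sdiff_subset)
  have hO0 : ∀ i, Tendsto (fun n => ∫⁻ ζ in O i, ‖simplePoles (q n) ζ‖ₑ) atTop (𝓝 0) := by
    intro i
    refine ENNReal.tendsto_atTop_zero_of_tsum_ne_top (ne_top_of_le_ne_top hfin ?_)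
    refine ENNReal.tsum_le_of_sum_range_le fun N => le_trans ?_ (hsum i N)
    exact le_add_self
  choose C hC hCle using fun i => exists_enorm_pairing_le (hr i) (hr' i) (hξd i)
  have hle : ∀ n, ‖ξ z‖ₑ ≤ ∑ i, C i * ∫⁻ ζ in O i, ‖simplePoles (q n) ζ‖ₑ := by
    intro n
    have hloc : ∀ x ∈ (q n).support, ∃ i, dist x (P i) < r i := fun x hx => by
      simpa using hX (hsupp n hx)
    have hfar : ∀ x i j, dist x (P i) < r i → i ≠ j → r' j < dist x (P j) := by
      intro x i j hi hij
      by_contra h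
      exact Set.disjoint_left.1 (hdisj hij) (hi.le.trans (hr' i).le) (not_lt.1 h)
    have h3 : ξ z = ∑ i, ∑ x ∈ (q n).support with dist x (P i) < r i, q n x * ξ x := by
      rw [← hpair n, Finsupp.linearCombination_apply, Finsupp.sum]
      simp_rw [Finset.sum_filter]
      rw [Finset.sum_comm]
      refine Finset.sum_congr rfl fun x hx => ?_
      obtain ⟨i, hi⟩ := hloc x hx
      rw [Finset.sum_eq_single i, if_pos hi, smul_eq_mul]
      · intro j _ hji
        rw [if_neg]
        have := hfar x i j hi hji.symm
        have := hr' j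
        linarith
      · simp
    rw [h3]
    refine (enorm_sum_le _ _).trans (Finset.sum_le_sum fun i _ => hCle i (q n) fun x hx => ?_)
    obtain ⟨j, hj⟩ := hloc x hx
    by_cases hij : j = i
    · subst hij; exact Or.inl hj
    · exact Or.inr (hfar x j i hj hij)
  have hlim : Tendsto (fun n => ∑ i, C i * ∫⁻ ζ in O i, ‖simplePoles (q n) ζ‖ₑ) atTop (𝓝 0) := by
    have := tendsto_finsetSum (Finset.univ : Finset ι) fun i _ =>
      ENNReal.Tendsto.const_mul (hO0 i) (Or.inr (hC i))
    simpa using this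
  have := ge_of_tendsto' hlim hle
  simpa using this

end Rigidity

section Dynamics

/-- The factor `(f^{n+1}(c+s) - f^{n+1}(c)) / (s^2 (s + 3c))` of the iterates of the cubic at its
critical point `c`. -/
noncomputable def critFactor (c a s : ℂ) : ℕ → ℂ
  | 0 => 1
  | n + 1 => critFactor c a s n *
      (3 * (((cubic c a)^[n + 1] c) ^ 2 - c ^ 2)
        + 3 * (cubic c a)^[n + 1] c * (s ^ 2 * ((s + 3 * c) * critFactor c a s n))
        + (s ^ 2 * ((s + 3 * c) * critFactor c a s n)) ^ 2)

/-- The quotient `(f^p(c+s) - f^p(c)) / s^2`. -/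
noncomputable def retFactor (p : ℕ) (c a s : ℂ) : ℂ := (s + 3 * c) * critFactor c a s (p - 1)

lemma iterate_cubic_add (c a s : ℂ) (n : ℕ) :
    (cubic c a)^[n + 1] (c + s) =
      (cubic c a)^[n + 1] c + s ^ 2 * ((s + 3 * c) * critFactor c a s n) := by
  induction n with
  | zero => simp only [zero_add, iterate_one, critFactor, cubic]; ring
  | succ n ih =>
    rw [iterate_succ_apply', ih, iterate_succ_apply' _ (n + 1) c, critFactor]
    generalize (cubic c a)^[n + 1] c = x
    generalize critFactor c a s n = q
    simp only [cubic]; ring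

lemma iterate_cubic_add_eq {p : ℕ} (hp : 1 ≤ p) (c a s : ℂ) :
    (cubic c a)^[p] (c + s) = (cubic c a)^[p] c + s ^ 2 * retFactor p c a s := by
  obtain ⟨n, rfl⟩ : ∃ n, p = n + 1 := ⟨p - 1, by omega⟩
  exact iterate_cubic_add c a s n

lemma contDiff_iterate_cubic {n : WithTop ℕ∞} (k : ℕ) :
    ContDiff ℂ n (fun x : ℂ × ℂ × ℂ => (cubic x.1 x.2.1)^[k] x.2.2) := by
  induction k with
  | zero => simp only [iterate_zero, id]; fun_prop
  | succ k ih =>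
    simp only [iterate_succ_apply']
    simp only [cubic] at ih ⊢
    fun_prop

lemma contDiff_critFactor {n : WithTop ℕ∞} (k : ℕ) :
    ContDiff ℂ n (fun x : ℂ × ℂ × ℂ => critFactor x.1 x.2.1 x.2.2 k) := by
  induction k with
  | zero => simp only [critFactor]; fun_prop
  | succ k ih =>
    have h : ContDiff ℂ n (fun x : ℂ × ℂ × ℂ => (cubic x.1 x.2.1)^[k + 1] x.1) :=
      (contDiff_iterate_cubic (k + 1)).comp
        (show ContDiff ℂ n (fun x : ℂ × ℂ × ℂ => (x.1, x.2.1, x.1)) by fun_prop)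
    simp only [critFactor]
    fun_prop

lemma contDiff_retFactor {n : WithTop ℕ∞} (p : ℕ) :
    ContDiff ℂ n (fun x : ℂ × ℂ × ℂ => retFactor p x.1 x.2.1 x.2.2) := by
  have := contDiff_critFactor (n := n) (p - 1)
  simp only [retFactor]
  fun_prop

lemma critFactor_zero_eq (c a : ℂ) (n : ℕ) :
    critFactor c a 0 n = ∏ k ∈ Finset.range n, (3 * (((cubic c a)^[k + 1] c) ^ 2 - c ^ 2)) := by
  induction n with
  | zero => simp [critFactor]
  | succ n ih => rw [critFactor, Finset.prod_range_succ, ih]; ring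

lemma hasDerivAt_iterate_cubic (c a z : ℂ) (n : ℕ) :
    HasDerivAt (cubic c a)^[n]
      (∏ k ∈ Finset.range n, (3 * (((cubic c a)^[k] z) ^ 2 - c ^ 2))) z := by
  induction n with
  | zero => simpa using hasDerivAt_id z
  | succ n ih =>
    rw [iterate_succ', Finset.prod_range_succ, mul_comm]
    exact (hasDerivAt_cubic c a _).comp z ih

lemma continuous_cubic (c a : ℂ) : Continuous (cubic c a) :=
  continuous_iff_continuousAt.2 fun z => (hasDerivAt_cubic c a z).continuousAt

lemma differentiable_cubic (c a : ℂ) : Differentiable ℂ (cubic c a) :=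
  fun z => (hasDerivAt_cubic c a z).differentiableAt

lemma isCritical_iterate_cubic {c a z : ℂ} {n : ℕ} (h : deriv (cubic c a)^[n] z = 0) :
    ∃ k < n, (cubic c a)^[k] z = c ∨ (cubic c a)^[k] z = -c := by
  rw [(hasDerivAt_iterate_cubic c a z n).deriv, Finset.prod_eq_zero_iff] at h
  obtain ⟨k, hk, h⟩ := h
  refine ⟨k, Finset.mem_range.1 hk, sq_eq_sq_iff_eq_or_eq_neg.1 ?_⟩
  linear_combination h / 3

lemma two_pow_mul_norm_le_iterate {c a z : ℂ} (hz : 2 + 3 * ‖c‖ ^ 2 + ‖a‖ ≤ ‖z‖) (n : ℕ) :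
    2 ^ n * ‖z‖ ≤ ‖(cubic c a)^[n] z‖ := by
  induction n with
  | zero => simp
  | succ n ih =>
    have h1 : ‖z‖ ≤ 2 ^ n * ‖z‖ := le_mul_of_one_le_left (norm_nonneg z) (one_le_pow₀ one_le_two)
    rw [iterate_succ_apply', pow_succ]
    linarith [two_mul_norm_le_norm_cubic (hz.trans (h1.trans ih))]

lemma norm_le_of_mem_filledJulia {c a z : ℂ} {R : ℝ} (hR : 2 + 3 * ‖c‖ ^ 2 + ‖a‖ ≤ R)
    (hz : z ∈ filledJulia (cubic c a)) : ‖z‖ ≤ R := by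
  by_contra h
  push Not at h
  obtain ⟨M, hM⟩ := isBounded_iff_forall_norm_le.1 (show Bornology.IsBounded
    (range fun n => (cubic c a)^[n] z) from hz)
  have h0 : 0 < ‖z‖ := lt_of_le_of_lt (by positivity) (lt_of_le_of_lt hR h)
  obtain ⟨n, hn⟩ := pow_unbounded_of_one_lt (M / ‖z‖) one_lt_two
  rw [div_lt_iff₀ h0] at hn
  exact absurd (hM _ (mem_range_self n))
    (not_le.2 (hn.trans_le (two_pow_mul_norm_le_iterate (hR.trans h.le) n)))

lemma iterate_mem_filledJulia {f : ℂ → ℂ} {z : ℂ} (hz : z ∈ filledJulia f) (n : ℕ) :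
    f^[n] z ∈ filledJulia f := by
  refine Bornology.IsBounded.subset (show Bornology.IsBounded (range fun n => f^[n] z) from hz) ?_
  rintro _ ⟨k, rfl⟩
  exact ⟨k + n, iterate_add_apply f k n z⟩

/-- The return map at the periodic critical point contracts a small disc. -/
lemma exists_trap {p : ℕ} (hp : 1 ≤ p) {c a : ℂ} (hper : (cubic c a)^[p] c = c) :
    ∃ ε > 0, ∀ s : ℂ, ‖s‖ < ε → ‖(cubic c a)^[p] (c + s) - c‖ ≤ ‖s‖ / 2 := by
  have hc : Continuous fun s => s * retFactor p c a s :=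
    continuous_id.mul ((contDiff_retFactor (n := 0) p).continuous.comp
      (show Continuous fun s : ℂ => ((c, a, s) : ℂ × ℂ × ℂ) by fun_prop))
  have h0 : Tendsto (fun s => s * retFactor p c a s) (𝓝 0) (𝓝 0) := by
    simpa using hc.tendsto 0
  obtain ⟨ε, hε, h⟩ := Metric.eventually_nhds_iff.1
    (h0.norm.eventually_le_const (u := 1 / 2) (by simp))
  refine ⟨ε, hε, fun s hs => ?_⟩
  have h1 := h (y := s) (by simpa using hs)
  rw [iterate_cubic_add_eq hp, hper, add_sub_cancel_left, sq, mul_assoc, norm_mul]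
  nlinarith [norm_nonneg s]

lemma trap_iterate {g : ℂ → ℂ} {c : ℂ} {ε : ℝ}
    (h : ∀ s : ℂ, ‖s‖ < ε → ‖g (c + s) - c‖ ≤ ‖s‖ / 2) {z : ℂ} (hz : ‖z - c‖ < ε) (n : ℕ) :
    ‖g^[n] z - c‖ ≤ (1 / 2) ^ n * ‖z - c‖ := by
  induction n with
  | zero => simp
  | succ n ih =>
    have h1 : ‖g^[n] z - c‖ < ε := by
      refine (ih.trans ?_).trans_lt hz
      exact mul_le_of_le_one_left (norm_nonneg _) (pow_le_one₀ (by norm_num) (by norm_num))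
    have := h _ h1
    rw [add_sub_cancel, ← iterate_succ_apply' g n z] at this
    rw [pow_succ]; linarith

lemma trap_tendsto {g : ℂ → ℂ} {c : ℂ} {ε : ℝ}
    (h : ∀ s : ℂ, ‖s‖ < ε → ‖g (c + s) - c‖ ≤ ‖s‖ / 2) {z : ℂ} (hz : ‖z - c‖ < ε) :
    Tendsto (fun n => g^[n] z) atTop (𝓝 c) := by
  rw [tendsto_iff_norm_sub_tendsto_zero]
  refine squeeze_zero (fun _ => norm_nonneg _) (trap_iterate h hz) ?_
  simpa using (tendsto_pow_atTop_nhds_zero_of_lt_one (r := (1 / 2 : ℝ)) (by norm_num)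
    (by norm_num)).mul_const ‖z - c‖

lemma mem_filledJulia_of_tendsto {c a z w : ℂ} {p : ℕ} (hp : 1 ≤ p)
    (h : Tendsto (fun n => ((cubic c a)^[p])^[n] z) atTop (𝓝 w)) :
    z ∈ filledJulia (cubic c a) := by
  have hb : ∀ k, Bornology.IsBounded (range fun n => (cubic c a)^[k] (((cubic c a)^[p])^[n] z)) :=
    fun k => isBounded_range_of_tendsto _ ((((continuous_cubic c a).iterate k).tendsto w).comp h)
  have : (range fun n => (cubic c a)^[n] z) ⊆
      ⋃ k ∈ Finset.range p, range fun n => (cubic c a)^[k] (((cubic c a)^[p])^[n] z) := by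
    rintro _ ⟨n, rfl⟩
    simp only [mem_iUnion]
    refine ⟨n % p, Finset.mem_range.2 (Nat.mod_lt _ hp), n / p, ?_⟩
    simp only
    rw [← iterate_mul, ← iterate_add_apply, Nat.mod_add_div]
  exact ((Bornology.isBounded_biUnion_finset _).2 fun k _ => hb k).subset this

theorem fatouComponent_subset_basin {p : ℕ} (hp : 1 ≤ p) {c a : ℂ}
    (hper : (cubic c a)^[p] c = c) :
    fatouComponent (cubic c a) c ⊆
      {z | Tendsto (fun n => ((cubic c a)^[p])^[n] z) atTop (𝓝 c)} := by
  set f := cubic c a with hf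
  set g := f^[p] with hg
  have hgc : Continuous g := (continuous_cubic c a).iterate p
  obtain ⟨ε, hε, htrap⟩ := exists_trap hp hper
  set B : Set ℂ := {z | Tendsto (fun n => g^[n] z) atTop (𝓝 c)} with hB
  have hBmem : ∀ z, z ∈ B ↔ ∃ n, ‖g^[n] z - c‖ < ε := by
    intro z
    constructor
    · intro h
      have := (tendsto_iff_norm_sub_tendsto_zero.1 (show Tendsto _ _ _ from
        h)).eventually_lt_const hε
      exact this.exists
    · rintro ⟨n, hn⟩
      have := trap_tendsto htrap hn
      refine (tendsto_add_atTop_iff_nat n).1 (this.congr fun k => ?_)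
      rw [iterate_add_apply]
  have hBo : IsOpen B := by
    have : B = ⋃ n, {z | ‖g^[n] z - c‖ < ε} := by ext z; simp [hBmem]
    rw [this]
    exact isOpen_iUnion fun n =>
      isOpen_lt ((hgc.iterate n).sub continuous_const).norm continuous_const
  have hcB : c ∈ B := (hBmem c).2 ⟨0, by simpa using hε⟩
  have hBK : B ⊆ interior (filledJulia f) :=
    interior_maximal (fun z hz => mem_filledJulia_of_tendsto hp hz) hBo
  have hcF : c ∈ fatouSet f := by
    intro h
    exact Set.disjoint_left.1 disjoint_interior_frontier (hBK hcB) h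
  have hpre : IsPreconnected (fatouComponent f c) := isPreconnected_connectedComponentIn
  have hcU : c ∈ fatouComponent f c := mem_connectedComponentIn hcF
  have hUK : fatouComponent f c ⊆ interior (filledJulia f) := by
    refine hpre.subset_left_of_subset_union isOpen_interior
      (isClosed_closure (s := filledJulia f)).isOpen_compl ?_ ?_ ⟨c, hcU, hBK hcB⟩
    · exact Set.disjoint_left.2 fun x hx hx' => hx' (subset_closure (interior_subset hx))
    · intro x hx
      have hx' : x ∉ frontier (filledJulia f) := connectedComponentIn_subset _ _ hx
      by_cases hxc : x ∈ closure (filledJulia f)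
      · exact Or.inl (by by_contra h; exact hx' ⟨hxc, h⟩)
      · exact Or.inr hxc
  refine hpre.subset_of_closure_inter_subset hBo ⟨c, hcU, hcB⟩ ?_
  rintro z ⟨hz, hzU⟩
  obtain ⟨ρ, hρ, hball⟩ := Metric.isOpen_iff.1 isOpen_interior z (hUK hzU)
  set R := 2 + 3 * ‖c‖ ^ 2 + ‖a‖ with hR
  have hR0 : 0 < R := by positivity
  obtain ⟨x, hxB, hxz⟩ := Metric.mem_closure_iff.1 hz (min (ρ / 2) (ε * ρ / (8 * R)))
    (lt_min (by positivity) (by positivity))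
  rw [dist_comm] at hxz
  obtain ⟨n, hn⟩ : ∃ n, ‖g^[n] x - c‖ < ε / 2 :=
    ((tendsto_iff_norm_sub_tendsto_zero.1 (show Tendsto _ _ _ from hxB)).eventually_lt_const
      (half_pos hε)).exists
  refine (hBmem z).2 ⟨n, ?_⟩
  have hd : ∀ y ∈ ball z (ρ / 2), ‖deriv g^[n] y‖ ≤ R / (ρ / 2) := by
    intro y hy
    refine Complex.norm_deriv_le_of_forall_mem_sphere_norm_le (half_pos hρ) ?_ ?_
    · rw [hg, ← iterate_mul]
      exact Differentiable.diffContOnCl fun z => (hasDerivAt_iterate_cubic c a z _).differentiableAt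
    · intro u hu
      have huK : u ∈ filledJulia f := interior_subset (hball (by
        rw [mem_ball] at hy ⊢; rw [mem_sphere] at hu
        linarith [dist_triangle u y z]))
      rw [hg, ← iterate_mul]
      exact norm_le_of_mem_filledJulia hR.symm.le (iterate_mem_filledJulia huK _)
  have hlip := (convex_ball z (ρ / 2)).norm_image_sub_le_of_norm_deriv_le (f := g^[n])
    (fun y _ => by
      rw [hg, ← iterate_mul]; exact (hasDerivAt_iterate_cubic c a y _).differentiableAt)
    hd (show x ∈ _ from hxz.trans_le (min_le_left _ _)) (mem_ball_self (half_pos hρ))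
  have h2 : R / (ρ / 2) * ‖z - x‖ < ε / 2 := by
    have := hxz.trans_le (min_le_right _ _)
    rw [dist_comm, dist_eq_norm, lt_div_iff₀ (by positivity)] at this
    rw [div_mul_eq_mul_div, div_lt_iff₀ (by positivity)]
    nlinarith
  calc ‖g^[n] z - c‖ = ‖(g^[n] z - g^[n] x) + (g^[n] x - c)‖ := by ring_nf
    _ ≤ ‖g^[n] z - g^[n] x‖ + ‖g^[n] x - c‖ := norm_add_le _ _
    _ < ε := by linarith

end Dynamics

section LocalBottcher

lemma norm_log_le_one {w : ℂ} (hw : ‖w - 1‖ ≤ 1 / 2) : ‖Complex.log w‖ ≤ 1 := by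
  have := Complex.norm_log_one_add_half_le_self hw
  rw [add_sub_cancel] at this
  linarith

lemma mem_slitPlane_of_norm_sub_one_le {w : ℂ} (hw : ‖w - 1‖ ≤ 1 / 2) : w ∈ Complex.slitPlane := by
  have := Complex.mem_slitPlane_of_norm_lt_one (z := w - 1) (by linarith)
  rwa [add_sub_cancel] at this

/-- Böttcher's theorem near a superattracting fixed point. -/
theorem exists_local_bottcher {d : ℕ} (hd : 2 ≤ d) {g q : ℂ → ℂ} {c μ : ℂ}
    (hq : Differentiable ℂ q) (hμ : μ ≠ 0) (hμq : μ ^ (d - 1) = q 0)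
    (hg : ∀ s, g (c + s) = c + s ^ d * q s) :
    ∃ ε > 0, (∀ s : ℂ, ‖s‖ < ε → ‖g (c + s) - c‖ ≤ ‖s‖ / 2) ∧ ∃ B : ℂ → ℂ,
      DifferentiableOn ℂ B (ball c ε) ∧ B c = 0 ∧ HasDerivAt B μ c ∧
      (∀ z ∈ ball c ε, B (g z) = B z ^ d) ∧
      ∀ z ∈ ball c ε, ∃ S : ℕ → ℂ, Tendsto S atTop (𝓝 0) ∧
        ∀ n, B z ^ d ^ n = μ * (g^[n] z - c) * Complex.exp (S n) := by
  have hq0 : q 0 ≠ 0 := hμq ▸ pow_ne_zero _ hμ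
  have hqc : Tendsto q (𝓝 0) (𝓝 (q 0)) := hq.continuous.tendsto 0
  have e1 : Tendsto (fun s : ℂ => ‖s * q s‖) (𝓝 0) (𝓝 0) := by
    simpa using (tendsto_id.mul hqc).norm
  have e2 : Tendsto (fun s : ℂ => ‖q s / q 0 - 1‖) (𝓝 0) (𝓝 0) := by
    simpa [div_self hq0] using ((hqc.div_const (q 0)).sub_const 1).norm
  obtain ⟨ε, hε, h⟩ := Metric.eventually_nhds_iff.1
    ((e1.eventually_le_const (u := 1 / 2) (by norm_num)).and
      (e2.eventually_le_const (u := 1 / 2) (by norm_num)))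
  set δ := min ε 1 with hδ
  have hδ0 : 0 < δ := lt_min hε one_pos
  have h' : ∀ s : ℂ, ‖s‖ < δ → ‖s * q s‖ ≤ 1 / 2 ∧ ‖q s / q 0 - 1‖ ≤ 1 / 2 := fun s hs =>
    h (by simpa using hs.trans_le (min_le_left _ _))
  have htrap : ∀ s : ℂ, ‖s‖ < δ → ‖g (c + s) - c‖ ≤ ‖s‖ / 2 := by
    intro s hs
    rw [hg, add_sub_cancel_left, show d = (d - 2) + 2 by omega,
      show s ^ (d - 2 + 2) * q s = s ^ (d - 2) * (s * (s * q s)) by ring, norm_mul, norm_mul,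
      norm_pow]
    have h1 : ‖s‖ ^ (d - 2) ≤ 1 := pow_le_one₀ (norm_nonneg _) (hs.le.trans (min_le_right _ _))
    have h2 : ‖s‖ * ‖s * q s‖ ≤ ‖s‖ / 2 := by nlinarith [(h' s hs).1, norm_nonneg s]
    calc _ ≤ 1 * (‖s‖ * ‖s * q s‖) := by gcongr
      _ ≤ _ := by linarith
  have htrap' : ∀ z ∈ ball c δ, ∀ n, ‖g^[n] z - c‖ ≤ (1 / 2) ^ n * ‖z - c‖ := fun z hz =>
    trap_iterate htrap (by simpa [dist_eq_norm] using hz)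
  have hin : ∀ z ∈ ball c δ, ∀ n, ‖g^[n] z - c‖ < δ := fun z hz n =>
    ((htrap' z hz n).trans (mul_le_of_le_one_left (norm_nonneg _)
      (pow_le_one₀ (by norm_num) (by norm_num)))).trans_lt (by simpa [dist_eq_norm] using hz)
  have hgd : Differentiable ℂ g := by
    have : g = fun z => c + (z - c) ^ d * q (z - c) := by
      ext z; rw [← hg, add_sub_cancel]
    rw [this]
    fun_prop
  have hgc : g c = c := by simpa [show d ≠ 0 by omega] using hg 0
  have hgd' : ∀ n, Differentiable ℂ g^[n] := fun n => hgd.iterate n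
  set L : ℕ → ℂ → ℂ := fun k z => Complex.log (q (g^[k] z - c) / q 0) with hL
  have hLd : ∀ k, DifferentiableOn ℂ (L k) (ball c δ) := by
    intro k z hz
    refine DifferentiableWithinAt.clog ?_
      (mem_slitPlane_of_norm_sub_one_le (h' _ (hin z hz k)).2)
    exact (((hq.comp ((hgd' k).sub_const c)).div_const (q 0)) z).differentiableWithinAt
  have hLC : ∀ k, ∀ z ∈ ball c δ, ‖L k z‖ ≤ 1 := fun k z hz =>
    norm_log_le_one (h' _ (hin z hz k)).2
  have hβ : ∀ z ∈ ball c δ, ∀ k, μ * (g^[k + 1] z - c) =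
      (μ * (g^[k] z - c)) ^ d * Complex.exp (L k z) := by
    intro z hz k
    have hne : q (g^[k] z - c) / q 0 ≠ 0 :=
      Complex.slitPlane_ne_zero (mem_slitPlane_of_norm_sub_one_le (h' _ (hin z hz k)).2)
    rw [hL, Complex.exp_log hne, iterate_succ_apply']
    have := hg (g^[k] z - c)
    rw [add_sub_cancel] at this
    rw [this, add_sub_cancel_left, mul_pow, ← hμq]
    have hμ' : μ ^ d = μ ^ (d - 1) * μ := by rw [← pow_succ]; congr 1; omega
    rw [hμ']
    field_simp
  have hE : DifferentiableOn ℂ (fun z => logSum d (fun k => L k z) 0) (ball c δ) :=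
    differentiableOn_logSum isOpen_ball hd hLd hLC 0
  have hcb : c ∈ ball c δ := mem_ball_self hδ0
  have hBd : DifferentiableOn ℂ
      (fun z => μ * (z - c) * Complex.exp (logSum d (fun k => L k z) 0)) (ball c δ) := by
    fun_prop
  have hL0 : ∀ z ∈ ball c δ, Tendsto (fun k => L k z) atTop (𝓝 0) := by
    intro z hz
    have h1 : Tendsto (fun k => g^[k] z - c) atTop (𝓝 0) := by
      simpa using (trap_tendsto htrap (by simpa [dist_eq_norm] using hz)).sub_const c
    have h2 := ((hqc.comp h1).div_const (q 0)).clog (by simp [div_self hq0])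
    simpa [div_self hq0] using h2
  refine ⟨δ, hδ0, htrap, fun z => μ * (z - c) * Complex.exp (logSum d (fun k => L k z) 0),
    hBd, by simp, ?_, ?_, ?_⟩
  · have hLc : ∀ k, L k c = 0 := by
      intro k
      have : g^[k] c = c := iterate_fixed hgc k
      simp [hL, this, div_self hq0]
    have h1 := (((hasDerivAt_id c).sub_const c).const_mul μ).mul
      ((hE.differentiableAt (ball_mem_nhds c hδ0)).hasDerivAt.cexp)
    refine h1.congr_deriv ?_
    simp [hLc, logSum]
  · intro z hz
    have h1 := bottcher_pow (l := fun k => L k z) (β := fun k => μ * (g^[k] z - c)) hd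
      (fun k => hLC k z hz) (hβ z hz) 1
    have hs : (fun k => L k (g z)) = fun k => L (k + 1) z := by
      ext k; simp only [hL, iterate_succ_apply]
    simp only [pow_one, iterate_one, iterate_zero, id] at h1
    rw [h1]
    show μ * (g z - c) * Complex.exp (logSum d (fun k => L k (g z)) 0) = _
    rw [hs]
    simp only [logSum, zero_add, add_comm 1]
  · intro z hz
    exact ⟨_, tendsto_logSum hd (hL0 z hz), fun n =>
      bottcher_pow (l := fun k => L k z) (β := fun k => μ * (g^[k] z - c)) hd
      (fun k => hLC k z hz) (hβ z hz) n⟩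

end LocalBottcher

section InverseContinuation

lemma exists_analytic_localInverse {f : ℂ → ℂ} {z₀ : ℂ} (hf : AnalyticAt ℂ f z₀)
    (hd : deriv f z₀ ≠ 0) : ∃ h : ℂ → ℂ, AnalyticAt ℂ h (f z₀) ∧ h (f z₀) = z₀ ∧
      (∀ᶠ y in 𝓝 (f z₀), f (h y) = y) ∧ ∀ᶠ z in 𝓝 z₀, h (f z) = z := by
  have hs := hf.hasStrictDerivAt
  exact ⟨hs.localInverse f _ z₀ hd, hf.analyticAt_localInverse hd,
    (hs.eventually_left_inverse hd).self_of_nhds, hs.eventually_right_inverse hd,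
    hs.eventually_left_inverse hd⟩

/-- Conjugating `w ↦ w ^ 2` near `0` to `g` near a superattracting fixed point. -/
lemma exists_local_uniformizer {g B : ℂ → ℂ} {c μ : ℂ} {ε : ℝ} (hε : 0 < ε) (hμ : μ ≠ 0)
    (hg : Continuous g) (hgc : g c = c)
    (hB : DifferentiableOn ℂ B (ball c ε)) (hBc : B c = 0) (hBd : HasDerivAt B μ c)
    (hconj : ∀ z ∈ ball c ε, B (g z) = B z ^ 2) :
    ∃ η > 0, η < 1 ∧ ∃ ψ : ℂ → ℂ, AnalyticOnNhd ℂ ψ (ball 0 η) ∧ ψ 0 = c ∧ HasDerivAt ψ μ⁻¹ 0 ∧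
      (∀ b ∈ ball 0 η, g (ψ b) = ψ (b ^ 2)) ∧ ∀ᶠ b in 𝓝 0, B (ψ b) = b := by
  have hBa : AnalyticAt ℂ B c := hB.analyticAt (ball_mem_nhds c hε)
  obtain ⟨ψ, hψ, hψc, h1, h2⟩ := exists_analytic_localInverse hBa (hBd.deriv ▸ hμ)
  rw [hBc] at hψ hψc h1
  have hψt : Tendsto ψ (𝓝 0) (𝓝 c) := by simpa [hψc] using hψ.continuousAt.tendsto
  have hgt : Tendsto g (𝓝 c) (𝓝 c) := by simpa [hgc] using hg.tendsto c
  have e1 : ∀ᶠ b in 𝓝 (0 : ℂ), g (ψ b) = ψ (b ^ 2) := by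
    filter_upwards [h1, hψt.eventually (ball_mem_nhds c hε), (hgt.comp hψt).eventually h2]
      with b hb1 hb2 hb3
    have := hconj _ hb2
    rw [hb1] at this
    rw [← this]
    exact hb3.symm
  obtain ⟨η, hη, h⟩ := Metric.eventually_nhds_iff_ball.1 (e1.and hψ.eventually_analyticAt)
  refine ⟨min η (1 / 2), lt_min hη (by norm_num), (min_le_right _ _).trans_lt (by norm_num), ψ,
    fun b hb => (h b (ball_subset_ball (min_le_left _ _) hb)).2, hψc, ?_,
    fun b hb => (h b (ball_subset_ball (min_le_left _ _) hb)).1, h1⟩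
  exact HasDerivAt.of_local_left_inverse (f := B) (g := ψ) hψ.continuousAt
    (by rwa [hψc]) hμ h1

lemma exists_extension_or_critical {g ψ : ℂ → ℂ} (hg : Differentiable ℂ g) {r M : ℝ} (hr : 0 < r)
    (hr1 : r < 1) (hψ : AnalyticOnNhd ℂ ψ (ball 0 r)) (hM : ∀ b ∈ ball 0 r, ‖ψ b‖ ≤ M)
    (hconj : ∀ b ∈ ball 0 r, g (ψ b) = ψ (b ^ 2)) {b₀ : ℂ} (hb₀ : ‖b₀‖ = r) :
    (∃ δ > 0, ∃ φ, AnalyticOnNhd ℂ φ (ball b₀ δ) ∧ ∀ b ∈ ball b₀ δ, ‖b‖ < r → φ b = ψ b) ∨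
      ∃ z, deriv g z = 0 ∧ g z = ψ (b₀ ^ 2) := by
  have hcl : b₀ ∈ closure (ball (0 : ℂ) r) := by
    rw [closure_ball _ hr.ne']; simp [hb₀]
  have : (𝓝[ball (0 : ℂ) r] b₀).NeBot := mem_closure_iff_nhdsWithin_neBot.1 hcl
  obtain ⟨z, -, hz⟩ := (isCompact_closedBall (0 : ℂ) M).exists_mapClusterPt
    (f := 𝓝[ball (0 : ℂ) r] b₀) (u := ψ) (by
      rw [le_principal_iff, mem_map]
      filter_upwards [self_mem_nhdsWithin] with b hb
      simpa using hM b hb)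
  have hsq : b₀ ^ 2 ∈ ball (0 : ℂ) r := by
    rw [mem_ball_zero_iff, norm_pow, hb₀]; nlinarith
  have hψ2 : ContinuousAt (fun b => ψ (b ^ 2)) b₀ :=
    ContinuousAt.comp (f := fun b : ℂ => b ^ 2) (hψ _ hsq).continuousAt (by fun_prop)
  have hgz : g z = ψ (b₀ ^ 2) := by
    have h1 : MapClusterPt (g z) (𝓝[ball (0 : ℂ) r] b₀) (g ∘ ψ) :=
      hz.tendsto_comp (hg.continuous.tendsto z)
    have h2 : Tendsto (g ∘ ψ) (𝓝[ball (0 : ℂ) r] b₀) (𝓝 (ψ (b₀ ^ 2))) := by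
      refine (hψ2.tendsto.mono_left nhdsWithin_le_nhds).congr' ?_
      filter_upwards [self_mem_nhdsWithin] with b hb
      exact (hconj b hb).symm
    exact @eq_of_nhds_neBot _ _ _ _ _ (NeBot.mono h1 (inf_le_inf_left _ h2))
  by_cases hd : deriv g z = 0
  · exact Or.inr ⟨z, hd, hgz⟩
  left
  obtain ⟨h, hh, hhz, -, hleft⟩ := exists_analytic_localInverse
    (hg.differentiableOn.analyticAt univ_mem) hd
  rw [hgz] at hh
  have hφ : AnalyticAt ℂ (fun b => h (ψ (b ^ 2))) b₀ :=
    AnalyticAt.comp (f := fun b => ψ (b ^ 2)) hh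
      (AnalyticAt.comp (f := fun b : ℂ => b ^ 2) (hψ _ hsq) (by fun_prop))
  obtain ⟨δ, hδ, hφδ⟩ := Metric.eventually_nhds_iff_ball.1 hφ.eventually_analyticAt
  refine ⟨δ, hδ, _, hφδ, ?_⟩
  obtain ⟨b₁, hb₁, hb₁δ, hb₁r⟩ := ((hz.frequently
    (eventually_eventually_nhds.2 hleft)).and_eventually
    (Filter.Eventually.and (show ∀ᶠ b in 𝓝[ball (0 : ℂ) r] b₀, b ∈ ball b₀ δ from
      mem_nhdsWithin_of_mem_nhds (ball_mem_nhds b₀ hδ)) self_mem_nhdsWithin)).exists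
  have key : EqOn (fun b => h (ψ (b ^ 2))) ψ (ball b₀ δ ∩ ball 0 r) := by
    refine AnalyticOnNhd.eqOn_of_preconnected_of_eventuallyEq (fun b hb => hφδ b hb.1)
      (fun b hb => hψ b hb.2) ((convex_ball _ _).inter (convex_ball _ _)).isPreconnected
      (z₀ := b₁) ⟨hb₁δ, hb₁r⟩ ?_
    filter_upwards [(hψ b₁ hb₁r).continuousAt.tendsto.eventually hb₁,
      isOpen_ball.mem_nhds hb₁r] with b h1 h2
    rw [← hconj b h2, h1]
  exact fun b hb hbr => key ⟨hb, mem_ball_zero_iff.2 hbr⟩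

end InverseContinuation

section FullExtension

lemma iterate_conj_sq {g ψ : ℂ → ℂ} {r : ℝ} (hr1 : r ≤ 1)
    (hconj : ∀ b ∈ ball (0 : ℂ) r, g (ψ b) = ψ (b ^ 2)) {b : ℂ} (hb : b ∈ ball (0 : ℂ) r) (n : ℕ) :
    g^[n] (ψ b) = ψ (b ^ 2 ^ n) := by
  induction n with
  | zero => simp
  | succ n ih =>
    rw [iterate_succ_apply', ih, pow_succ, pow_mul]
    refine hconj _ ?_
    rw [mem_ball_zero_iff] at hb ⊢
    rw [norm_pow]
    exact (pow_le_of_le_one (norm_nonneg _) (hb.le.trans hr1) (by positivity)).trans_lt hb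

lemma tendsto_pow_two_pow {b : ℂ} (hb : ‖b‖ < 1) :
    Tendsto (fun n : ℕ => b ^ 2 ^ n) atTop (𝓝 0) :=
  (tendsto_pow_atTop_nhds_zero_of_norm_lt_one hb).comp
    (tendsto_pow_atTop_atTop_of_one_lt one_lt_two)

lemma deriv_ne_zero_of_conj_sq {g ψ : ℂ → ℂ} (hg : Differentiable ℂ g)
    (hψ : AnalyticOnNhd ℂ ψ (ball 0 1)) (hψ0 : deriv ψ 0 ≠ 0)
    (hconj : ∀ b ∈ ball (0 : ℂ) 1, g (ψ b) = ψ (b ^ 2)) {b : ℂ} (hb : b ∈ ball (0 : ℂ) 1) :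
    deriv g (ψ b) * deriv ψ b = deriv ψ (b ^ 2) * (2 * b) ∧ deriv ψ b ≠ 0 := by
  have hsq : ∀ b ∈ ball (0 : ℂ) 1, b ^ 2 ∈ ball (0 : ℂ) 1 := fun b hb => by
    rw [mem_ball_zero_iff] at hb ⊢
    rw [norm_pow]; nlinarith [norm_nonneg b]
  have hchain : ∀ b ∈ ball (0 : ℂ) 1,
      deriv g (ψ b) * deriv ψ b = deriv ψ (b ^ 2) * (2 * b) := by
    intro b hb
    have h1 : HasDerivAt (fun x => g (ψ x)) (deriv g (ψ b) * deriv ψ b) b :=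
      (hg (ψ b)).hasDerivAt.comp b (hψ b hb).differentiableAt.hasDerivAt
    have h2 : HasDerivAt (fun x => ψ (x ^ 2)) (deriv ψ (b ^ 2) * (2 * b)) b := by
      have := (hψ _ (hsq b hb)).differentiableAt.hasDerivAt.comp b (hasDerivAt_pow 2 b)
      exact this.congr_deriv (by simp)
    refine h1.unique (h2.congr_of_eventuallyEq ?_)
    filter_upwards [isOpen_ball.mem_nhds hb] with x hx using hconj x hx
  refine ⟨hchain b hb, fun h0 => hψ0 ?_⟩
  have hz : ∀ n, b ^ 2 ^ n ∈ ball (0 : ℂ) 1 ∧ deriv ψ (b ^ 2 ^ n) = 0 := by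
    intro n
    induction n with
    | zero => simpa using ⟨mem_ball_zero_iff.1 hb, h0⟩
    | succ n ih =>
      rw [pow_succ, pow_mul]
      refine ⟨hsq _ ih.1, ?_⟩
      by_cases hb0 : b ^ 2 ^ n = 0
      · rw [hb0] at ih ⊢; simpa using ih.2
      · have := hchain _ ih.1
        rw [ih.2, mul_zero] at this
        exact (mul_eq_zero.1 this.symm).resolve_right (mul_ne_zero two_ne_zero hb0)
  have h1 := ((hψ 0 (mem_ball_self one_pos)).deriv.continuousAt.tendsto).comp
    (tendsto_pow_two_pow (mem_ball_zero_iff.1 hb))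
  refine tendsto_nhds_unique (h1.congr fun n => (hz n).2) tendsto_const_nhds |>.symm ▸ rfl

/-- If the inverse Böttcher coordinate is defined on the whole disc, the immediate basin has no
critical point besides the fixed point. -/
lemma deriv_ne_zero_of_full_extension {g B ψ : ℂ → ℂ} {c : ℂ} {ε : ℝ} (hg : Differentiable ℂ g)
    (hε : 0 < ε) (htrap : ∀ s : ℂ, ‖s‖ < ε → ‖g (c + s) - c‖ ≤ ‖s‖ / 2)
    (hB : DifferentiableOn ℂ B (ball c ε)) (hBc : B c = 0)
    (hBconj : ∀ z ∈ ball c ε, B (g z) = B z ^ 2)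
    (hψ : AnalyticOnNhd ℂ ψ (ball 0 1)) (hψc : ψ 0 = c) (hψ0 : deriv ψ 0 ≠ 0)
    (hconj : ∀ b ∈ ball (0 : ℂ) 1, g (ψ b) = ψ (b ^ 2)) (hBψ : ∀ᶠ b in 𝓝 0, B (ψ b) = b)
    {U : Set ℂ} (hU : IsPreconnected U) (hcU : c ∈ U)
    (hUB : ∀ z ∈ U, Tendsto (fun n => g^[n] z) atTop (𝓝 c)) {z : ℂ} (hz : z ∈ U) (hzc : z ≠ c) :
    deriv g z ≠ 0 := by
  have hBit : ∀ z ∈ ball c ε, ∀ n, g^[n] z ∈ ball c ε ∧ B (g^[n] z) = B z ^ 2 ^ n := by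
    intro z hz n
    induction n with
    | zero => simpa using hz
    | succ n ih =>
      rw [iterate_succ_apply', hBconj _ ih.1, ih.2, ← pow_mul, ← pow_succ]
      refine ⟨?_, rfl⟩
      have h1 := mem_ball_iff_norm.1 ih.1
      have h2 := htrap _ h1
      rw [add_sub_cancel] at h2
      rw [mem_ball_iff_norm]
      linarith [norm_nonneg (g^[n] z - c)]
  have hBlt : ∀ z ∈ ball c ε, ‖B z‖ < 1 := by
    intro z hz
    by_contra! h
    have h1 : Tendsto (fun n => B (g^[n] z)) atTop (𝓝 0) := by
      have := ((hB.differentiableAt (ball_mem_nhds c hε)).continuousAt.tendsto).comp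
        (trap_tendsto htrap (mem_ball_iff_norm.1 hz))
      rwa [hBc] at this
    obtain ⟨n, hn⟩ := (h1.norm.eventually_lt_const (u := 1) (by simp)).exists
    rw [(hBit z hz n).2, norm_pow] at hn
    exact absurd hn (not_lt.2 (one_le_pow₀ h))
  have hnorm : ∀ b ∈ ball (0 : ℂ) 1, ψ b ∈ ball c ε → ‖B (ψ b)‖ = ‖b‖ := by
    intro b hb hbε
    obtain ⟨n, hn⟩ := ((tendsto_pow_two_pow (mem_ball_zero_iff.1 hb)).eventually hBψ).exists
    rw [← iterate_conj_sq le_rfl hconj hb, (hBit _ hbε n).2] at hn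
    have := congrArg norm hn
    rw [norm_pow, norm_pow] at this
    exact (pow_left_inj₀ (norm_nonneg _) (norm_nonneg _) (by positivity)).1 this
  have hopen : IsOpen (ψ '' ball 0 1) := by
    rw [isOpen_iff_mem_nhds]
    rintro _ ⟨b, hb, rfl⟩
    have := ((hψ b hb).hasStrictDerivAt).map_nhds_eq
      (deriv_ne_zero_of_conj_sq hg hψ hψ0 hconj hb).2
    rw [← this]
    exact image_mem_map (isOpen_ball.mem_nhds hb)
  have hsub : U ⊆ ψ '' ball 0 1 := by
    refine hU.subset_of_closure_inter_subset hopen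
      ⟨c, hcU, 0, mem_ball_self one_pos, hψc⟩ ?_
    rintro x ⟨hx, hxU⟩
    obtain ⟨m, hm⟩ := ((hUB x hxU).eventually (ball_mem_nhds c hε)).exists
    obtain ⟨ρ, hρ1, hρ2⟩ := exists_between (hBlt _ hm)
    have hgm : Tendsto g^[m] (𝓝 x) (𝓝 (g^[m] x)) := (hg.continuous.iterate m).tendsto x
    have hN : ∀ᶠ y in 𝓝 x, g^[m] y ∈ ball c ε ∧ ‖B (g^[m] y)‖ < ρ :=
      (hgm.eventually (isOpen_ball.mem_nhds hm)).and
        ((((hB.differentiableAt (isOpen_ball.mem_nhds hm)).continuousAt.tendsto.comp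
          hgm).norm).eventually_lt_const hρ1)
    set C : Set ℂ := {b | ‖b‖ ^ 2 ^ m ≤ ρ} with hC
    have hCb : C ⊆ ball 0 1 := by
      intro b hb
      rw [mem_ball_zero_iff]
      by_contra! h
      exact absurd ((one_le_pow₀ h).trans hb) (not_le.2 hρ2)
    have hCc : IsCompact C := by
      refine Metric.isCompact_of_isClosed_isBounded
        (isClosed_le (by fun_prop) continuous_const) (isBounded_ball.subset hCb)
    have himg : IsClosed (ψ '' C) :=
      (hCc.image_of_continuousOn ((hψ.continuousOn).mono hCb)).isClosed
    have hxC : x ∈ closure (ψ '' C) := by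
      rw [mem_closure_iff_nhds]
      intro t ht
      obtain ⟨y, ⟨hyt, hy⟩, b, hb, rfl⟩ := mem_closure_iff_nhds.1 hx _ (inter_mem ht hN)
      refine ⟨ψ b, hyt, b, ?_, rfl⟩
      have hy' : g^[m] (ψ b) ∈ ball c ε ∧ ‖B (g^[m] (ψ b))‖ < ρ := hy
      rw [iterate_conj_sq le_rfl hconj hb] at hy'
      have hbm : b ^ 2 ^ m ∈ ball (0 : ℂ) 1 := by
        rw [mem_ball_zero_iff] at hb ⊢
        rw [norm_pow]
        exact pow_lt_one₀ (norm_nonneg _) hb (by positivity)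
      rw [hnorm _ hbm hy'.1, norm_pow] at hy'
      exact hy'.2.le
    rw [himg.closure_eq] at hxC
    exact image_mono hCb hxC
  obtain ⟨b, hb, rfl⟩ := hsub hz
  have hb0 : b ≠ 0 := by rintro rfl; exact hzc hψc
  have hb2 : b ^ 2 ∈ ball (0 : ℂ) 1 := by
    rw [mem_ball_zero_iff] at hb ⊢
    rw [norm_pow]; nlinarith [norm_nonneg b]
  intro h0
  have h1 := (deriv_ne_zero_of_conj_sq hg hψ hψ0 hconj hb).1
  rw [h0, zero_mul] at h1
  exact mul_ne_zero (deriv_ne_zero_of_conj_sq hg hψ hψ0 hconj hb2).2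
    (mul_ne_zero two_ne_zero hb0) h1.symm

end FullExtension

section CriticalParameter

/-- The orbit of the free critical point `-c` under the first return map, centred at `c`. -/
noncomputable def critOrbit (p : ℕ) (w : ℂ × ℂ) (n : ℕ) : ℂ :=
  ((cubic w.1 w.2)^[p])^[n] (-w.1) - w.1

/-- `t` is a square root of the Böttcher coordinate of `f^p(-c)`, in the sense that it has the
same asymptotics along the orbit. -/
def IsCritParam (p : ℕ) (w : ℂ × ℂ) (t : ℂ) : Prop :=
  (w.1 = 0 ∧ t = 0) ∨ (w.1 ≠ 0 ∧
    Tendsto (fun n => t ^ 2 ^ (n + 1) / (retFactor p w.1 w.2 0 * critOrbit p w n)) atTop (𝓝 1))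

variable {p : ℕ} {c a : ℂ}

lemma retFactor_zero_ne_zero (hp : 1 ≤ p) (hw : (c, a) ∈ Sp p) (hc : c ≠ 0)
    (ht : Tendsto (critOrbit p (c, a)) atTop (𝓝 0)) : retFactor p c a 0 ≠ 0 := by
  rw [retFactor, zero_add]
  refine mul_ne_zero (by simpa using hc) ?_
  rw [critFactor_zero_eq, Finset.prod_ne_zero_iff]
  intro k hk h
  rw [Finset.mem_range] at hk
  have h' : (cubic c a)^[k + 1] c ^ 2 = c ^ 2 := by linear_combination h / 3
  rcases sq_eq_sq_iff_eq_or_eq_neg.1 h' with h' | h'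
  · exact hw.2 (k + 1) (by omega) (by omega) h'
  · have h1 : ∀ n, critOrbit p (c, a) n = -c - c := by
      intro n
      have : ((cubic c a)^[p])^[n] (-c) = -c := by
        rw [← h', ← iterate_mul, ← iterate_add_apply, add_comm, iterate_add_apply, iterate_mul,
          iterate_fixed hw.1]
      simp [critOrbit, this]
    have h2 := tendsto_nhds_unique (ht.congr h1) tendsto_const_nhds
    exact hc (by linear_combination h2 / 2)

lemma eq_or_eq_neg_of_isCritical (hw : (c, a) ∈ Sp p)
    (ht : Tendsto (critOrbit p (c, a)) atTop (𝓝 0)) {z : ℂ}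
    (hz : deriv (cubic c a)^[p] z = 0)
    (hzt : Tendsto (fun n => ((cubic c a)^[p])^[n] z) atTop (𝓝 c)) : z = c ∨ z = -c := by
  obtain ⟨k, hk, h⟩ := isCritical_iterate_cubic hz
  have ht' : Tendsto (fun n => ((cubic c a)^[p])^[n] (-c)) atTop (𝓝 c) := by
    simpa [critOrbit] using ht.add_const c
  have h1 : Tendsto (fun n => ((cubic c a)^[p])^[n] ((cubic c a)^[k] z)) atTop
      (𝓝 ((cubic c a)^[k] c)) := by
    refine ((((continuous_cubic c a).iterate k).tendsto c).comp hzt).congr fun n => ?_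
    simp only [comp_apply]
    rw [← iterate_mul, ← iterate_add_apply, ← iterate_add_apply, add_comm]
  have h2 : (cubic c a)^[k] c = c := by
    rcases h with h | h
    · rw [h] at h1
      exact tendsto_nhds_unique h1 (tendsto_const_nhds.congr fun n => (iterate_fixed hw.1 n).symm)
    · rw [h] at h1
      exact tendsto_nhds_unique h1 ht'
  have hk0 : k = 0 := by
    by_contra h0
    exact hw.2 k (by omega) hk h2
  subst hk0
  exact h

lemma conj_sq_of_eventually {g ψ : ℂ → ℂ} (hg : Differentiable ℂ g) {r : ℝ} (hr : 0 < r)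
    (hr1 : r ≤ 1) (hψ : AnalyticOnNhd ℂ ψ (ball 0 r))
    (hconj : ∀ᶠ b in 𝓝 (0 : ℂ), g (ψ b) = ψ (b ^ 2)) :
    ∀ b ∈ ball (0 : ℂ) r, g (ψ b) = ψ (b ^ 2) := by
  have h1 : AnalyticOnNhd ℂ (fun b => g (ψ b)) (ball 0 r) := fun b hb =>
    AnalyticAt.comp (f := ψ) (g := g) (hg.analyticAt _) (hψ b hb)
  have h2 : AnalyticOnNhd ℂ (fun b => ψ (b ^ 2)) (ball 0 r) := by
    intro b hb
    refine AnalyticAt.comp (f := fun b : ℂ => b ^ 2) (hψ _ ?_) (by fun_prop)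
    rw [mem_ball_zero_iff] at hb ⊢
    rw [norm_pow]
    exact (pow_le_of_le_one (norm_nonneg _) (hb.le.trans hr1) two_ne_zero).trans_lt hb
  exact h1.eqOn_of_preconnected_of_eventuallyEq h2 (convex_ball _ _).isPreconnected
    (mem_ball_self hr) hconj

theorem exists_isCritParam (hp : 1 ≤ p) (hw : (c, a) ∈ Sp p) (hc : c ≠ 0)
    (hU : -c ∈ fatouComponent (cubic c a) c) {R : ℝ} (hR : 2 + 3 * ‖c‖ ^ 2 + ‖a‖ ≤ R) :
    ∃ t, t ≠ 0 ∧ ‖t‖ < 1 ∧ IsCritParam p (c, a) t ∧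
      ∀ n, 1 ≤ n → ‖critOrbit p (c, a) n‖ ≤ 2 * R * ‖t‖ ^ (2 * (2 ^ n - 1)) := by
  have hper : (cubic c a)^[p] c = c := hw.1
  have hbasin := fatouComponent_subset_basin hp hper
  have ht' : Tendsto (fun n => ((cubic c a)^[p])^[n] (-c)) atTop (𝓝 c) := hbasin hU
  have ht : Tendsto (critOrbit p (c, a)) atTop (𝓝 0) := by
    have h1 := ht'.sub_const c
    rwa [sub_self] at h1
  have hl := retFactor_zero_ne_zero hp hw hc ht
  set l := retFactor p c a 0 with hl_def
  have hg : Differentiable ℂ (cubic c a)^[p] := (differentiable_cubic c a).iterate p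
  obtain ⟨ε, hε, htrap, B, hBd, hBc, hBl, hBconj, -⟩ := exists_local_bottcher (d := 2) le_rfl
    (g := (cubic c a)^[p]) (q := retFactor p c a) (c := c) (μ := l)
    (((contDiff_retFactor (n := 1) p).comp
      (show ContDiff ℂ 1 fun s : ℂ => ((c, a, s) : ℂ × ℂ × ℂ) by fun_prop)).differentiable
        (by norm_num)) hl (by simp [hl_def])
    (fun s => by rw [iterate_cubic_add_eq hp, hper])
  obtain ⟨η, hη, hη1, ψ₀, hψ₀, hψc, hψd, hψconj, hBψ⟩ := exists_local_uniformizer hε hl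
    hg.continuous hper hBd hBc hBl hBconj
  have hcU : c ∈ fatouComponent (cubic c a) c := by
    refine mem_connectedComponentIn ?_
    by_contra h
    rw [fatouComponent, connectedComponentIn_eq_empty h] at hU
    exact hU
  have near : ∀ r, η ≤ r → ∀ f : ℂ → ℂ, (∀ b ∈ ball (0 : ℂ) η, f b = ψ₀ b) →
      f =ᶠ[𝓝 0] ψ₀ ∧ f 0 = c ∧ ∀ᶠ b in 𝓝 (0 : ℂ), (cubic c a)^[p] (f b) = f (b ^ 2) := by
    intro r hr f hf
    refine ⟨?_, ?_, ?_⟩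
    · filter_upwards [ball_mem_nhds 0 hη] with b hb using hf b hb
    · rw [hf 0 (mem_ball_self hη), hψc]
    · filter_upwards [ball_mem_nhds 0 hη] with b hb
      rw [hf b hb, hψconj b hb, hf]
      rw [mem_ball_zero_iff] at hb ⊢
      rw [norm_pow]
      exact (pow_le_of_le_one (norm_nonneg _) (hb.le.trans hη1.le) two_ne_zero).trans_lt hb
  by_contra hno
  obtain ⟨ψ, hψ, -, hψψ₀⟩ := analytic_continuation_ball (fun _ _ => True) hη hη1.le hψ₀
    (fun _ _ => trivial) (by
      intro r hηr hr1 f hf _ hff₀ b₀ hb₀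
      have hr0 : 0 < r := hη.trans_le hηr
      obtain ⟨hfe, hf0, hfe'⟩ := near r hηr f hff₀
      have hconj := conj_sq_of_eventually hg hr0 hr1.le hf hfe'
      have hcont : Tendsto f (𝓝 0) (𝓝 c) := by
        simpa [hf0] using (hf 0 (mem_ball_self hr0)).continuousAt.tendsto
      have hfb : ∀ b ∈ ball (0 : ℂ) r,
          Tendsto (fun n => ((cubic c a)^[p])^[n] (f b)) atTop (𝓝 c) := by
        intro b hb
        refine (hcont.comp (tendsto_pow_two_pow
          ((mem_ball_zero_iff.1 hb).trans hr1))).congr fun n => ?_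
        exact (iterate_conj_sq hr1.le hconj hb n).symm
      have hM : ∀ b ∈ ball (0 : ℂ) r, ‖f b‖ ≤ R := fun b hb =>
        norm_le_of_mem_filledJulia hR (mem_filledJulia_of_tendsto hp (hfb b hb))
      have hcR : ‖c‖ ≤ R := hf0 ▸ hM 0 (mem_ball_self hr0)
      have hb₀2 : b₀ ^ 2 ∈ ball (0 : ℂ) r := by
        rw [mem_ball_zero_iff, norm_pow, hb₀]; nlinarith
      have hb₀0 : b₀ ≠ 0 := by rintro rfl; simp at hb₀; linarith
      have hslope : Tendsto (fun b => (f b - c) / b) (𝓝[≠] 0) (𝓝 l⁻¹) := by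
        have h1 : HasDerivAt f l⁻¹ 0 := hψd.congr_of_eventuallyEq hfe
        have := hasDerivAt_iff_tendsto_slope.1 h1
        refine this.congr fun b => ?_
        simp [slope_def_field, hf0]
      have hpow : Tendsto (fun n : ℕ => b₀ ^ 2 ^ n) atTop (𝓝[≠] 0) :=
        tendsto_nhdsWithin_iff.2 ⟨tendsto_pow_two_pow (hb₀ ▸ hr1),
          .of_forall fun n => pow_ne_zero _ hb₀0⟩
      rcases exists_extension_or_critical hg hr0 hr1 hf hM hconj hb₀ with h | ⟨z, hz, hgz⟩
      · obtain ⟨δ, hδ, φ, hφ, h⟩ := h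
        exact ⟨δ, hδ, φ, hφ, fun _ _ => trivial, h⟩
      exfalso
      have hzt : Tendsto (fun n => ((cubic c a)^[p])^[n] z) atTop (𝓝 c) := by
        rw [← tendsto_add_atTop_iff_nat 1]
        simp only [iterate_succ_apply, hgz]
        exact hfb _ hb₀2
      have hit : ∀ n, ((cubic c a)^[p])^[n + 1] z = f (b₀ ^ 2 ^ (n + 1)) := fun n => by
        rw [iterate_succ_apply, hgz, iterate_conj_sq hr1.le hconj hb₀2, ← pow_mul, pow_succ']
      rcases eq_or_eq_neg_of_isCritical hw ht hz hzt with rfl | rfl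
      · have h1 := hslope.comp (hpow.comp (tendsto_add_atTop_nat 1))
        have h2 : Tendsto (fun _ : ℕ => (0 : ℂ)) atTop (𝓝 l⁻¹) := by
          refine h1.congr fun n => ?_
          simp only [comp_apply]
          rw [← hit, iterate_fixed hper, sub_self, zero_div]
        exact inv_ne_zero hl (tendsto_nhds_unique tendsto_const_nhds h2).symm
      · obtain ⟨t, htb⟩ := IsAlgClosed.exists_pow_nat_eq b₀ two_pos
        have htr : ‖t‖ ^ 2 = r := by rw [← norm_pow, htb, hb₀]
        have horb : ∀ n, critOrbit p (c, a) (n + 1) = f (b₀ ^ 2 ^ (n + 1)) - c := fun n => by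
          rw [← hit]; rfl
        refine hno ⟨t, ?_, ?_, Or.inr ⟨hc, ?_⟩, ?_⟩
        · rintro rfl
          exact hb₀0 (by rw [← htb]; simp)
        · nlinarith [norm_nonneg t]
        · rw [← tendsto_add_atTop_iff_nat 1]
          have h1 := ((hslope.comp (hpow.comp (tendsto_add_atTop_nat 1))).inv₀
            (inv_ne_zero hl)).div_const l
          rw [inv_inv, div_self hl] at h1
          refine h1.congr fun n => ?_
          simp only [comp_apply]
          rw [horb, inv_div, div_div, pow_succ' 2 (n + 1), pow_mul, htb, mul_comm l]
        · intro n hn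
          obtain ⟨m, rfl⟩ : ∃ m, n = m + 1 := ⟨n - 1, by omega⟩
          have hbm : b₀ ^ 2 ^ (m + 1) ∈ ball (0 : ℂ) r := by
            rw [mem_ball_zero_iff, norm_pow, hb₀]
            exact pow_lt_self_of_lt_one₀ hr0 hr1 (Nat.one_lt_two_pow (by omega))
          have hmaps : MapsTo f (ball 0 r) (closedBall (f 0) (2 * R)) := by
            intro b hb
            rw [mem_closedBall, dist_eq_norm, hf0]
            linarith [norm_sub_le (f b) c, hM b hb]
          have h1 := Complex.dist_le_div_mul_dist_of_mapsTo_ball hf.differentiableOn hmaps hbm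
          rw [hf0, dist_eq_norm, dist_zero_right, norm_pow, hb₀] at h1
          rw [horb]
          refine h1.trans_eq ?_
          rw [pow_mul, htr, div_mul_eq_mul_div, div_eq_iff hr0.ne',
            mul_assoc (2 * R) _ r, ← pow_succ, Nat.sub_add_cancel Nat.one_le_two_pow])
  have hψ0 : deriv ψ 0 ≠ 0 := by
    rw [(near 1 hη1.le ψ hψψ₀).1.deriv_eq, hψd.deriv]
    exact inv_ne_zero hl
  refine deriv_ne_zero_of_full_extension hg hε htrap hBd hBc hBconj hψ
    (near 1 hη1.le ψ hψψ₀).2.1 hψ0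
    (conj_sq_of_eventually hg one_pos le_rfl hψ (near 1 hη1.le ψ hψψ₀).2.2) ?_
    isPreconnected_connectedComponentIn hcU (fun z hz => hbasin hz) hU
    (fun h => hc (by linear_combination -h / 2)) ?_
  · filter_upwards [hBψ, (near 1 hη1.le ψ hψψ₀).1] with b h1 h2
    rw [h2, h1]
  · rw [(hasDerivAt_iterate_cubic c a (-c) p).deriv]
    refine Finset.prod_eq_zero (Finset.mem_range.2 hp) (by simp)

end CriticalParameter

section ParameterSpace

variable {p : ℕ}

lemma continuous_iterate_cubic_param {X : Type*} [TopologicalSpace X] {u v z : X → ℂ}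
    (hu : Continuous u) (hv : Continuous v) (hz : Continuous z) (k : ℕ) :
    Continuous fun x => (cubic (u x) (v x))^[k] (z x) := by
  induction k with
  | zero => simpa using hz
  | succ k ih =>
    simp only [iterate_succ_apply']
    generalize hF : (fun x => (cubic (u x) (v x))^[k] (z x)) = F at ih
    have h2 : (fun x => cubic (u x) (v x) ((cubic (u x) (v x))^[k] (z x))) =
        fun x => F x ^ 3 - 3 * u x ^ 2 * F x + v x := by
      subst hF; rfl
    rw [h2]
    fun_prop

lemma continuous_critOrbit (p n : ℕ) : Continuous fun w : ℂ × ℂ => critOrbit p w n := by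
  simp only [critOrbit, ← iterate_mul]
  exact (continuous_iterate_cubic_param continuous_fst continuous_snd continuous_fst.neg
    (p * n)).sub continuous_fst

/-- Near a parameter whose critical point `c` has period dividing `k`, every parameter in `Sp p`
has `c` of period dividing `k`. -/
lemma eventually_iterate_eq (hp : 1 ≤ p) {k : ℕ} (hk : 1 ≤ k) {w₁ : ℂ × ℂ}
    (h : (cubic w₁.1 w₁.2)^[k] w₁.1 = w₁.1) :
    ∀ᶠ w in 𝓝 w₁, (cubic w.1 w.2)^[p] w.1 = w.1 → (cubic w.1 w.2)^[k] w.1 = w.1 := by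
  set D : ℂ × ℂ × ℂ → ℂ := fun x =>
    ∏ j ∈ Finset.range k, (3 * (((cubic x.1 x.2.1)^[j] x.2.2) ^ 2 - x.1 ^ 2)) with hD
  have hDc : Continuous D := by
    refine continuous_finsetProd _ fun j _ => ?_
    have := continuous_iterate_cubic_param (X := ℂ × ℂ × ℂ) continuous_fst
      continuous_snd.fst continuous_snd.snd j
    fun_prop
  have hD0 : D (w₁.1, w₁.2, w₁.1) = 0 :=
    Finset.prod_eq_zero (Finset.mem_range.2 hk) (by simp)
  obtain ⟨δ, hδ, hball⟩ := Metric.eventually_nhds_iff.1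
    ((hDc.tendsto (w₁.1, w₁.2, w₁.1)).norm.eventually_le_const (u := 1 / 2) (by simp [hD0]))
  have hnear : ∀ᶠ w in 𝓝 w₁, ∀ j ∈ Finset.range (p + 2),
      (cubic w.1 w.2)^[k * j] w.1 ∈ ball w₁.1 δ := by
    rw [Filter.eventually_all_finset]
    intro j _
    have hc := continuous_iterate_cubic_param (X := ℂ × ℂ) continuous_fst continuous_snd
      continuous_fst (k * j)
    refine (hc.tendsto w₁).eventually (isOpen_ball.mem_nhds ?_)
    rw [iterate_mul, iterate_fixed h]
    exact mem_ball_self hδ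
  filter_upwards [hnear, ball_mem_nhds w₁ hδ] with w hw hwδ hper
  set f := cubic w.1 w.2
  have hlip : ∀ x ∈ ball w₁.1 δ, ∀ y ∈ ball w₁.1 δ, ‖f^[k] y - f^[k] x‖ ≤ 1 / 2 * ‖y - x‖ := by
    intro x hx y hy
    refine (convex_ball w₁.1 δ).norm_image_sub_le_of_norm_deriv_le
      (fun z _ => (hasDerivAt_iterate_cubic w.1 w.2 z k).differentiableAt) (fun z hz => ?_) hx hy
    rw [(hasDerivAt_iterate_cubic w.1 w.2 z k).deriv]
    refine hball (y := (w.1, w.2, z)) ?_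
    rw [mem_ball, Prod.dist_eq, max_lt_iff] at hwδ
    simp only [Prod.dist_eq, max_lt_iff]
    exact ⟨hwδ.1, hwδ.2, hz⟩
  have hj : ∀ j ≤ p, ‖f^[k * (j + 1)] w.1 - f^[k * j] w.1‖ ≤ (1 / 2) ^ j * ‖f^[k] w.1 - w.1‖ := by
    intro j
    induction j with
    | zero => simp
    | succ j ih =>
      intro hj
      have := hlip _ (hw j (Finset.mem_range.2 (by omega))) _
        (hw (j + 1) (Finset.mem_range.2 (by omega)))
      rw [← iterate_add_apply, ← iterate_add_apply, show k + k * (j + 1) = k * (j + 1 + 1) by ring,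
        show k + k * j = k * (j + 1) by ring] at this
      refine this.trans ?_
      rw [pow_succ]
      linarith [ih (by omega)]
  have h1 := hj p le_rfl
  have h2 : f^[k * p] w.1 = w.1 := by rw [mul_comm, iterate_mul, iterate_fixed hper]
  rw [mul_add, mul_one, add_comm, iterate_add_apply, h2] at h1
  have h3 : ((1 : ℝ) / 2) ^ p ≤ 1 / 2 := pow_le_of_le_one (by norm_num) (by norm_num) (by omega)
  rw [← sub_eq_zero, ← norm_eq_zero]
  nlinarith [norm_nonneg (f^[k] w.1 - w.1)]

lemma isClosed_Sp (hp : 1 ≤ p) : IsClosed (Sp p) := by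
  rw [isClosed_iff_frequently]
  intro w₁ hw
  have hper : (cubic w₁.1 w₁.2)^[p] w₁.1 = w₁.1 := by
    have hc := continuous_iterate_cubic_param (X := ℂ × ℂ) continuous_fst continuous_snd
      continuous_fst p
    exact (isClosed_eq hc continuous_fst).mem_of_frequently_of_tendsto
      (hw.mono fun w h => h.1) tendsto_id
  refine ⟨hper, fun k hk hkp h => ?_⟩
  obtain ⟨w, h1, h2⟩ := (hw.and_eventually (eventually_iterate_eq hp hk h)).exists
  exact h1.2 k hk hkp (h2 h1.1)

lemma attracted_of_tendsto (hp : 1 ≤ p) {c a z : ℂ} (hper : (cubic c a)^[p] c = c)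
    (h : Tendsto (fun n => ((cubic c a)^[p])^[n] z) atTop (𝓝 c)) :
    AttractedToAttractingCycle (cubic c a) z := by
  refine ⟨p, hp, c, hper, ?_, by simpa only [iterate_mul] using h⟩
  rw [(hasDerivAt_iterate_cubic c a c p).deriv,
    Finset.prod_eq_zero (Finset.mem_range.2 hp) (by simp)]
  simp

lemma mem_hypLocus_of_tendsto (hp : 1 ≤ p) {w : ℂ × ℂ} (hw : w ∈ Sp p)
    (h : Tendsto (critOrbit p w) atTop (𝓝 0)) : w ∈ hypLocus p := by
  refine ⟨hw, attracted_of_tendsto hp hw.1 ?_, attracted_of_tendsto hp hw.1 ?_⟩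
  · exact tendsto_const_nhds.congr fun n => (iterate_fixed hw.1 n).symm
  · simpa [critOrbit] using h.add_const w.1

lemma tendsto_critOrbit (hp : 1 ≤ p) {w : ℂ × ℂ} (hw : w ∈ Sp p)
    (hU : -w.1 ∈ fatouComponent (cubic w.1 w.2) w.1) : Tendsto (critOrbit p w) atTop (𝓝 0) := by
  have h : Tendsto _ _ _ := fatouComponent_subset_basin hp hw.1 hU
  have h1 := h.sub_const w.1
  rwa [sub_self] at h1

lemma IsCritParam.norm_eq_and {w : ℂ × ℂ} {t t' : ℂ} (h : IsCritParam p w t)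
    (h' : IsCritParam p w t') (ht : t ≠ 0) : ∃ N, (t' / t) ^ 2 ^ N = 1 := by
  rcases h with ⟨-, h0⟩ | ⟨hc, h⟩
  · exact absurd h0 ht
  rcases h' with ⟨h0, -⟩ | ⟨-, h'⟩
  · exact absurd h0 hc
  have h1 := h'.div h one_ne_zero
  rw [div_one] at h1
  have h2 : Tendsto (fun n => (t' / t) ^ 2 ^ (n + 1)) atTop (𝓝 1) := by
    refine h1.congr' ?_
    filter_upwards [h.eventually_ne one_ne_zero] with n hn
    have : retFactor p w.1 w.2 0 * critOrbit p w n ≠ 0 := fun h0 => hn (by rw [h0, div_zero])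
    simp only [Pi.div_apply]
    rw [div_div_div_cancel_right₀ this, div_pow]
  obtain ⟨N, hN⟩ := eventually_eq_one_of_sq (fun n => by rw [pow_succ 2 (n + 1), pow_mul]) h2
  exact ⟨N + 1, hN N le_rfl⟩

lemma IsCritParam.ne_zero {w : ℂ × ℂ} {t : ℂ} (h : IsCritParam p w t) (hc : w.1 ≠ 0) : t ≠ 0 := by
  rintro rfl
  rcases h with ⟨h0, -⟩ | ⟨-, h⟩
  · exact hc h0
  · simp only [ne_eq, pow_eq_zero_iff', OfNat.ofNat_ne_zero, Nat.add_eq_zero_iff, one_ne_zero,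
      and_false, not_false_eq_true, false_and, zero_pow, zero_div] at h
    exact one_ne_zero (tendsto_nhds_unique h tendsto_const_nhds)

lemma IsCritParam.eq_zero {w : ℂ × ℂ} {t : ℂ} (h : IsCritParam p w t) (hc : w.1 = 0) : t = 0 :=
  h.elim (fun h => h.2) fun h => absurd hc h.1

lemma IsCritParam.norm_eq {w : ℂ × ℂ} {t t' : ℂ} (h : IsCritParam p w t)
    (h' : IsCritParam p w t') : ‖t'‖ = ‖t‖ := by
  by_cases hc : w.1 = 0
  · rw [h.eq_zero hc, h'.eq_zero hc]
  · obtain ⟨N, hN⟩ := h.norm_eq_and h' (h.ne_zero hc)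
    have := congrArg norm hN
    rw [norm_pow, norm_one, pow_eq_one_iff_of_nonneg (norm_nonneg _) (by positivity), norm_div,
      div_eq_one_iff_eq (norm_ne_zero_iff.2 (h.ne_zero hc))] at this
    exact this

variable {H : Set (ℂ × ℂ)}

lemma exists_isCritParam_of_mem (hp : 1 ≤ p) {w : ℂ × ℂ} (hw : w ∈ Sp p)
    (hU : -w.1 ∈ fatouComponent (cubic w.1 w.2) w.1) : ∃ t, ‖t‖ < 1 ∧ IsCritParam p w t := by
  by_cases hc : w.1 = 0
  · exact ⟨0, by simp, Or.inl ⟨hc, rfl⟩⟩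
  · obtain ⟨t, -, ht, h, -⟩ := exists_isCritParam (c := w.1) (a := w.2) hp hw hc hU le_rfl
    exact ⟨t, ht, h⟩

lemma norm_critOrbit_le (hp : 1 ≤ p) {w : ℂ × ℂ} (hw : w ∈ Sp p)
    (hU : -w.1 ∈ fatouComponent (cubic w.1 w.2) w.1) {R : ℝ} (hR : 2 + 3 * ‖w.1‖ ^ 2 + ‖w.2‖ ≤ R)
    {t : ℂ} (ht : IsCritParam p w t) {n : ℕ} (hn : 1 ≤ n) :
    ‖critOrbit p w n‖ ≤ 2 * R * ‖t‖ ^ (2 * (2 ^ n - 1)) := by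
  by_cases hc : w.1 = 0
  · have : critOrbit p w n = 0 := by
      rw [critOrbit, show -w.1 = w.1 by simp [hc], iterate_fixed hw.1, sub_self]
    rw [this, norm_zero]
    have : 0 ≤ R := le_trans (by positivity) hR
    positivity
  · obtain ⟨t', -, -, h, hb⟩ := exists_isCritParam (c := w.1) (a := w.2) hp hw hc hU hR
    rw [← ht.norm_eq h]
    exact hb n hn

theorem IsHyperbolicComponent.subset (hH : IsHyperbolicComponent p H) : H ⊆ hypLocus p := by
  obtain ⟨w, -, rfl⟩ := hH
  exact connectedComponentIn_subset _ _

theorem IsHyperbolicComponent.subset_of_isPreconnected (hH : IsHyperbolicComponent p H)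
    {S : Set (ℂ × ℂ)} (hS : IsPreconnected S) (hSL : S ⊆ hypLocus p) {w : ℂ × ℂ} (hwS : w ∈ S)
    (hwH : w ∈ H) : S ⊆ H := by
  obtain ⟨w₀, hw₀, rfl⟩ := hH
  rw [connectedComponentIn_eq hwH]
  exact hS.subset_connectedComponentIn hwS hSL

theorem IsHyperbolicComponent.isPreconnected (hH : IsHyperbolicComponent p H) :
    IsPreconnected H := by
  obtain ⟨w, -, rfl⟩ := hH
  exact isPreconnected_connectedComponentIn

theorem IsHyperbolicComponent.nonempty (hH : IsHyperbolicComponent p H) : H.Nonempty := by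
  obtain ⟨w, hw, rfl⟩ := hH
  exact ⟨w, mem_connectedComponentIn hw⟩

theorem mem_of_mem_closure (hp : 1 ≤ p) (hH : IsHyperbolicComponent p H)
    (hb : Bornology.IsBounded H)
    (htypeA : ∀ w ∈ H, -w.1 ∈ fatouComponent (cubic w.1 w.2) w.1) {ρ : ℝ} (hρ : ρ < 1)
    {w₁ : ℂ × ℂ} (hw₁ : w₁ ∈ closure {w ∈ H | ∃ t, IsCritParam p w t ∧ ‖t‖ ≤ ρ}) : w₁ ∈ H := by
  have hfr := mem_closure_iff_frequently.1 hw₁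
  have hρ0 : 0 ≤ ρ := by
    obtain ⟨w, -, t, -, ht⟩ := hfr.exists
    exact (norm_nonneg t).trans ht
  have hSp : w₁ ∈ Sp p := (isClosed_Sp hp).closure_subset_iff.2
    (fun w hw => (hH.subset hw.1).1) hw₁
  obtain ⟨M, hM⟩ := isBounded_iff_forall_norm_le.1 hb
  have hle : ∀ n, 1 ≤ n → ‖critOrbit p w₁ n‖ ≤
      2 * (2 + 3 * M ^ 2 + M) * ρ ^ (2 * (2 ^ n - 1)) := by
    intro n hn
    refine (isClosed_le (continuous_critOrbit p n).norm
      continuous_const).mem_of_frequently_of_tendsto (hfr.mono ?_) tendsto_id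
    rintro w ⟨hw, t, ht, htρ⟩
    have h1 : ‖w.1‖ ≤ M := (norm_fst_le w).trans (hM w hw)
    have h2 : ‖w.2‖ ≤ M := (norm_snd_le w).trans (hM w hw)
    have hM0 : 0 ≤ M := (norm_nonneg _).trans h1
    refine (norm_critOrbit_le hp (hH.subset hw).1 (htypeA w hw) (R := 2 + 3 * M ^ 2 + M)
      (by gcongr) ht hn).trans ?_
    show _ * _ ≤ _
    gcongr
  have hlim : Tendsto (fun n : ℕ => 2 * (2 + 3 * M ^ 2 + M) * ρ ^ (2 * (2 ^ n - 1))) atTop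
      (𝓝 0) := by
    have h1 : Tendsto (fun n : ℕ => 2 * (2 ^ n - 1)) atTop atTop := by
      refine tendsto_atTop_mono (fun n => ?_) tendsto_id
      have : n < 2 ^ n := Nat.lt_two_pow_self
      simp only [id]; omega
    simpa using ((tendsto_pow_atTop_nhds_zero_of_lt_one hρ0 hρ).comp h1).const_mul
      (2 * (2 + 3 * M ^ 2 + M))
  have horb : Tendsto (critOrbit p w₁) atTop (𝓝 0) := by
    rw [tendsto_zero_iff_norm_tendsto_zero]
    refine squeeze_zero' (.of_forall fun _ => norm_nonneg _) ?_ hlim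
    filter_upwards [eventually_ge_atTop 1] with n hn using hle n hn
  have hcl : w₁ ∈ closure H := closure_mono (fun w hw => hw.1) hw₁
  obtain ⟨w₂, hw₂⟩ := hH.nonempty
  refine hH.subset_of_isPreconnected (S := insert w₁ H) ?_ ?_ (mem_insert_of_mem _ hw₂) hw₂
    (mem_insert _ _)
  · exact hH.isPreconnected.subset_closure (subset_insert _ _)
      (insert_subset hcl subset_closure)
  · exact insert_subset (mem_hypLocus_of_tendsto hp hSp horb) hH.subset

theorem isCompact_closure_param (hb : Bornology.IsBounded H) (P : ℂ × ℂ → Prop) :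
    IsCompact (closure {w ∈ H | P w}) :=
  (hb.subset fun _ h => h.1).isCompact_closure

end ParameterSpace

section Variation

/-- The first variation along the orbit of `z` when `(c, a)` moves with velocity `(c', a')` and
`z` moves with velocity `z'`. -/
noncomputable def varOrbit (c a c' a' z z' : ℂ) : ℕ → ℂ
  | 0 => z'
  | n + 1 => 3 * (((cubic c a)^[n] z) ^ 2 - c ^ 2) * varOrbit c a c' a' z z' n +
      (-6 * c * c' * (cubic c a)^[n] z + a')

variable {c a c' a' : ℂ}

lemma varOrbit_one (z z' : ℂ) : varOrbit c a c' a' z z' 1 =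
    3 * (z ^ 2 - c ^ 2) * z' + (-6 * c * c' * z + a') := rfl

lemma varOrbit_add (z z' : ℂ) (m n : ℕ) : varOrbit c a c' a' z z' (m + n) =
    varOrbit c a c' a' ((cubic c a)^[m] z) (varOrbit c a c' a' z z' m) n := by
  induction n with
  | zero => rfl
  | succ n ih =>
    rw [← add_assoc, varOrbit, ih, varOrbit, ← iterate_add_apply, add_comm n m]

lemma deriv_iterate_cubic_succ (z : ℂ) (n : ℕ) : deriv (cubic c a)^[n + 1] z =
    3 * (((cubic c a)^[n] z) ^ 2 - c ^ 2) * deriv (cubic c a)^[n] z := by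
  rw [(hasDerivAt_iterate_cubic c a z _).deriv, (hasDerivAt_iterate_cubic c a z _).deriv,
    Finset.prod_range_succ, mul_comm]

lemma varOrbit_add_right (z z' u : ℂ) (n : ℕ) : varOrbit c a c' a' z (z' + u) n =
    varOrbit c a c' a' z z' n + deriv (cubic c a)^[n] z * u := by
  induction n with
  | zero => simp [varOrbit]
  | succ n ih => rw [varOrbit, ih, varOrbit, deriv_iterate_cubic_succ]; ring

lemma varOrbit_eq (z z' : ℂ) (n : ℕ) : varOrbit c a c' a' z z' n =
    varOrbit c a c' a' z 0 n + deriv (cubic c a)^[n] z * z' := by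
  simpa using varOrbit_add_right z 0 z' n

lemma varOrbit_injective {z : ℂ} {n : ℕ} (h : deriv (cubic c a)^[n] z ≠ 0) {u v : ℂ}
    (huv : varOrbit c a c' a' z u n = varOrbit c a c' a' z v n) : u = v := by
  rw [varOrbit_eq z u, varOrbit_eq z v] at huv
  exact mul_left_cancel₀ h (add_left_cancel huv)

lemma varOrbit_linear (α β c₁ a₁ z₁ c₂ a₂ z₂ z : ℂ) (n : ℕ) :
    varOrbit c a (α * c₁ + β * c₂) (α * a₁ + β * a₂) z (α * z₁ + β * z₂) n =
      α * varOrbit c a c₁ a₁ z z₁ n + β * varOrbit c a c₂ a₂ z z₂ n := by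
  induction n with
  | zero => rfl
  | succ n ih => rw [varOrbit, ih, varOrbit, varOrbit]; ring

lemma differentiable_varOrbit (z' : ℂ) (n : ℕ) :
    Differentiable ℂ fun z => varOrbit c a c' a' z z' n := by
  induction n with
  | zero => exact differentiable_const z'
  | succ n ih =>
    have : Differentiable ℂ fun z => (cubic c a)^[n] z := (differentiable_cubic c a).iterate n
    simp only [varOrbit]
    fun_prop

lemma hasDerivAt_varOrbit {C A Z : ℂ → ℂ} {C' A' Z' u : ℂ} (hC : HasDerivAt C C' u)
    (hA : HasDerivAt A A' u) (hZ : HasDerivAt Z Z' u) (n : ℕ) :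
    HasDerivAt (fun v => (cubic (C v) (A v))^[n] (Z v))
      (varOrbit (C u) (A u) C' A' (Z u) Z' n) u := by
  induction n with
  | zero => exact hZ
  | succ n ih =>
    simp only [iterate_succ_apply']
    have h := ((ih.pow 3).sub ((hC.pow 2).const_mul 3 |>.mul ih)).add hA
    refine (h.congr_deriv ?_).congr_of_eventuallyEq (Eventually.of_forall fun v => ?_)
    · rw [varOrbit]; push_cast; simp; ring
    · simp [cubic]

end Variation

section CriticalVariation

variable {p : ℕ} {c a : ℂ}

/-- Fixed points of the affine functional equation `κ = m · κ ∘ G + q` near an attracting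
fixed point. -/
lemma exists_solution_of_contraction {m q G : ℂ → ℂ} {ε C : ℝ}
    (hm : DifferentiableOn ℂ m (ball 0 ε)) (hq : DifferentiableOn ℂ q (ball 0 ε))
    (hG : DifferentiableOn ℂ G (ball 0 ε)) (hGm : MapsTo G (ball 0 ε) (ball 0 ε))
    (hmb : ∀ s ∈ ball (0 : ℂ) ε, ‖m s‖ ≤ 3 / 4) (hqb : ∀ s ∈ ball (0 : ℂ) ε, ‖q s‖ ≤ C) :
    ∃ κ : ℂ → ℂ, DifferentiableOn ℂ κ (ball 0 ε) ∧
      ∀ s ∈ ball (0 : ℂ) ε, κ s = m s * κ (G s) + q s := by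
  have hGi : ∀ n, MapsTo G^[n] (ball 0 ε) (ball 0 ε) := fun n => hGm.iterate n
  have hGd : ∀ n, DifferentiableOn ℂ G^[n] (ball 0 ε) := fun n => by
    induction n with
    | zero => exact differentiableOn_id
    | succ n ih => rw [iterate_succ']; exact hG.comp ih (hGi n)
  set T : ℕ → ℂ → ℂ := fun n s => (∏ j ∈ Finset.range n, m (G^[j] s)) * q (G^[n] s) with hT
  have hTd : ∀ n, DifferentiableOn ℂ (T n) (ball 0 ε) := fun n =>
    (DifferentiableOn.fun_finsetProd fun j _ => hm.comp (hGd j) (hGi j)).mul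
      (hq.comp (hGd n) (hGi n))
  have hTb : ∀ n, ∀ s ∈ ball (0 : ℂ) ε, ‖T n s‖ ≤ C * (3 / 4) ^ n := by
    intro n s hs
    have h1 : ‖∏ j ∈ Finset.range n, m (G^[j] s)‖ ≤ (3 / 4) ^ n := by
      rw [norm_prod]
      refine (Finset.prod_le_prod (fun _ _ => norm_nonneg _) fun j _ => hmb _ (hGi j hs)).trans ?_
      rw [Finset.prod_const, Finset.card_range]
    rw [hT, norm_mul, mul_comm]
    exact mul_le_mul (hqb _ (hGi n hs)) h1 (norm_nonneg _)
      ((norm_nonneg _).trans (hqb _ (hGi n hs)))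
  have hsum : Summable fun n : ℕ => C * (3 / 4 : ℝ) ^ n :=
    (summable_geometric_of_lt_one (by norm_num) (by norm_num)).mul_left C
  refine ⟨fun s => ∑' n, T n s, Complex.differentiableOn_tsum_of_summable_norm hsum hTd
    isOpen_ball hTb,
    fun s hs => ?_⟩
  have hs1 : Summable fun n => T n s := .of_norm_bounded hsum fun n => hTb n s hs
  change ∑' n, T n s = m s * ∑' n, T n (G s) + q s
  rw [hs1.tsum_eq_zero_add, ← tsum_mul_left, add_comm]
  congr 1
  · refine tsum_congr fun n => ?_
    simp only [hT, Finset.prod_range_succ', iterate_succ_apply, iterate_zero, id]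
    ring
  · simp [hT]

/-- A local infinitesimal conjugacy `c + s ↦ c' + s * κ s` at the periodic critical point. -/
structure IsBaseVar (p : ℕ) (c a c' a' : ℂ) (ε : ℝ) (κ : ℂ → ℂ) : Prop where
  diff : DifferentiableOn ℂ κ (ball 0 ε)
  eq : ∀ s ∈ ball (0 : ℂ) ε, varOrbit c a c' a' (c + s) (c' + s * κ s) p =
    c' + ((cubic c a)^[p] (c + s) - c) * κ ((cubic c a)^[p] (c + s) - c)

lemma IsBaseVar.linear {c₁ a₁ c₂ a₂ : ℂ} {ε : ℝ} {κ₁ κ₂ : ℂ → ℂ}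
    (h₁ : IsBaseVar p c a c₁ a₁ ε κ₁) (h₂ : IsBaseVar p c a c₂ a₂ ε κ₂) (α β : ℂ) :
    IsBaseVar p c a (α * c₁ + β * c₂) (α * a₁ + β * a₂) ε fun s => α * κ₁ s + β * κ₂ s := by
  refine ⟨(h₁.diff.const_mul α).add (h₂.diff.const_mul β), fun s hs => ?_⟩
  have := varOrbit_linear (c := c) (a := a) α β c₁ a₁ (c₁ + s * κ₁ s) c₂ a₂ (c₂ + s * κ₂ s)
    (c + s) p
  rw [h₁.eq s hs, h₂.eq s hs] at this
  rw [show α * c₁ + β * c₂ + s * (α * κ₁ s + β * κ₂ s) =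
    α * (c₁ + s * κ₁ s) + β * (c₂ + s * κ₂ s) by ring, this]
  ring

lemma hasDerivAt_retFactor (c a s : ℂ) :
    HasDerivAt (fun s => retFactor p c a s) (deriv (fun s => retFactor p c a s) s) s :=
  (((contDiff_retFactor (n := 1) p).differentiable one_ne_zero).comp
    (show Differentiable ℂ fun s : ℂ => ((c, a, s) : ℂ × ℂ × ℂ) by fun_prop) s).hasDerivAt

lemma deriv_iterate_add (hp : 1 ≤ p) (c a s : ℂ) : deriv (cubic c a)^[p] (c + s) =
    s * (2 * retFactor p c a s + s * deriv (fun s => retFactor p c a s) s) := by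
  have h1 : HasDerivAt (fun s => (cubic c a)^[p] (c + s)) (deriv (cubic c a)^[p] (c + s)) s := by
    have h := ((((differentiable_cubic c a).iterate p) (c + s)).hasDerivAt).comp s
      ((hasDerivAt_id s).const_add c)
    rw [mul_one] at h
    exact h
  have h2 : HasDerivAt (fun s => (cubic c a)^[p] (c + s))
      (s * (2 * retFactor p c a s + s * deriv (fun s => retFactor p c a s) s)) s := by
    simp only [iterate_cubic_add_eq hp c a]
    refine ((((hasDerivAt_id s).pow 2).mul (hasDerivAt_retFactor c a s)).const_add _).congr_deriv ?_
    simp; ring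
  exact h1.unique h2

/-- The quadratic vanishing of the first variation of the return map. -/
lemma exists_variation_factor (hp : 1 ≤ p) {c' a' : ℂ}
    (h : varOrbit c a c' a' c c' p = c') :
    ∃ q : ℂ → ℂ, Differentiable ℂ q ∧
      ∀ s, varOrbit c a c' a' (c + s) c' p = c' + s ^ 2 * q s := by
  set R : ℂ × ℂ × ℂ → ℂ := fun x => retFactor p x.1 x.2.1 x.2.2 with hR
  have hRd : Differentiable ℂ R := (contDiff_retFactor (n := 1) p).differentiable one_ne_zero
  have hRd' : Differentiable ℂ (fderiv ℂ R) :=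
    ((contDiff_retFactor (n := 2) p).fderiv_right (m := 1) (by norm_num)).differentiable one_ne_zero
  refine ⟨fun s => fderiv ℂ R (c, a, s) (c', a', 0), ?_, fun s => ?_⟩
  · exact (hRd'.comp (show Differentiable ℂ fun s : ℂ => ((c, a, s) : ℂ × ℂ × ℂ) by
      fun_prop)).clm_apply (differentiable_const _)
  · have hC : HasDerivAt (fun u : ℂ => c + u * c') c' 0 := by
      simpa using ((hasDerivAt_id (0 : ℂ)).mul_const c').const_add c
    have hA : HasDerivAt (fun u : ℂ => a + u * a') a' 0 := by
      simpa using ((hasDerivAt_id (0 : ℂ)).mul_const a').const_add a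
    have h1 := hasDerivAt_varOrbit hC hA (hC.add_const s) p
    have h2 := hasDerivAt_varOrbit hC hA hC p
    simp only [zero_mul, add_zero] at h1 h2
    rw [h] at h2
    have h3 : HasDerivAt (fun u : ℂ => R (c + u * c', a + u * a', s))
        (fderiv ℂ R (c, a, s) (c', a', 0)) 0 := by
      have := HasFDerivAt.comp_hasDerivAt (f := fun u : ℂ => (c + u * c', a + u * a', s))
        (0 : ℂ) (hRd _).hasFDerivAt (hC.prodMk (hA.prodMk (hasDerivAt_const (0 : ℂ) s)))
      simp only [zero_mul, add_zero] at this
      exact this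
    refine h1.unique ((h2.add (h3.const_mul (s ^ 2))).congr_of_eventuallyEq
      (Eventually.of_forall fun u => ?_))
    simp [iterate_cubic_add_eq hp, hR]

theorem exists_isBaseVar (hp : 1 ≤ p) (hper : (cubic c a)^[p] c = c)
    (hla : retFactor p c a 0 ≠ 0) : ∃ ε > 0,
      (∀ s : ℂ, ‖s‖ < ε → ‖(cubic c a)^[p] (c + s) - c‖ ≤ ‖s‖ / 2) ∧
      (∀ s : ℂ, ‖s‖ < ε → 4 / 3 * ‖(cubic c a)^[p] (c + s) - c‖ ≤
        ‖deriv (cubic c a)^[p] (c + s)‖ * ‖s‖) ∧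
      ∀ c' a', varOrbit c a c' a' c c' p = c' → ∃ κ, IsBaseVar p c a c' a' ε κ := by
  set Q : ℂ → ℂ := fun s => retFactor p c a s with hQ
  have hQ1 : ContDiff ℂ 2 Q := (contDiff_retFactor p).comp
    (show ContDiff ℂ 2 fun s : ℂ => ((c, a, s) : ℂ × ℂ × ℂ) by fun_prop)
  have hQd : Differentiable ℂ Q := hQ1.differentiable two_ne_zero
  have hQd' : Differentiable ℂ (deriv Q) :=
    ((contDiff_succ_iff_deriv (n := 1)).1 hQ1).2.2.differentiable one_ne_zero
  set h : ℂ → ℂ := fun s => 2 * Q s + s * deriv Q s with hh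
  have hhd : Differentiable ℂ h := by fun_prop
  have hh0 : h 0 = 2 * Q 0 := by simp [hh]
  have hG : ∀ s, (cubic c a)^[p] (c + s) - c = s ^ 2 * Q s := fun s => by
    rw [iterate_cubic_add_eq hp, hper]; ring
  have hQp : 0 < ‖Q 0‖ := norm_pos_iff.2 hla
  obtain ⟨ε₁, hε₁, htrap⟩ := exists_trap hp hper
  have e1 : ∀ᶠ s in 𝓝 (0 : ℂ), ‖Q 0‖ < ‖h s‖ :=
    (hhd.continuous.tendsto 0).norm.eventually_const_lt (by rw [hh0, norm_mul]; simp; linarith)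
  have e2 : ∀ᶠ s in 𝓝 (0 : ℂ), ‖Q s‖ < 3 / 4 * ‖h s‖ :=
    (hQd.continuous.tendsto 0).norm.eventually_lt
      ((hhd.continuous.tendsto 0).norm.const_mul (3 / 4))
      (by rw [hh0, norm_mul]; simp; linarith)
  obtain ⟨ε₂, hε₂, he⟩ := Metric.eventually_nhds_iff.1 (e1.and e2)
  have htr : ∀ s : ℂ, ‖s‖ < min ε₁ ε₂ → ‖(cubic c a)^[p] (c + s) - c‖ ≤ ‖s‖ / 2 :=
    fun s hs => htrap s (hs.trans_le (min_le_left _ _))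
  have he' : ∀ s ∈ ball (0 : ℂ) (min ε₁ ε₂), ‖Q 0‖ < ‖h s‖ ∧ ‖Q s‖ < 3 / 4 * ‖h s‖ := fun s hs =>
    he ((mem_ball.1 hs).trans_le (min_le_right _ _))
  refine ⟨min ε₁ ε₂, lt_min hε₁ hε₂, htr, fun s hs => ?_, fun c' a' hv => ?_⟩
  · have h1 := (he' s (by simpa using hs)).2
    rw [hG, deriv_iterate_add hp, norm_mul, norm_mul, norm_pow]
    change _ ≤ ‖s‖ * ‖h s‖ * ‖s‖
    nlinarith [mul_nonneg (norm_nonneg s) (norm_nonneg s)]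
  · obtain ⟨q, hqd, hq⟩ := exists_variation_factor hp hv
    have hne : ∀ s ∈ ball (0 : ℂ) (min ε₁ ε₂), h s ≠ 0 := fun s hs =>
      norm_pos_iff.1 (hQp.trans (he' s hs).1)
    obtain ⟨C, hC⟩ := (isCompact_closedBall (0 : ℂ) (min ε₁ ε₂)).exists_bound_of_continuousOn
      hqd.continuous.continuousOn
    obtain ⟨κ, hκd, hκ⟩ := exists_solution_of_contraction (m := fun s => Q s / h s)
      (q := fun s => -q s / h s) (G := fun s => s ^ 2 * Q s) (ε := min ε₁ ε₂) (C := C / ‖Q 0‖)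
      (hQd.differentiableOn.div hhd.differentiableOn hne)
      (hqd.neg.differentiableOn.div hhd.differentiableOn hne)
      (by fun_prop)
      (fun s hs => by
        have h1 := htr s (by simpa using hs)
        rw [hG] at h1
        rw [mem_ball_zero_iff] at hs ⊢
        linarith [norm_nonneg s])
      (fun s hs => by
        rw [norm_div, div_le_iff₀ (hQp.trans (he' s hs).1)]; exact (he' s hs).2.le)
      (fun s hs => by
        rw [norm_div, norm_neg]
        exact div_le_div₀ ((norm_nonneg _).trans (hC s (ball_subset_closedBall hs)))
          (hC s (ball_subset_closedBall hs)) hQp (he' s hs).1.le)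
    refine ⟨κ, hκd, fun s hs => ?_⟩
    rw [varOrbit_add_right, hq, deriv_iterate_add hp, hG]
    change c' + s ^ 2 * q s + s * h s * (s * κ s) = _
    rw [hκ s hs]
    have := hne s hs
    field_simp
    ring

end CriticalVariation

section DiscSystem

variable {c a c' a' : ℂ}

/-- A finite system of discs mapped into itself by the cubic, carrying an infinitesimal conjugacy
`ξ` which agrees with `ξ₀` near `c`; it contains the tail of the orbit `y` from time `n` on. -/
def HasDiscSystem (c a c' a' : ℂ) (ξ₀ : ℂ → ℂ) (y : ℕ → ℂ) (n : ℕ) : Prop :=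
  ∃ (ι : Type) (_ : Fintype ι) (P : ι → ℂ) (r r' : ι → ℝ) (ξ : ℂ → ℂ),
    (∀ i, 0 < r i) ∧ (∀ i, r i < r' i) ∧
    (Pairwise (Disjoint on fun i => closedBall (P i) (r' i))) ∧
    (∀ i, MapsTo (cubic c a) (closedBall (P i) (r' i)) (⋃ j, ball (P j) (r j))) ∧
    (∀ i, DifferentiableOn ℂ ξ (closedBall (P i) (r' i))) ∧
    (∀ i, ∀ z ∈ closedBall (P i) (r' i),
      ξ (cubic c a z) = 3 * (z ^ 2 - c ^ 2) * ξ z + (-6 * c * c' * z + a')) ∧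
    c ∈ (⋃ j, ball (P j) (r j)) ∧ y n ∈ (⋃ j, ball (P j) (r j)) ∧
    (∀ j, 1 ≤ j → j < n → ∀ i, y j ∉ closedBall (P i) (r' i)) ∧ ξ =ᶠ[𝓝 c] ξ₀

lemma HasDiscSystem.step {ξ₀ : ℂ → ℂ} {y : ℕ → ℂ} {n : ℕ} (hn : 1 ≤ n)
    (h : HasDiscSystem c a c' a' ξ₀ y (n + 1)) (hy : y (n + 1) = cubic c a (y n))
    (hne : y n ^ 2 ≠ c ^ 2) (hinj : ∀ j, j < n → y j ≠ y n) :
    HasDiscSystem c a c' a' ξ₀ y n := by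
  classical
  obtain ⟨ι, _, P, r, r', ξ, hr, hr', hdisj, hmap, hξd, hξ, hcm, hym, hyn, hξ₀⟩ := h
  have hsub : (⋃ j, ball (P j) (r j)) ⊆ ⋃ j, closedBall (P j) (r' j) :=
    iUnion_mono fun j => (ball_subset_ball (hr' j).le).trans ball_subset_closedBall
  have e1 : ∀ᶠ z in 𝓝 (y n), z ∉ ⋃ j, closedBall (P j) (r' j) :=
    (isClosed_iUnion_of_finite fun _ => isClosed_closedBall).isOpen_compl.mem_nhds
      (by simpa using hyn n hn (Nat.lt_succ_self n))
  have e2 : ∀ᶠ z in 𝓝 (y n), cubic c a z ∈ ⋃ j, ball (P j) (r j) :=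
    (continuous_cubic c a).continuousAt.eventually
      ((isOpen_iUnion fun _ => isOpen_ball).mem_nhds (by rwa [← hy]))
  have e3 : ∀ᶠ z in 𝓝 (y n), ∀ j ∈ Finset.range n, z ≠ y j := by
    rw [Filter.eventually_all_finset]
    exact fun j hj => isOpen_ne.mem_nhds (hinj j (Finset.mem_range.1 hj)).symm
  have e4 : ∀ᶠ z in 𝓝 (y n), z ^ 2 - c ^ 2 ≠ 0 :=
    ((continuous_pow 2).sub continuous_const).continuousAt.eventually_ne (sub_ne_zero.2 hne)
  obtain ⟨s, hs, hball⟩ := Metric.nhds_basis_closedBall.eventually_iff.1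
    (e1.and (e2.and (e3.and e4)))
  set D := closedBall (y n) s with hD
  set ξ' : ℂ → ℂ := fun z => if z ∈ D then
    (ξ (cubic c a z) - (-6 * c * c' * z + a')) / (3 * (z ^ 2 - c ^ 2)) else ξ z with hξ'
  have hξ'o : ∀ i, EqOn ξ' ξ (closedBall (P i) (r' i)) := fun i z hz =>
    if_neg fun hzD => (hball hzD).1 (mem_iUnion.2 ⟨i, hz⟩)
  have hξ'u : ∀ z ∈ ⋃ j, ball (P j) (r j), ξ' z = ξ z := fun z hz => by
    obtain ⟨i, hi⟩ := mem_iUnion.1 (hsub hz)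
    exact hξ'o i hi
  have hξ'D : EqOn ξ' (fun z => (ξ (cubic c a z) - (-6 * c * c' * z + a')) /
      (3 * (z ^ 2 - c ^ 2))) D := fun z hz => if_pos hz
  have hU : (⋃ j : Option ι, ball (j.elim (y n) P) (j.elim (s / 2) r)) =
      ball (y n) (s / 2) ∪ ⋃ j, ball (P j) (r j) := by
    ext z; simp [Option.exists]
  refine ⟨Option ι, inferInstance, fun o => o.elim (y n) P, fun o => o.elim (s / 2) r,
    fun o => o.elim s r', ξ', ?_, ?_, ?_, ?_, ?_, ?_, ?_, ?_, ?_, ?_⟩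
  · rintro (_ | i)
    exacts [half_pos hs, hr i]
  · rintro (_ | i)
    exacts [half_lt_self hs, hr' i]
  · have hD' : ∀ i, Disjoint D (closedBall (P i) (r' i)) := fun i =>
      disjoint_left.2 fun z hz hzi => (hball hz).1 (mem_iUnion.2 ⟨i, hzi⟩)
    rintro (_ | i) (_ | j) hij
    · exact absurd rfl hij
    · exact hD' j
    · exact (hD' i).symm
    · exact hdisj fun h => hij (congrArg some h)
  · rintro (_ | i) z hz
    · rw [hU]; exact Or.inr (hball hz).2.1
    · rw [hU]; exact Or.inr (hmap i hz)
  · rintro (_ | i)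
    · refine DifferentiableOn.congr ?_ hξ'D
      have hmapD : MapsTo (cubic c a) D (⋃ j, ball (P j) (r j)) := fun z hz => (hball hz).2.1
      have hξU : DifferentiableOn ℂ ξ (⋃ j, ball (P j) (r j)) := fun z hz => by
        obtain ⟨i, hi⟩ := mem_iUnion.1 hz
        exact ((hξd i).differentiableAt (closedBall_mem_nhds_of_mem
          (ball_subset_ball (hr' i).le hi))).differentiableWithinAt
      refine ((hξU.comp (differentiable_cubic c a).differentiableOn hmapD).sub
        (by fun_prop)).div (by fun_prop) fun z hz => mul_ne_zero three_ne_zero (hball hz).2.2.2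
    · exact (hξd i).congr (hξ'o i)
  · rintro (_ | i) z hz
    · rw [hξ'u _ (hball hz).2.1, hξ'D hz]
      have := (hball hz).2.2.2
      field_simp
      ring
    · rw [hξ'u _ (hmap i hz), hξ'o i hz, hξ i z hz]
  · rw [hU]; exact Or.inr hcm
  · rw [hU]; exact Or.inl (mem_ball_self (half_pos hs))
  · rintro j hj hjn (_ | i) hji
    · exact (hball hji).2.2.1 j (Finset.mem_range.2 hjn) rfl
    · exact hyn j hj (hjn.trans (Nat.lt_succ_self n)) i hji
  · refine EventuallyEq.trans ?_ hξ₀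
    filter_upwards [(isOpen_iUnion fun _ => isOpen_ball).mem_nhds hcm] with z hz
    exact hξ'u z hz

lemma HasDiscSystem.one {ξ₀ : ℂ → ℂ} {y : ℕ → ℂ} {n : ℕ} (hn : 1 ≤ n)
    (h : HasDiscSystem c a c' a' ξ₀ y n) (hy : ∀ n, y (n + 1) = cubic c a (y n))
    (hne : ∀ n, 1 ≤ n → y n ^ 2 ≠ c ^ 2) (hinj : Injective y) :
    HasDiscSystem c a c' a' ξ₀ y 1 := by
  induction n, hn using Nat.le_induction with
  | base => exact h
  | succ n hn ih => exact ih (h.step hn (hy n) (hne n hn) fun j hj e => hj.ne (hinj e))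

/-- The infinitesimal conjugacy carried by a disc system vanishes as soon as it follows the
variation of the free critical orbit. -/
theorem HasDiscSystem.eq_zero (hc : c ≠ 0) {ξ₀ : ℂ → ℂ} {p : ℕ} (hp : 1 ≤ p)
    (h : HasDiscSystem c a c' a' ξ₀ (fun n => (cubic c a)^[n] (-c)) 1)
    (hne : ∀ n, 1 ≤ n → ((cubic c a)^[n] (-c)) ^ 2 ≠ c ^ 2)
    (hper : ∀ n, (cubic c a)^[n] c ≠ -c) (hξ₀ : ξ₀ c = c')
    (ht : Tendsto (fun m => (cubic c a)^[m * p] (-c)) atTop (𝓝 c))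
    (hev : ∀ᶠ m in atTop, ξ₀ ((cubic c a)^[m * p] (-c)) =
      varOrbit c a c' a' (-c) (-c') (m * p)) :
    c' = 0 ∧ a' = 0 := by
  obtain ⟨ι, _, P, r, r', ξ, hr, hr', hdisj, hmap, hξd, hξ, hcm, hym, -, hξe⟩ := h
  set f := cubic c a with hf
  set U := ⋃ j, ball (P j) (r j) with hU
  have hUmem : ∀ z ∈ U, ∃ i, z ∈ closedBall (P i) (r' i) := fun z hz => by
    obtain ⟨i, hi⟩ := mem_iUnion.1 hz
    exact ⟨i, ball_subset_closedBall (ball_subset_ball (hr' i).le hi)⟩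
  have hfU : MapsTo f U U := fun z hz => by
    obtain ⟨i, hi⟩ := hUmem z hz
    exact hmap i hi
  have hξU : ∀ z ∈ U, ξ (f z) = 3 * (z ^ 2 - c ^ 2) * ξ z + (-6 * c * c' * z + a') :=
    fun z hz => by
      obtain ⟨i, hi⟩ := hUmem z hz
      exact hξ i z hi
  have hyU : ∀ n, 1 ≤ n → f^[n] (-c) ∈ U := fun n hn => by
    induction n, hn using Nat.le_induction with
    | base => exact hym
    | succ n hn ih => rw [iterate_succ_apply']; exact hfU ih
  have hback : ∀ k n, 1 ≤ n → ξ (f^[n + k] (-c)) = varOrbit c a c' a' (-c) (-c') (n + k) →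
      ξ (f^[n] (-c)) = varOrbit c a c' a' (-c) (-c') n := by
    intro k
    induction k with
    | zero => exact fun n _ h => h
    | succ k ih =>
      intro n hn h
      refine ih n hn ?_
      rw [← add_assoc, iterate_succ_apply', hξU _ (hyU _ (by omega)), varOrbit] at h
      exact mul_left_cancel₀ (mul_ne_zero three_ne_zero (sub_ne_zero.2 (hne _ (by omega))))
        (add_right_cancel h)
  have h1 : ξ (f^[1] (-c)) = varOrbit c a c' a' (-c) (-c') 1 := by
    obtain ⟨m, hm1, hm2, hm3⟩ := ((ht.eventually hξe).and (hev.and (eventually_ge_atTop 1))).exists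
    have : m * p = 1 + (m * p - 1) := by
      have := Nat.mul_pos (show 0 < m from hm3) (show 0 < p from hp)
      omega
    refine hback (m * p - 1) 1 le_rfl ?_
    rw [← this, ← hm2]
    exact hm1
  have hξc : ξ c = c' := hξe.eq_of_nhds.trans hξ₀
  set X : Set ℂ := range (fun n => f^[n] c) ∪ range (fun n => f^[n + 1] (-c)) with hX
  have hXU : X ⊆ U := by
    rintro _ (⟨n, rfl⟩ | ⟨n, rfl⟩)
    · exact hfU.iterate n hcm
    · exact hyU _ (by omega)
  have hcX : c ∈ X := Or.inl ⟨0, rfl⟩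
  have key := infinitesimal_rigidity hc hr hr' hdisj
    (fun i z hz => iUnion_mono (fun j => ball_subset_closedBall) (hmap i hz)) hXU
    (by
      rintro _ (⟨n, rfl⟩ | ⟨n, rfl⟩)
      · exact Or.inl ⟨n + 1, iterate_succ_apply' f n c⟩
      · exact Or.inr ⟨n + 1, iterate_succ_apply' f (n + 1) (-c)⟩)
    (Or.inl ⟨1, rfl⟩) (Or.inr ⟨0, rfl⟩)
    (by
      rintro (⟨n, hn⟩ | ⟨n, hn⟩)
      · exact hper n hn
      · exact hne (n + 1) (by omega) (by
          change f^[n + 1] (-c) = -c at hn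
          rw [hn, neg_sq]))
    hξd (fun z hz => hξU z (hXU hz))
    (by rw [hξU c hcm]; ring)
    (by
      rw [iterate_one, varOrbit_one] at h1
      rw [h1]; ring)
    (fun _ => hξc)
  have hc' : c' = 0 := by rw [← hξc]; exact key c hcX
  refine ⟨hc', ?_⟩
  have h2 := key _ (show f c ∈ X from Or.inl ⟨1, rfl⟩)
  rw [hξU c hcm, hc'] at h2
  simpa using h2

lemma eventually_forall_closedBall {x : ℂ} {C : ℝ} {Q : ℂ → Prop}
    (h : ∀ᶠ z in 𝓝 x, Q z) : ∀ᶠ ρ : ℝ in 𝓝[>] 0, ∀ z ∈ closedBall x (C * ρ), Q z := by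
  obtain ⟨s, hs, hball⟩ := Metric.nhds_basis_closedBall.eventually_iff.1 h
  have : ∀ᶠ ρ : ℝ in 𝓝 0, C * ρ < s :=
    (continuous_const_mul C).continuousAt.eventually_lt_const (by simpa using hs)
  filter_upwards [this.filter_mono nhdsWithin_le_nhds] with ρ hρ z hz
  exact hball (closedBall_subset_closedBall hρ.le hz)

/-- Pull back of a vector field under the `e`-th iterate, corrected by the variation. -/
noncomputable def pullVar (c a c' a' : ℂ) (ξ₀ : ℂ → ℂ) (e : ℕ) (z : ℂ) : ℂ :=
  (ξ₀ ((cubic c a)^[e] z) - varOrbit c a c' a' z 0 e) / deriv (cubic c a)^[e] z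

lemma varOrbit_pullVar {ξ₀ : ℂ → ℂ} {e : ℕ} {z : ℂ} (h : deriv (cubic c a)^[e] z ≠ 0) :
    varOrbit c a c' a' z (pullVar c a c' a' ξ₀ e z) e = ξ₀ ((cubic c a)^[e] z) := by
  rw [varOrbit_eq, pullVar]; field_simp; ring

lemma pullVar_zero (ξ₀ : ℂ → ℂ) (z : ℂ) : pullVar c a c' a' ξ₀ 0 z = ξ₀ z := by
  simp [pullVar, varOrbit]

lemma pullVar_cubic {ξ₀ : ℂ → ℂ} {e : ℕ} {z v : ℂ} (h : deriv (cubic c a)^[e] (cubic c a z) ≠ 0)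
    (hv : varOrbit c a c' a' z v (1 + e) = ξ₀ ((cubic c a)^[1 + e] z)) :
    pullVar c a c' a' ξ₀ e (cubic c a z) =
      3 * (z ^ 2 - c ^ 2) * v + (-6 * c * c' * z + a') := by
  refine varOrbit_injective (c' := c') (a' := a') h ?_
  have h1 := varOrbit_add (c' := c') (a' := a') (c := c) (a := a) z v 1 e
  rw [hv, add_comm 1 e, iterate_succ_apply] at h1
  rw [varOrbit_pullVar h, h1]
  rfl

lemma exists_piecewise {ι : Type*} {D : ι → Set ℂ} (hD : Pairwise (Disjoint on D))
    (g : ι → ℂ → ℂ) : ∃ ξ : ℂ → ℂ, ∀ i, EqOn ξ (g i) (D i) := by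
  classical
  refine ⟨fun z => if h : ∃ i, z ∈ D i then g h.choose z else 0, fun i z hz => ?_⟩
  have h : ∃ i, z ∈ D i := ⟨i, hz⟩
  have : h.choose = i := by
    by_contra hne
    exact disjoint_left.1 (hD hne) h.choose_spec hz
  simp only [dif_pos h, this]

lemma exists_locally_lipschitz {ι : Type*} [Fintype ι] (c a : ℂ) (P : ι → ℂ) : ∃ L : ℝ, 1 ≤ L ∧
    ∀ i, ∀ᶠ z in 𝓝 (P i), ‖cubic c a z - cubic c a (P i)‖ ≤ L * ‖z - P i‖ := by
  have h : ∀ i, ∃ C : ℝ, ∀ᶠ z in 𝓝 (P i),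
      ‖cubic c a z - cubic c a (P i)‖ ≤ C * ‖z - P i‖ := fun i =>
    ((differentiable_cubic c a) (P i)).isBigO_sub.bound
  choose C hC using h
  refine ⟨1 + ∑ i, |C i|, le_add_of_nonneg_right (Finset.sum_nonneg fun i _ => abs_nonneg _),
    fun i => (hC i).mono fun z hz => hz.trans ?_⟩
  gcongr
  calc C i ≤ |C i| := le_abs_self _
    _ ≤ ∑ j, |C j| := Finset.single_le_sum (f := fun j => |C j|) (fun j _ => abs_nonneg _)
        (Finset.mem_univ i)
    _ ≤ _ := by linarith

lemma injective_orbit {p : ℕ} (hw : (c, a) ∈ Sp p) :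
    Injective fun k : Fin p => (cubic c a)^[k + 1] c := by
  have key : ∀ k l : ℕ, k < l → l < p → (cubic c a)^[k + 1] c ≠ (cubic c a)^[l + 1] c := by
    intro k l hkl hl h
    have h1 := congrArg (cubic c a)^[p - 1 - l] h
    rw [← iterate_add_apply, ← iterate_add_apply, show p - 1 - l + (l + 1) = p by omega,
      hw.1] at h1
    exact hw.2 _ (by omega) (by omega) h1
  intro k l h
  rcases lt_trichotomy (k : ℕ) l with hkl | hkl | hkl
  · exact absurd h (key _ _ hkl l.2)
  · exact Fin.ext hkl
  · exact absurd h.symm (key _ _ hkl k.2)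

theorem exists_hasDiscSystem {p : ℕ} (hp : 1 ≤ p) (hw : (c, a) ∈ Sp p)
    (hcrit : ∀ n, (cubic c a)^[n] c ≠ -c) {ε : ℝ} (hε : 0 < ε) {κ : ℂ → ℂ}
    (hκ : IsBaseVar p c a c' a' ε κ) {y : ℕ → ℂ}
    (hy : Tendsto (fun m => y (m * p)) atTop (𝓝 c)) :
    ∃ n, 1 ≤ n ∧ HasDiscSystem c a c' a' (fun z => c' + (z - c) * κ (z - c)) y n := by
  set f := cubic c a with hf
  set ξ₀ : ℂ → ℂ := fun z => c' + (z - c) * κ (z - c) with hξ₀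
  set P : Fin p → ℂ := fun k => f^[k + 1] c with hP
  set e : Fin p → ℕ := fun k => p - 1 - k with he
  have hPc : ∀ k, f^[e k] (P k) = c := fun k => by
    rw [hP, ← iterate_add_apply, show e k + (k + 1) = p by have := k.2; simp only [he]; omega]
    exact hw.1
  have hder : ∀ k, deriv f^[e k] (P k) ≠ 0 := fun k h => by
    obtain ⟨j, hj, h⟩ := isCritical_iterate_cubic h
    rw [hP, ← iterate_add_apply] at h
    rcases h with h | h
    · have := k.2
      simp only [he] at hj
      exact hw.2 (j + (k + 1)) (by omega) (by omega) h
    · exact hcrit _ h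
  obtain ⟨L, hL1, hL⟩ := exists_locally_lipschitz c a P
  set K : Fin p → ℝ := fun k => ((3 * L) ^ e k)⁻¹ with hK
  have hK0 : ∀ k, 0 < K k := fun k => by positivity
  have hK1 : ∀ k, K k ≤ 1 := fun k => inv_le_one_of_one_le₀ (one_le_pow₀ (by linarith))
  have hfd : ∀ n, Differentiable ℂ f^[n] := fun n => (differentiable_cubic c a).iterate n
  have hdd : ∀ n, Differentiable ℂ (deriv f^[n]) := fun n =>
    ((hfd n).contDiff (n := 2)).differentiable_deriv_two
  have hvd : ∀ n, Differentiable ℂ fun z => varOrbit c a c' a' z 0 n :=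
    fun n => differentiable_varOrbit 0 n
  have q1 : ∀ k, ∀ᶠ ρ : ℝ in 𝓝[>] 0, ∀ z ∈ closedBall (P k) (2 * ρ),
      ‖f z - f (P k)‖ ≤ L * ‖z - P k‖ ∧ deriv f^[e k] z ≠ 0 ∧ f^[e k] z ∈ ball c ε := fun k =>
    eventually_forall_closedBall ((hL k).and
      (((hdd _).continuous.continuousAt.eventually_ne (hder k)).and
        ((hfd _).continuous.continuousAt.eventually
          (isOpen_ball.mem_nhds (by rw [hPc]; exact mem_ball_self hε)))))
  have q2 : ∀ᶠ ρ : ℝ in 𝓝[>] 0, ∀ k l, k ≠ l → 2 * ρ + 2 * ρ < dist (P k) (P l) := by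
    rw [eventually_all]; intro k
    rw [eventually_all]; intro l
    by_cases hkl : k = l
    · simp [hkl]
    · have h0 : 0 < dist (P k) (P l) := dist_pos.2 fun h => hkl (injective_orbit hw h)
      have : ∀ᶠ ρ : ℝ in 𝓝 0, 2 * ρ + 2 * ρ < dist (P k) (P l) :=
        (show Continuous fun ρ : ℝ => 2 * ρ + 2 * ρ by fun_prop).continuousAt.eventually_lt_const
          (by simpa using h0)
      exact (this.filter_mono nhdsWithin_le_nhds).mono fun ρ h _ => h
  have q3 : ∀ᶠ ρ : ℝ in 𝓝[>] 0, 4 * ρ * (2 * ρ + 3 * ‖c‖) < K ⟨0, hp⟩ := by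
    have : ∀ᶠ ρ : ℝ in 𝓝 0, 4 * ρ * (2 * ρ + 3 * ‖c‖) < K ⟨0, hp⟩ :=
      (show Continuous fun ρ : ℝ => 4 * ρ * (2 * ρ + 3 * ‖c‖) by
        fun_prop).continuousAt.eventually_lt_const (by simpa using hK0 _)
    exact this.filter_mono nhdsWithin_le_nhds
  obtain ⟨ρ, hρ1, hρ2, hρ3, hρ⟩ := ((eventually_all.2 q1).and (q2.and (q3.and
    self_mem_nhdsWithin))).exists
  replace hρ : 0 < ρ := hρ
  have hbig : ∀ {θ : ℝ} k, θ ≤ 2 → closedBall (P k) (θ * K k * ρ) ⊆ closedBall (P k) (2 * ρ) :=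
    fun {θ} k hθ => closedBall_subset_closedBall (by
      have := hK1 k
      have := hK0 k
      have : θ * K k ≤ 2 := by nlinarith
      gcongr)
  have hbig' : ∀ {θ : ℝ} k, θ ≤ 2 →
      closedBall (P k) (θ * K k * ρ) ⊆ closedBall (P k) (2 * K k * ρ) :=
    fun {θ} k hθ => closedBall_subset_closedBall (by have := hK0 k; gcongr)
  -- the last disc is centred at `c`
  set l : Fin p := ⟨p - 1, by omega⟩ with hl
  have hel : e l = 0 := by simp [he, hl]
  have hPl : P l = c := by have := hPc l; rwa [hel] at this
  have hKl : K l = 1 := by simp [hK, hel]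
  have hlast : ∀ k : Fin p, (k : ℕ) + 1 < p ∨ k = l := fun k => by
    have := k.2
    by_cases h : (k : ℕ) + 1 < p
    · exact Or.inl h
    · exact Or.inr (Fin.ext (by simp only [hl]; omega))
  have hmap : ∀ k, ∀ z ∈ closedBall (P k) (2 * K k * ρ), ∃ j, f z ∈ ball (P j) (1 * K j * ρ) ∧
      ((e k = 1 + e j) ∨ (k = l ∧ 1 + e j = p)) := by
    intro k z hz
    rcases hlast k with hk | rfl
    · refine ⟨⟨k + 1, hk⟩, ?_, Or.inl (by simp only [he]; omega)⟩
      have h1 := (hρ1 k z (hbig k le_rfl hz)).1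
      have h2 : f (P k) = P ⟨k + 1, hk⟩ := (iterate_succ_apply' f _ c).symm
      have h3 : e k = e ⟨k + 1, hk⟩ + 1 := by simp only [he]; omega
      have h4 : K ⟨k + 1, hk⟩ = 3 * L * K k := by
        simp only [hK, h3, pow_succ]; field_simp
      rw [mem_closedBall_iff_norm] at hz
      rw [mem_ball_iff_norm, ← h2, h4]
      have := hK0 k
      calc ‖f z - f (P k)‖ ≤ L * (2 * K k * ρ) := h1.trans (by gcongr)
        _ < 1 * (3 * L * K k) * ρ := by
          have : 0 < L * K k * ρ := by positivity
          nlinarith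
    · refine ⟨⟨0, hp⟩, ?_, Or.inr ⟨rfl, by simp only [he]; omega⟩⟩
      rw [hPl, hKl, mem_closedBall_iff_norm, mul_one] at hz
      have h2 : P ⟨0, hp⟩ = f c := rfl
      rw [mem_ball_iff_norm, h2]
      have h3 : f z - f c = (z - c) ^ 2 * ((z - c) + 3 * c) := by simp only [hf, cubic]; ring
      rw [h3, norm_mul, norm_pow]
      have h4 : ‖z - c + 3 * c‖ ≤ 2 * ρ + 3 * ‖c‖ :=
        (norm_add_le _ _).trans (add_le_add hz (by simp))
      calc ‖z - c‖ ^ 2 * ‖z - c + 3 * c‖ ≤ (2 * ρ) ^ 2 * (2 * ρ + 3 * ‖c‖) := by gcongr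
        _ = (4 * ρ * (2 * ρ + 3 * ‖c‖)) * ρ := by ring
        _ < 1 * K ⟨0, hp⟩ * ρ := by rw [one_mul]; gcongr
  have hdisj : Pairwise (Disjoint on fun k => closedBall (P k) (2 * K k * ρ)) := fun k j hkj =>
    (closedBall_disjoint_closedBall (hρ2 k j hkj)).mono (hbig k le_rfl) (hbig j le_rfl)
  obtain ⟨ξ, hξ⟩ := exists_piecewise hdisj fun k => pullVar c a c' a' ξ₀ (e k)
  -- the entry time of the orbit `y`
  have hentry : ∃ n, 1 ≤ n ∧ ∃ k, y n ∈ ball (P k) (2 * K k * ρ) := by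
    obtain ⟨m, hm, hm1⟩ := ((hy.eventually (isOpen_ball.mem_nhds (mem_ball_self
      (show 0 < 2 * ρ by positivity)))).and (eventually_ge_atTop 1)).exists
    exact ⟨m * p, Nat.mul_pos hm1 hp, l, by rwa [hPl, hKl, mul_one]⟩
  classical
  obtain ⟨hN1, k₀, hk₀⟩ := Nat.find_spec hentry
  set N := Nat.find hentry with hN
  obtain ⟨θ, hθ1, hθ2⟩ : ∃ θ, max 1 (dist (y N) (P k₀) / (K k₀ * ρ)) < θ ∧ θ < 2 := by
    refine exists_between (max_lt one_lt_two ?_)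
    have := hK0 k₀
    rw [div_lt_iff₀ (by positivity), ← mul_assoc]
    exact hk₀
  have hθ0 : 1 < θ := (le_max_left _ _).trans_lt hθ1
  have hθ' : (θ + 2) / 2 ≤ 2 := by linarith
  refine ⟨N, hN1, Fin p, inferInstance, P, fun k => θ * K k * ρ, fun k => (θ + 2) / 2 * K k * ρ, ξ,
    fun k => ?_, fun k => ?_, ?_, ?_, ?_, ?_, ?_, ?_, ?_, ?_⟩
  · have := hK0 k; positivity
  · have := hK0 k
    change θ * K k * ρ < (θ + 2) / 2 * K k * ρ
    have : θ < (θ + 2) / 2 := by linarith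
    gcongr
  · exact fun k j hkj => (hdisj hkj).mono (hbig' k hθ') (hbig' j hθ')
  · intro k z hz
    obtain ⟨j, hj, -⟩ := hmap k z (hbig' k hθ' hz)
    have := hK0 j
    have : 1 * K j * ρ ≤ θ * K j * ρ := by gcongr
    exact mem_iUnion.2 ⟨j, ball_subset_ball this hj⟩
  · intro k
    refine DifferentiableOn.congr ?_ fun z hz => hξ k (hbig' k hθ' hz)
    have hm : MapsTo (fun z => f^[e k] z - c) (closedBall (P k) ((θ + 2) / 2 * K k * ρ))
        (ball 0 ε) := fun z hz => by
      have := (hρ1 k z (hbig k hθ' hz)).2.2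
      rw [mem_ball_iff_norm] at this
      simpa using this
    have hm1 := hκ.diff.comp ((hfd (e k)).sub_const c).differentiableOn hm
    exact ((((hfd (e k)).sub_const c).differentiableOn.mul hm1).const_add c' |>.sub
      (hvd _).differentiableOn).div (hdd _).differentiableOn
      fun z hz => (hρ1 k z (hbig k hθ' hz)).2.1
  · intro k z hz
    obtain ⟨j, hj, hkj⟩ := hmap k z (hbig' k hθ' hz)
    have hK0j := hK0 j
    have hj' : f z ∈ closedBall (P j) (2 * K j * ρ) :=
      ball_subset_closedBall (ball_subset_ball (by gcongr; norm_num) hj)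
    have hd := (hρ1 j _ (hbig j le_rfl hj')).2.1
    rw [hξ j hj', hξ k (hbig' k hθ' hz)]
    refine pullVar_cubic hd ?_
    rcases hkj with hkj | ⟨rfl, hkj⟩
    · rw [← hkj]
      exact varOrbit_pullVar (hρ1 k _ (hbig k hθ' hz)).2.1
    · have h1 := (hρ1 l z (hbig l hθ' hz)).2.2
      rw [hel, iterate_zero, id, mem_ball_iff_norm] at h1
      have h2 := hκ.eq (z - c) (by simpa using h1)
      rw [add_sub_cancel] at h2
      simp only [hel, pullVar_zero]
      rw [hkj]
      exact h2
  · have := hK0 l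
    exact mem_iUnion.2 ⟨l, by rw [hPl]; exact mem_ball_self (by positivity)⟩
  · refine mem_iUnion.2 ⟨k₀, ?_⟩
    have := hK0 k₀
    have h1 := (le_max_right _ _).trans_lt hθ1
    rw [div_lt_iff₀ (by positivity), ← mul_assoc] at h1
    exact h1
  · intro j hj hjN k hk
    have := hK0 k
    have h1 : (θ + 2) / 2 < 2 := by linarith
    have h2 : (θ + 2) / 2 * K k * ρ < 2 * K k * ρ := by gcongr
    exact Nat.find_min hentry hjN ⟨hj, k, closedBall_subset_ball h2 hk⟩
  · have : closedBall c (2 * ρ) ∈ 𝓝 c := closedBall_mem_nhds c (by positivity)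
    filter_upwards [this] with z hz
    rw [hξ l (by rwa [hPl, hKl, mul_one]), hel, pullVar_zero]

end DiscSystem

section Transversality

variable {p : ℕ} {c a : ℂ}

lemma iterate_eq_add_critOrbit (n : ℕ) :
    (cubic c a)^[n * p] (-c) = c + critOrbit p (c, a) n := by
  rw [mul_comm, iterate_mul]; simp [critOrbit]

lemma tendsto_iterate_of_critOrbit (ht : Tendsto (critOrbit p (c, a)) atTop (𝓝 0)) :
    Tendsto (fun m => (cubic c a)^[m * p] (-c)) atTop (𝓝 c) := by
  simp only [iterate_eq_add_critOrbit]
  simpa using ht.const_add c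

lemma iterate_periodic_point_fixed (hper : (cubic c a)^[p] c = c) (n m : ℕ) :
    (cubic c a)^[m * p] ((cubic c a)^[n] c) = (cubic c a)^[n] c := by
  rw [← iterate_add_apply, add_comm, iterate_add_apply, mul_comm, iterate_mul,
    iterate_fixed hper]

lemma iterate_crit_ne_neg (hc : c ≠ 0) (hper : (cubic c a)^[p] c = c)
    (ht : Tendsto (critOrbit p (c, a)) atTop (𝓝 0)) (n : ℕ) : (cubic c a)^[n] c ≠ -c := by
  intro h
  have h1 := tendsto_iterate_of_critOrbit ht
  simp only [← h, iterate_periodic_point_fixed hper] at h1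
  have h2 := tendsto_nhds_unique h1 tendsto_const_nhds
  rw [h] at h2
  exact hc (self_eq_neg.1 h2)

lemma iterate_free_crit_ne (hper : (cubic c a)^[p] c = c) (hp : 1 ≤ p)
    (ht : Tendsto (critOrbit p (c, a)) atTop (𝓝 0)) (hnz : ∀ n, critOrbit p (c, a) n ≠ 0) (n : ℕ) :
    (cubic c a)^[n] (-c) ≠ c := by
  intro h
  have hnp : n * p = (n * p - n) + n := by
    have := Nat.le_mul_of_pos_right n hp
    omega
  have h1 : ∀ m, (cubic c a)^[(m + n) * p] (-c) = (cubic c a)^[n * p - n] c := fun m => by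
    rw [add_mul, iterate_add_apply, hnp, iterate_add_apply _ (n * p - n), h, ← hnp]
    exact iterate_periodic_point_fixed hper _ _
  have h2 := (tendsto_iterate_of_critOrbit ht).comp (tendsto_add_atTop_nat n)
  simp only [comp_def, h1] at h2
  have h3 := tendsto_nhds_unique h2 tendsto_const_nhds
  have h4 := h1 0
  rw [zero_add, iterate_eq_add_critOrbit, ← h3] at h4
  exact hnz n (by simpa using h4)

lemma injective_free_crit_orbit (hper : (cubic c a)^[p] c = c) (hp : 1 ≤ p)
    (ht : Tendsto (critOrbit p (c, a)) atTop (𝓝 0)) (hnz : ∀ n, critOrbit p (c, a) n ≠ 0) :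
    Injective fun n => (cubic c a)^[n] (-c) := by
  have key : ∀ i j, i < j → (cubic c a)^[i] (-c) ≠ (cubic c a)^[j] (-c) := by
    intro i j hij h
    have h1 : (cubic c a)^[j - i] ((cubic c a)^[i] (-c)) = (cubic c a)^[i] (-c) := by
      rw [← iterate_add_apply, Nat.sub_add_cancel hij.le, h]
    have h2 : ∀ m, (cubic c a)^[i] ((cubic c a)^[(m * (j - i)) * p] (-c)) =
        (cubic c a)^[i] (-c) := fun m => by
      rw [← iterate_add_apply, add_comm, iterate_add_apply, mul_assoc, mul_comm, mul_assoc,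
        iterate_mul, iterate_fixed h1]
    have h3 : Tendsto (fun m => m * (j - i)) atTop atTop :=
      tendsto_id.atTop_mul_const' (by omega)
    have h4 := (((continuous_cubic c a).iterate i).tendsto c).comp
      ((tendsto_iterate_of_critOrbit ht).comp h3)
    simp only [comp_def, h2] at h4
    have h5 := tendsto_nhds_unique h4 tendsto_const_nhds
    refine iterate_free_crit_ne hper hp ht hnz (i * p) ?_
    have hip : i * p = (i * p - i) + i := by
      have := Nat.le_mul_of_pos_right i hp
      omega
    rw [hip, iterate_add_apply, ← h5, ← iterate_add_apply, ← hip, mul_comm, iterate_mul,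
      iterate_fixed hper]
  intro i j h
  rcases lt_trichotomy i j with hij | hij | hij
  · exact absurd h (key _ _ hij)
  · exact hij
  · exact absurd h.symm (key _ _ hij)

lemma iterate_sq_ne (hper : (cubic c a)^[p] c = c) (hp : 1 ≤ p)
    (ht : Tendsto (critOrbit p (c, a)) atTop (𝓝 0)) (hnz : ∀ n, critOrbit p (c, a) n ≠ 0) {n : ℕ}
    (hn : 1 ≤ n) : ((cubic c a)^[n] (-c)) ^ 2 ≠ c ^ 2 := by
  intro h
  rcases sq_eq_sq_iff_eq_or_eq_neg.1 h with h | h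
  · exact iterate_free_crit_ne hper hp ht hnz n h
  · exact absurd (injective_free_crit_orbit hper hp ht hnz (a₁ := n) (a₂ := 0) h) (by omega)

/-- The variation of `critOrbit`. -/
noncomputable def critVar (p : ℕ) (c a c' a' : ℂ) (n : ℕ) : ℂ :=
  varOrbit c a c' a' (-c) (-c') (n * p) - c'

lemma critVar_succ {c' a' : ℂ} (n : ℕ) : critVar p c a c' a' (n + 1) =
    varOrbit c a c' a' (c + critOrbit p (c, a) n) (c' + critVar p c a c' a' n) p - c' := by
  rw [critVar, add_mul, one_mul, varOrbit_add, iterate_eq_add_critOrbit, critVar]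
  congr 2; ring

lemma critOrbit_succ (n : ℕ) : critOrbit p (c, a) (n + 1) =
    (cubic c a)^[p] (c + critOrbit p (c, a) n) - c := by
  simp [critOrbit, iterate_succ_apply']

theorem eq_zero_of_critVar (hp : 1 ≤ p) (hc : c ≠ 0) (hw : (c, a) ∈ Sp p)
    (ht : Tendsto (critOrbit p (c, a)) atTop (𝓝 0)) (hnz : ∀ n, critOrbit p (c, a) n ≠ 0)
    {c' a' : ℂ} {ε : ℝ} (hε : 0 < ε) {κ : ℂ → ℂ} (hκ : IsBaseVar p c a c' a' ε κ) {N : ℕ}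
    (hN : ∀ n ≥ N, critOrbit p (c, a) n ∈ ball (0 : ℂ) ε)
    (h : critVar p c a c' a' N = critOrbit p (c, a) N * κ (critOrbit p (c, a) N)) :
    c' = 0 ∧ a' = 0 := by
  have hall : ∀ n ≥ N, critVar p c a c' a' n =
      critOrbit p (c, a) n * κ (critOrbit p (c, a) n) := by
    intro n hn
    induction n, hn using Nat.le_induction with
    | base => exact h
    | succ n hn ih =>
      rw [critVar_succ, ih, hκ.eq _ (hN n hn), critOrbit_succ]; ring
  have hcn := iterate_crit_ne_neg hc hw.1 ht
  obtain ⟨n, hn, hD⟩ := exists_hasDiscSystem (y := fun n => (cubic c a)^[n] (-c)) hp hw hcn hε hκ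
    (tendsto_iterate_of_critOrbit ht)
  have hD1 := hD.one hn (fun n => iterate_succ_apply' _ _ _)
    (fun n hn => iterate_sq_ne hw.1 hp ht hnz hn) (injective_free_crit_orbit hw.1 hp ht hnz)
  refine hD1.eq_zero hc hp (fun n hn => iterate_sq_ne hw.1 hp ht hnz hn) hcn (by simp)
    (tendsto_iterate_of_critOrbit ht) ?_
  filter_upwards [eventually_ge_atTop N] with m hm
  have := hall m hm
  rw [critVar] at this
  rw [iterate_eq_add_critOrbit, add_sub_cancel_left, ← this]
  ring

lemma critVar_linear (α β c₁ a₁ c₂ a₂ : ℂ) (n : ℕ) :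
    critVar p c a (α * c₁ + β * c₂) (α * a₁ + β * a₂) n =
      α * critVar p c a c₁ a₁ n + β * critVar p c a c₂ a₂ n := by
  simp only [critVar]
  have := varOrbit_linear (c := c) (a := a) α β c₁ a₁ (-c₁) c₂ a₂ (-c₂) (-c) (n * p)
  rw [show -(α * c₁ + β * c₂) = α * -c₁ + β * -c₂ by ring, this]
  ring

/-- The curve `Sp p` is smooth at hyperbolic parameters of Type A with `c ≠ 0`. -/
theorem exists_varOrbit_ne (hp : 1 ≤ p) (hc : c ≠ 0) (hw : (c, a) ∈ Sp p)
    (ht : Tendsto (critOrbit p (c, a)) atTop (𝓝 0)) (hnz : ∀ n, critOrbit p (c, a) n ≠ 0) :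
    ∃ c' a', varOrbit c a c' a' c c' p ≠ c' := by
  by_contra! hall
  obtain ⟨ε, hε, -, -, hex⟩ := exists_isBaseVar hp hw.1 (retFactor_zero_ne_zero hp hw hc ht)
  obtain ⟨κ₁, h₁⟩ := hex 1 0 (hall 1 0)
  obtain ⟨κ₂, h₂⟩ := hex 0 1 (hall 0 1)
  obtain ⟨N, hN⟩ := eventually_atTop.1 (ht.eventually (ball_mem_nhds 0 hε))
  set s := critOrbit p (c, a) N
  set d₁ := critVar p c a 1 0 N - s * κ₁ s with hd₁
  set d₂ := critVar p c a 0 1 N - s * κ₂ s with hd₂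
  have key : ∀ α β : ℂ, α * d₁ + β * d₂ = 0 → α = 0 ∧ β = 0 := by
    intro α β h
    have h3 := critVar_linear (p := p) (c := c) (a := a) α β 1 0 0 1 N
    have h4 := eq_zero_of_critVar hp hc hw ht hnz hε (h₁.linear h₂ α β) hN
      (by rw [h3]; linear_combination h)
    simpa using h4
  have h5 := key d₂ (-d₁) (by ring)
  exact one_ne_zero (key 1 0 (by simp [neg_eq_zero.1 h5.2])).1

theorem eq_zero_of_bounded_critVar (hp : 1 ≤ p) (hc : c ≠ 0) (hw : (c, a) ∈ Sp p)
    (ht : Tendsto (critOrbit p (c, a)) atTop (𝓝 0)) (hnz : ∀ n, critOrbit p (c, a) n ≠ 0)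
    {c' a' : ℂ} (hv : varOrbit c a c' a' c c' p = c') {M : ℝ}
    (hM : ∀ᶠ n in atTop, ‖critVar p c a c' a' n‖ ≤ M * ‖critOrbit p (c, a) n‖) :
    c' = 0 ∧ a' = 0 := by
  obtain ⟨ε, hε, -, hgrow, hex⟩ := exists_isBaseVar hp hw.1 (retFactor_zero_ne_zero hp hw hc ht)
  obtain ⟨κ, hκ⟩ := hex c' a' hv
  obtain ⟨N, hN⟩ := eventually_atTop.1 (ht.eventually (ball_mem_nhds 0 hε))
  refine eq_zero_of_critVar hp hc hw ht hnz hε hκ hN ?_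
  set s := critOrbit p (c, a) with hs
  set d : ℕ → ℂ := fun n => critVar p c a c' a' n - s n * κ (s n) with hd
  have hds : ∀ n ≥ N, d (n + 1) = deriv (cubic c a)^[p] (c + s n) * d n := fun n hn => by
    have h1 := hκ.eq _ (hN n hn)
    have h2 := varOrbit_add_right (c := c) (a := a) (c' := c') (a' := a') (c + s n)
      (c' + s n * κ (s n)) (d n) p
    rw [h1, ← critOrbit_succ] at h2
    rw [hd]
    simp only
    rw [critVar_succ, show c' + critVar p c a c' a' n = c' + s n * κ (s n) + d n by
      simp only [hd]; ring, h2]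
    ring
  have hgr : ∀ n ≥ N, 4 / 3 * (‖d n‖ / ‖s n‖) ≤ ‖d (n + 1)‖ / ‖s (n + 1)‖ := fun n hn => by
    have h1 := hgrow (s n) (by simpa using hN n hn)
    rw [← critOrbit_succ] at h1
    have h2 := norm_pos_iff.2 (hnz n)
    have h3 := norm_pos_iff.2 (hnz (n + 1))
    rw [hds n hn, norm_mul, ← mul_div_assoc, div_le_div_iff₀ h2 h3]
    calc _ = (4 / 3 * ‖s (n + 1)‖) * ‖d n‖ := by ring
      _ ≤ (‖deriv (cubic c a)^[p] (c + s n)‖ * ‖s n‖) * ‖d n‖ := by gcongr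
      _ = _ := by ring
  have hpow : ∀ k, (4 / 3) ^ k * (‖d N‖ / ‖s N‖) ≤ ‖d (N + k)‖ / ‖s (N + k)‖ := fun k => by
    induction k with
    | zero => simp
    | succ k ih =>
      refine le_trans ?_ (hgr (N + k) (by omega))
      rw [pow_succ]; linarith
  have hκ0 : ∀ᶠ n in atTop, ‖κ (s n)‖ ≤ ‖κ 0‖ + 1 :=
    ((((hκ.diff.differentiableAt (ball_mem_nhds 0 hε)).continuousAt).tendsto.comp ht).norm
      |>.eventually_le_const (by linarith)).mono fun n h => h
  have hbd : ∀ᶠ n in atTop, ‖d n‖ / ‖s n‖ ≤ M + (‖κ 0‖ + 1) := by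
    filter_upwards [hM, hκ0] with n h1 h2
    rw [div_le_iff₀ (norm_pos_iff.2 (hnz n)), add_mul]
    refine (norm_sub_le _ _).trans (add_le_add h1 ?_)
    rw [norm_mul, mul_comm]
    gcongr
  have hzero : ‖d N‖ / ‖s N‖ = 0 := by
    by_contra hne
    have hpos : 0 < ‖d N‖ / ‖s N‖ := lt_of_le_of_ne (by positivity) (Ne.symm hne)
    have h1 : Tendsto (fun k : ℕ => (4 / 3 : ℝ) ^ k * (‖d N‖ / ‖s N‖)) atTop atTop :=
      (tendsto_pow_atTop_atTop_of_one_lt (by norm_num)).atTop_mul_const hpos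
    have h2 : ∀ᶠ k in atTop, ‖d (N + k)‖ / ‖s (N + k)‖ ≤ M + (‖κ 0‖ + 1) :=
      (tendsto_atTop_mono (fun k => Nat.le_add_left k N) tendsto_id).eventually hbd
    obtain ⟨k, hk1, hk2⟩ := (h2.and (h1.eventually_gt_atTop (M + (‖κ 0‖ + 1)))).exists
    linarith [hpow k]
  rw [div_eq_zero_iff] at hzero
  have := hzero.resolve_right (norm_ne_zero_iff.2 (hnz N))
  exact sub_eq_zero.1 (norm_eq_zero.1 this)

end Transversality

section Curve

lemma exists_curve {F : ℂ × ℂ → ℂ} {w₁ : ℂ × ℂ} (hF : AnalyticAt ℂ F w₁)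
    (ℓ : ℂ × ℂ →L[ℂ] ℂ) (hinj : ∀ v, fderiv ℂ F w₁ v = 0 → ℓ v = 0 → v = 0) (hF0 : F w₁ = 0) :
    ∃ γ : ℂ → ℂ × ℂ, AnalyticAt ℂ γ (ℓ w₁) ∧ γ (ℓ w₁) = w₁ ∧
      (∀ᶠ u in 𝓝 (ℓ w₁), F (γ u) = 0 ∧ ℓ (γ u) = u) ∧
      ∀ᶠ w in 𝓝 w₁, F w = 0 → γ (ℓ w) = w := by
  set D : ℂ × ℂ →L[ℂ] ℂ × ℂ := (fderiv ℂ F w₁).prod ℓ with hD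
  have hDi : Injective (D : ℂ × ℂ →ₗ[ℂ] ℂ × ℂ) := by
    rw [injective_iff_map_eq_zero]
    intro v hv
    have h := Prod.ext_iff.1 hv
    exact hinj v h.1 h.2
  set e : (ℂ × ℂ) ≃L[ℂ] ℂ × ℂ :=
    (LinearEquiv.ofInjectiveEndo (D : ℂ × ℂ →ₗ[ℂ] ℂ × ℂ) hDi).toContinuousLinearEquiv with he
  set f : ℂ × ℂ → ℂ × ℂ := fun w => (F w, ℓ w) with hf
  have hfc : ContDiffAt ℂ ⊤ f w₁ := hF.contDiffAt.prodMk ℓ.contDiff.contDiffAt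
  have hfd : HasFDerivAt f (e : ℂ × ℂ →L[ℂ] ℂ × ℂ) w₁ := by
    have h : HasFDerivAt f D w₁ := hF.differentiableAt.hasFDerivAt.prodMk ℓ.hasFDerivAt
    convert h using 1
    exact ContinuousLinearMap.ext fun v => rfl
  have hs : HasStrictFDerivAt f (e : ℂ × ℂ →L[ℂ] ℂ × ℂ) w₁ :=
    hfc.hasStrictFDerivAt' hfd (by simp)
  set r := hfc.localInverse hfd (by simp) with hr
  have hfw : f w₁ = (0, ℓ w₁) := by simp [hf, hF0]
  have hra : AnalyticAt ℂ r (0, ℓ w₁) := by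
    have h := (hfc.to_localInverse hfd (by simp)).analyticAt
    rwa [hfw] at h
  have hr1 : ∀ᶠ w in 𝓝 w₁, r (f w) = w := hs.eventually_left_inverse
  have hr2 : ∀ᶠ y in 𝓝 ((0 : ℂ), ℓ w₁), f (r y) = y := by
    have h := hs.eventually_right_inverse
    rwa [hfw] at h
  have hι : AnalyticAt ℂ (fun u : ℂ => ((0 : ℂ), u)) (ℓ w₁) :=
    analyticAt_const.prod analyticAt_id
  refine ⟨fun u => r (0, u), AnalyticAt.comp (g := r) (f := fun u : ℂ => ((0 : ℂ), u)) hra hι, ?_,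
    ?_, ?_⟩
  · have := hr1.self_of_nhds
    rwa [hfw] at this
  · filter_upwards [hι.continuousAt.eventually hr2] with u hu
    exact Prod.ext_iff.1 hu
  · filter_upwards [hr1] with w hw h0
    have h1 : f w = (0, ℓ w) := by simp [hf, h0]
    rwa [h1] at hw

end Curve

section LocalStructure

variable {p : ℕ} {H : Set (ℂ × ℂ)}

/-- The equation `f^p(c) - c` of the curve of parameters with a `p`-periodic critical point. -/
noncomputable def periodEq (p : ℕ) (w : ℂ × ℂ) : ℂ := (cubic w.1 w.2)^[p] w.1 - w.1

lemma analyticAt_periodEq (w : ℂ × ℂ) : AnalyticAt ℂ (periodEq p) w := by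
  have h : ContDiff ℂ ⊤ (fun x : ℂ × ℂ => (cubic x.1 x.2)^[p] x.1) :=
    ContDiff.comp (g := fun x : ℂ × ℂ × ℂ => (cubic x.1 x.2.1)^[p] x.2.2)
      (f := fun x : ℂ × ℂ => (x.1, x.2, x.1)) (contDiff_iterate_cubic p) (by fun_prop)
  exact (h.sub contDiff_fst).contDiffAt.analyticAt

lemma hasDerivAt_periodEq {γ : ℂ → ℂ × ℂ} {γ' : ℂ × ℂ} {u : ℂ} (hγ : HasDerivAt γ γ' u) :
    HasDerivAt (fun v => periodEq p (γ v))
      (varOrbit (γ u).1 (γ u).2 γ'.1 γ'.2 (γ u).1 γ'.1 p - γ'.1) u := by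
  have h1 : HasDerivAt (fun v => (γ v).1) γ'.1 u :=
    (ContinuousLinearMap.fst ℂ ℂ ℂ).hasFDerivAt.comp_hasDerivAt u hγ
  have h2 : HasDerivAt (fun v => (γ v).2) γ'.2 u :=
    (ContinuousLinearMap.snd ℂ ℂ ℂ).hasFDerivAt.comp_hasDerivAt u hγ
  exact (hasDerivAt_varOrbit h1 h2 h1 p).sub h1

lemma fderiv_periodEq (w v : ℂ × ℂ) : fderiv ℂ (periodEq p) w v =
    varOrbit w.1 w.2 v.1 v.2 w.1 v.1 p - v.1 := by
  have hγ : HasDerivAt (fun u : ℂ => w + u • v) v 0 := by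
    simpa using ((hasDerivAt_id (0 : ℂ)).smul_const v).const_add w
  have h1 := hasDerivAt_periodEq (p := p) hγ
  have hF : HasFDerivAt (periodEq p) (fderiv ℂ (periodEq p) w) (w + (0 : ℂ) • v) := by
    simpa using (analyticAt_periodEq (p := p) w).differentiableAt.hasFDerivAt
  have h2 := hF.comp_hasDerivAt (0 : ℂ) hγ
  have h3 := h2.unique h1
  simpa using h3

lemma eventually_mem_Sp {w₁ : ℂ × ℂ} (hw₁ : w₁ ∈ Sp p) :
    ∀ᶠ w in 𝓝 w₁, periodEq p w = 0 → w ∈ Sp p := by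
  have h : ∀ᶠ w in 𝓝 w₁, ∀ k ∈ Finset.Ico 1 p, (cubic w.1 w.2)^[k] w.1 ≠ w.1 := by
    rw [Filter.eventually_all_finset]
    intro k hk
    have hk' := Finset.mem_Ico.1 hk
    have hc : Continuous fun w : ℂ × ℂ => (cubic w.1 w.2)^[k] w.1 - w.1 :=
      (continuous_iterate_cubic_param continuous_fst continuous_snd continuous_fst k).sub
        continuous_fst
    filter_upwards [hc.continuousAt.eventually_ne (sub_ne_zero.2 (hw₁.2 k hk'.1 hk'.2))] with w hw
    exact sub_ne_zero.1 hw
  filter_upwards [h] with w hw h0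
  exact ⟨sub_eq_zero.1 h0, fun k h1 h2 => hw k (Finset.mem_Ico.2 ⟨h1, h2⟩)⟩

lemma critOrbit_succ_eq (hp : 1 ≤ p) {w : ℂ × ℂ} (hper : (cubic w.1 w.2)^[p] w.1 = w.1) (n : ℕ) :
    critOrbit p w (n + 1) = critOrbit p w n ^ 2 * retFactor p w.1 w.2 (critOrbit p w n) := by
  rw [critOrbit_succ (p := p) (c := w.1) (a := w.2), iterate_cubic_add_eq hp, hper,
    add_sub_cancel_left]

lemma exists_uniform_trap {w₁ : ℂ × ℂ} (ht : Tendsto (critOrbit p w₁) atTop (𝓝 0))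
    {R : ℂ × ℂ → ℂ → Prop} (hR : ∀ᶠ x in 𝓝 (w₁, (0 : ℂ)), R x.1 x.2) :
    ∃ ε > 0, ∃ N, ∀ᶠ w in 𝓝 w₁, (∀ s, ‖s‖ < ε →
      ‖s ^ 2 * retFactor p w.1 w.2 s‖ ≤ ‖s‖ / 2 ∧ R w s) ∧ ‖critOrbit p w N‖ < ε := by
  have hQc : Continuous fun x : (ℂ × ℂ) × ℂ => ‖x.2 * retFactor p x.1.1 x.1.2 x.2‖ := by
    have h : Continuous fun x : (ℂ × ℂ) × ℂ => retFactor p x.1.1 x.1.2 x.2 :=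
      ((contDiff_retFactor (n := 0) p).continuous).comp
        (show Continuous fun x : (ℂ × ℂ) × ℂ => (x.1.1, x.1.2, x.2) by fun_prop)
    fun_prop
  have hQ : ∀ᶠ x in 𝓝 (w₁, (0 : ℂ)), ‖x.2 * retFactor p x.1.1 x.1.2 x.2‖ < 1 / 2 :=
    hQc.continuousAt.eventually_lt_const (by simp)
  have h := hQ.and hR
  rw [nhds_prod_eq] at h
  obtain ⟨P, hP, S, hS, hPS⟩ := Filter.eventually_prod_iff.1 h
  obtain ⟨ε, hε, hεS⟩ := Metric.eventually_nhds_iff.1 hS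
  obtain ⟨N, hN⟩ := (ht.norm.eventually_lt_const (by simpa using hε)).exists
  refine ⟨ε, hε, N, ?_⟩
  filter_upwards [hP, (continuous_critOrbit p N).norm.continuousAt.eventually_lt_const hN]
    with w hw hwN
  refine ⟨fun s hs => ?_, hwN⟩
  have h1 := hPS hw (hεS (y := s) (by simpa using hs))
  refine ⟨?_, h1.2⟩
  have h2 : ‖s ^ 2 * retFactor p w.1 w.2 s‖ = ‖s‖ * ‖s * retFactor p w.1 w.2 s‖ := by
    rw [← norm_mul]; congr 1; ring
  rw [h2]
  have h3 : ‖s * retFactor p w.1 w.2 s‖ < 1 / 2 := h1.1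
  nlinarith [norm_nonneg s]

lemma norm_critOrbit_trap (hp : 1 ≤ p) {w : ℂ × ℂ} (hper : (cubic w.1 w.2)^[p] w.1 = w.1) {ε : ℝ}
    {N : ℕ} (htrap : ∀ s, ‖s‖ < ε → ‖s ^ 2 * retFactor p w.1 w.2 s‖ ≤ ‖s‖ / 2)
    (hN : ‖critOrbit p w N‖ < ε) (k : ℕ) :
    ‖critOrbit p w (N + k)‖ ≤ ‖critOrbit p w N‖ * (1 / 2) ^ k := by
  induction k with
  | zero => simp
  | succ k ih =>
    have h1 : ‖critOrbit p w (N + k)‖ < ε := by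
      refine lt_of_le_of_lt (ih.trans ?_) hN
      exact mul_le_of_le_one_right (norm_nonneg _) (pow_le_one₀ (by norm_num) (by norm_num))
    rw [← add_assoc, critOrbit_succ_eq hp hper, pow_succ (1 / 2 : ℝ)]
    linarith [htrap _ h1]

lemma norm_critOrbit_lt_trap (hp : 1 ≤ p) {w : ℂ × ℂ} (hper : (cubic w.1 w.2)^[p] w.1 = w.1)
    {ε : ℝ} {N : ℕ} (htrap : ∀ s, ‖s‖ < ε → ‖s ^ 2 * retFactor p w.1 w.2 s‖ ≤ ‖s‖ / 2)
    (hN : ‖critOrbit p w N‖ < ε) (k : ℕ) : ‖critOrbit p w (N + k)‖ < ε :=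
  lt_of_le_of_lt ((norm_critOrbit_trap hp hper htrap hN k).trans
    (mul_le_of_le_one_right (norm_nonneg _) (pow_le_one₀ (by norm_num) (by norm_num)))) hN

lemma tendsto_critOrbit_of_trap (hp : 1 ≤ p) {w : ℂ × ℂ} (hper : (cubic w.1 w.2)^[p] w.1 = w.1)
    {ε : ℝ} {N : ℕ} (htrap : ∀ s, ‖s‖ < ε → ‖s ^ 2 * retFactor p w.1 w.2 s‖ ≤ ‖s‖ / 2)
    (hN : ‖critOrbit p w N‖ < ε) : Tendsto (critOrbit p w) atTop (𝓝 0) := by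
  rw [← tendsto_add_atTop_iff_nat N]
  have h : Tendsto (fun k => ‖critOrbit p w N‖ * (1 / 2 : ℝ) ^ k) atTop (𝓝 0) := by
    simpa using (tendsto_pow_atTop_nhds_zero_of_lt_one (r := (1 / 2 : ℝ)) (by norm_num)
      (by norm_num)).const_mul ‖critOrbit p w N‖
  refine squeeze_zero_norm (fun k => ?_) h
  rw [add_comm]
  exact norm_critOrbit_trap hp hper htrap hN k

lemma eventually_curve_mem (hp : 1 ≤ p) (hH : IsHyperbolicComponent p H) {w₁ : ℂ × ℂ}
    (hw₁ : w₁ ∈ H) (ht : Tendsto (critOrbit p w₁) atTop (𝓝 0)) {γ : ℂ → ℂ × ℂ} {u₁ : ℂ}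
    (hγ : AnalyticAt ℂ γ u₁) (hγu : γ u₁ = w₁) (hF : ∀ᶠ u in 𝓝 u₁, periodEq p (γ u) = 0) :
    ∀ᶠ u in 𝓝 u₁, γ u ∈ H := by
  obtain ⟨ε, hε, N, hw⟩ := exists_uniform_trap (R := fun _ _ => True) ht (by simp)
  have hSp := eventually_mem_Sp (hH.subset hw₁).1
  have hγc := hγ.continuousAt
  rw [← hγu] at hw hSp
  obtain ⟨δ, hδ, h⟩ := Metric.eventually_nhds_iff_ball.1
    (hF.and ((hγc.eventually hw).and ((hγc.eventually hSp).and hγ.eventually_analyticAt)))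
  filter_upwards [ball_mem_nhds u₁ hδ] with u hu
  have hpre : IsPreconnected (γ '' ball u₁ δ) :=
    (convex_ball u₁ δ).isPreconnected.image γ fun v hv =>
      (h v hv).2.2.2.continuousAt.continuousWithinAt
  refine hH.subset_of_isPreconnected hpre ?_ ⟨u₁, mem_ball_self hδ, hγu⟩ hw₁ ⟨u, hu, rfl⟩
  rintro _ ⟨v, hv, rfl⟩
  obtain ⟨h1, h2, h3, -⟩ := h v hv
  have h4 := h3 h1
  exact mem_hypLocus_of_tendsto hp h4
    (tendsto_critOrbit_of_trap hp h4.1 (fun s hs => (h2.1 s hs).1) h2.2)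

/-- Near `w₁` the set `H` is a Riemann surface on which `t` is a local coordinate. -/
def HasLocalParam (p : ℕ) (H : Set (ℂ × ℂ)) (w₁ : ℂ × ℂ) (t₁ : ℂ) : Prop :=
  ∃ (ω : ℂ → ℂ × ℂ) (T : ℂ × ℂ → ℂ), AnalyticAt ℂ ω t₁ ∧ ω t₁ = w₁ ∧ AnalyticAt ℂ T w₁ ∧
    T w₁ = t₁ ∧ (∀ᶠ t in 𝓝 t₁, ω t ∈ H ∧ IsCritParam p (ω t) t ∧ T (ω t) = t) ∧
    ∀ᶠ w in 𝓝 w₁, w ∈ H → ω (T w) = w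

lemma hasLocalParam_of_curve (hH : H ⊆ Sp p) {w₁ : ℂ × ℂ} (ℓ : ℂ × ℂ →L[ℂ] ℂ) {γ : ℂ → ℂ × ℂ}
    {θ : ℂ → ℂ} (hγ : AnalyticAt ℂ γ (ℓ w₁)) (hγ₁ : γ (ℓ w₁) = w₁)
    (hγℓ : ∀ᶠ u in 𝓝 (ℓ w₁), ℓ (γ u) = u) (hℓγ : ∀ᶠ w in 𝓝 w₁, periodEq p w = 0 → γ (ℓ w) = w)
    (hγH : ∀ᶠ u in 𝓝 (ℓ w₁), γ u ∈ H) (hθ : AnalyticAt ℂ θ (ℓ w₁)) (hθd : deriv θ (ℓ w₁) ≠ 0)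
    (hθc : ∀ᶠ u in 𝓝 (ℓ w₁), IsCritParam p (γ u) (θ u)) :
    HasLocalParam p H w₁ (θ (ℓ w₁)) := by
  obtain ⟨h, hha, hh1, hh2, hh3⟩ := exists_analytic_localInverse hθ hθd
  have hhc : Tendsto h (𝓝 (θ (ℓ w₁))) (𝓝 (ℓ w₁)) := by
    have := hha.continuousAt.tendsto
    rwa [hh1] at this
  refine ⟨fun t => γ (h t), fun w => θ (ℓ w), ?_, ?_, ?_, rfl, ?_, ?_⟩
  · exact AnalyticAt.comp (g := γ) (f := h) (by rwa [hh1]) hha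
  · simp only [hh1, hγ₁]
  · exact AnalyticAt.comp (g := θ) (f := ℓ) hθ (ℓ.analyticAt w₁)
  · filter_upwards [hhc.eventually hγH, hhc.eventually hθc, hhc.eventually hγℓ, hh2]
      with t h1 h2 h3 h4
    rw [h4] at h2
    exact ⟨h1, h2, by rw [h3, h4]⟩
  · filter_upwards [hℓγ, ℓ.continuous.continuousAt.eventually hh3] with w h1 h2 h3
    rw [h2, h1 (sub_eq_zero.2 (hH h3).1)]

end LocalStructure

section BottcherFamily

lemma exists_bottcher_family {O : Set ℂ} (hO : IsOpen O) {β q : ℕ → ℂ → ℂ}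
    (hq : ∀ k, DifferentiableOn ℂ (q k) O) (hq1 : ∀ k, ∀ u ∈ O, ‖q k u - 1‖ ≤ 1 / 2)
    (hqt : ∀ u ∈ O, Tendsto (fun k => q k u) atTop (𝓝 1))
    (hβ : ∀ k, ∀ u ∈ O, β (k + 1) u = β k u ^ 2 * q k u) :
    ∃ S : ℕ → ℂ → ℂ, (∀ k, DifferentiableOn ℂ (S k) O) ∧ (∀ k, ∀ u ∈ O, ‖S k u‖ ≤ 1) ∧
      ∀ u ∈ O, Tendsto (fun k => S k u) atTop (𝓝 0) ∧
        ∀ k, (β 0 u * Complex.exp (S 0 u)) ^ 2 ^ k = β k u * Complex.exp (S k u) := by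
  set L : ℕ → ℂ → ℂ := fun k u => Complex.log (q k u) with hL
  have hLd : ∀ k, DifferentiableOn ℂ (L k) O := fun k u hu =>
    (hq k u hu).clog (mem_slitPlane_of_norm_sub_one_le (hq1 k u hu))
  have hL1 : ∀ k, ∀ u ∈ O, ‖L k u‖ ≤ 1 := fun k u hu => norm_log_le_one (hq1 k u hu)
  refine ⟨fun n u => logSum 2 (fun k => L k u) n, differentiableOn_logSum hO le_rfl hLd hL1,
    fun n u hu => norm_logSum_le le_rfl n fun k => hL1 _ u hu, fun u hu => ⟨?_, ?_⟩⟩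
  · refine tendsto_logSum le_rfl ?_
    have h := (hqt u hu).clog Complex.one_mem_slitPlane
    rwa [Complex.log_one] at h
  · refine bottcher_pow (β := fun k => β k u) le_rfl (fun k => hL1 k u hu) fun k => ?_
    have h0 : q k u ≠ 0 :=
      Complex.slitPlane_ne_zero (mem_slitPlane_of_norm_sub_one_le (hq1 k u hu))
    simp only [hL, Complex.exp_log h0]
    exact hβ k u hu

lemma exists_param_of_family {O : Set ℂ} (hO : IsOpen O) {β q : ℕ → ℂ → ℂ}
    (hq : ∀ k, DifferentiableOn ℂ (q k) O) (hq1 : ∀ k, ∀ u ∈ O, ‖q k u - 1‖ ≤ 1 / 2)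
    (hqt : ∀ u ∈ O, Tendsto (fun k => q k u) atTop (𝓝 1))
    (hβ : ∀ k, ∀ u ∈ O, β (k + 1) u = β k u ^ 2 * q k u)
    (hβd : ∀ k, DifferentiableOn ℂ (β k) O) {u₁ t₁ : ℂ} (hu₁ : u₁ ∈ O) (ht₁ : t₁ ≠ 0) (M : ℕ)
    (htt : Tendsto (fun k => t₁ ^ 2 ^ (k + M) / β k u₁) atTop (𝓝 1))
    (hnd : ∀ C : ℝ, ∃ k, C * ‖β k u₁‖ < ‖deriv (β k) u₁‖) :
    ∃ θ : ℂ → ℂ, AnalyticAt ℂ θ u₁ ∧ θ u₁ = t₁ ∧ deriv θ u₁ ≠ 0 ∧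
      ∀ᶠ u in 𝓝 u₁, Tendsto (fun k => θ u ^ 2 ^ (k + M) / β k u) atTop (𝓝 1) := by
  obtain ⟨S, hSd, hS1, hS⟩ := exists_bottcher_family hO hq hq1 hqt hβ
  set Θ : ℂ → ℂ := fun u => β 0 u * Complex.exp (S 0 u) with hΘ
  have hΘd : DifferentiableOn ℂ Θ O := (hβd 0).mul (hSd 0).cexp
  have hO₁ : O ∈ 𝓝 u₁ := hO.mem_nhds hu₁
  have hΘa : AnalyticAt ℂ Θ u₁ := hΘd.analyticAt hO₁
  have hΘ0 : Θ u₁ ≠ 0 := by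
    intro h0
    obtain ⟨k, hk⟩ := (htt.eventually_ne one_ne_zero).exists
    have h1 := (hS u₁ hu₁).2 k
    rw [show β 0 u₁ * Complex.exp (S 0 u₁) = 0 from h0, zero_pow (by positivity)] at h1
    rcases mul_eq_zero.1 h1.symm with h2 | h2
    · rw [h2, div_zero] at hk
      exact hk rfl
    · exact Complex.exp_ne_zero _ h2
  have hΘ' : deriv Θ u₁ ≠ 0 := by
    intro h0
    obtain ⟨C, hC⟩ := deriv_bound_of_bounded hO hu₁ hSd hS1
    obtain ⟨k, hk⟩ := hnd C
    have hβk := ((hβd k).differentiableAt hO₁).hasDerivAt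
    have hSk := ((hSd k).differentiableAt hO₁).hasDerivAt
    have h1 : HasDerivAt (fun u => Θ u ^ 2 ^ k) 0 u₁ := by
      have h := hΘa.differentiableAt.hasDerivAt.pow (2 ^ k)
      rw [h0, mul_zero] at h
      exact h
    have h2 := hβk.mul hSk.cexp
    have h3 : HasDerivAt (fun u => Θ u ^ 2 ^ k) _ u₁ := h2.congr_of_eventuallyEq (by
      filter_upwards [hO₁] with u hu
      exact (hS u hu).2 k)
    have h4 := h3.unique h1
    have h5 : deriv (β k) u₁ = - (β k u₁ * deriv (S k) u₁) := by
      have : (deriv (β k) u₁ + β k u₁ * deriv (S k) u₁) * Complex.exp (S k u₁) = 0 := by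
        linear_combination h4
      exact eq_neg_of_add_eq_zero_left ((mul_eq_zero.1 this).resolve_right (Complex.exp_ne_zero _))
    rw [h5, norm_neg, norm_mul] at hk
    nlinarith [hC k, norm_nonneg (β k u₁)]
  set e : ℂ := (2 ^ M : ℂ) with he
  have he0 : e ≠ 0 := pow_ne_zero _ two_ne_zero
  have hr1 : AnalyticAt ℂ (fun u => Θ u / Θ u₁) u₁ := hΘa.div_const
  have hslit : Θ u₁ / Θ u₁ ∈ Complex.slitPlane := by
    rw [div_self hΘ0]; exact Complex.one_mem_slitPlane
  set θ : ℂ → ℂ := fun u => t₁ * Complex.exp (Complex.log (Θ u / Θ u₁) / e) with hθ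
  have hθa : AnalyticAt ℂ θ u₁ :=
    analyticAt_const.mul (((hr1.clog hslit).div_const).cexp)
  have hθ1 : θ u₁ = t₁ := by simp [hθ, div_self hΘ0]
  refine ⟨θ, hθa, hθ1, ?_, ?_⟩
  · have h1 := (hΘa.differentiableAt.hasDerivAt.div_const (Θ u₁)).clog hslit
    have h2 := ((h1.div_const e).cexp).const_mul t₁
    have h3 : deriv θ u₁ = _ := h2.deriv
    rw [h3]
    refine mul_ne_zero ht₁ (mul_ne_zero (Complex.exp_ne_zero _) (div_ne_zero (div_ne_zero
      (div_ne_zero hΘ' hΘ0) (Complex.slitPlane_ne_zero hslit)) he0))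
  · filter_upwards [hO₁, hΘa.continuousAt.eventually_ne hΘ0] with u hu hu0
    have hexp : ∀ v ∈ O, Tendsto (fun k => Complex.exp (S k v)) atTop (𝓝 1) := fun v hv => by
      have h := (hS v hv).1.cexp
      rwa [Complex.exp_zero] at h
    have hβne : ∀ v ∈ O, Θ v ≠ 0 → ∀ k, β k v ≠ 0 := by
      intro v hv h0 k h
      have h1 := (hS v hv).2 k
      rw [h, zero_mul] at h1
      exact pow_ne_zero _ h0 h1
    have h := (htt.div (hexp u₁ hu₁) one_ne_zero).mul (hexp u hu)
    rw [div_one, mul_one] at h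
    refine h.congr fun k => ?_
    have e1 : Θ u ^ 2 ^ k = β k u * Complex.exp (S k u) := (hS u hu).2 k
    have e2 : Θ u₁ ^ 2 ^ k = β k u₁ * Complex.exp (S k u₁) := (hS u₁ hu₁).2 k
    have e3 : θ u ^ 2 ^ (k + M) = t₁ ^ 2 ^ (k + M) * (Θ u ^ 2 ^ k / Θ u₁ ^ 2 ^ k) := by
      rw [hθ]
      simp only
      rw [mul_pow, ← Complex.exp_nat_mul, pow_add 2 k M]
      congr 1
      rw [← div_pow, show ((2 ^ k * 2 ^ M : ℕ) : ℂ) * (Complex.log (Θ u / Θ u₁) / e) =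
        ((2 ^ k : ℕ) : ℂ) * Complex.log (Θ u / Θ u₁) by
        push_cast; rw [← he]; field_simp,
        Complex.exp_nat_mul, Complex.exp_log (div_ne_zero hu0 hΘ0)]
    have b1 := hβne u hu hu0 k
    have b2 := hβne u₁ hu₁ hΘ0 k
    have b3 := Complex.exp_ne_zero (S k u₁)
    simp only [Pi.div_apply]
    rw [e3, e1, e2]
    field_simp

end BottcherFamily

section NonCentral

variable {p : ℕ} {H : Set (ℂ × ℂ)}

lemma exists_transverse_coordinate {L : ℂ × ℂ →L[ℂ] ℂ} (hL : ∃ v, L v ≠ 0) :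
    ∃ ℓ : ℂ × ℂ →L[ℂ] ℂ, ∀ v, L v = 0 → ℓ v = 0 → v = 0 := by
  have hLv : ∀ v : ℂ × ℂ, L v = v.1 * L (1, 0) + v.2 * L (0, 1) := by
    intro v
    have : v = v.1 • ((1 : ℂ), (0 : ℂ)) + v.2 • ((0 : ℂ), (1 : ℂ)) := by ext <;> simp
    conv_lhs => rw [this]
    rw [map_add, map_smul, map_smul, smul_eq_mul, smul_eq_mul]
  by_cases h : L (0, 1) = 0
  · refine ⟨.snd ℂ ℂ ℂ, fun v hv h2 => ?_⟩
    have h2' : v.2 = 0 := h2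
    obtain ⟨v₀, hv₀⟩ := hL
    rw [hLv, h, mul_zero, add_zero] at hv hv₀
    exact Prod.ext ((mul_eq_zero.1 hv).resolve_right (right_ne_zero_of_mul hv₀)) h2'
  · refine ⟨.fst ℂ ℂ ℂ, fun v hv h1 => ?_⟩
    have h1' : v.1 = 0 := h1
    rw [hLv, h1', zero_mul, zero_add] at hv
    exact Prod.ext h1' ((mul_eq_zero.1 hv).resolve_right h)

lemma hasDerivAt_critOrbit {γ : ℂ → ℂ × ℂ} {γ' : ℂ × ℂ} {u : ℂ} (hγ : HasDerivAt γ γ' u) (n : ℕ) :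
    HasDerivAt (fun v => critOrbit p (γ v) n)
      (critVar p (γ u).1 (γ u).2 γ'.1 γ'.2 n) u := by
  have h1 : HasDerivAt (fun v => (γ v).1) γ'.1 u :=
    (ContinuousLinearMap.fst ℂ ℂ ℂ).hasFDerivAt.comp_hasDerivAt u hγ
  have h2 : HasDerivAt (fun v => (γ v).2) γ'.2 u :=
    (ContinuousLinearMap.snd ℂ ℂ ℂ).hasFDerivAt.comp_hasDerivAt u hγ
  have h := (hasDerivAt_varOrbit h1 h2 h1.neg (n * p)).sub h1
  refine h.congr_of_eventuallyEq (Eventually.of_forall fun v => ?_)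
  simp only [critOrbit, ← iterate_mul, mul_comm p n]
  rfl

lemma IsCritParam.critOrbit_ne_zero (hp : 1 ≤ p) {w : ℂ × ℂ} {t : ℂ}
    (hper : (cubic w.1 w.2)^[p] w.1 = w.1) (h : IsCritParam p w t) (hc : w.1 ≠ 0) (n : ℕ) :
    critOrbit p w n ≠ 0 := by
  intro h0
  have hk : ∀ k, critOrbit p w (n + k) = 0 := by
    intro k
    induction k with
    | zero => exact h0
    | succ k ih => rw [← add_assoc, critOrbit_succ_eq hp hper, ih]; simp
  rcases h with ⟨h1, -⟩ | ⟨-, h1⟩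
  · exact hc h1
  obtain ⟨N, hN⟩ := eventually_atTop.1 (h1.eventually_ne one_ne_zero)
  have := hN (n + N) (by omega)
  rw [hk N, mul_zero, div_zero] at this
  exact this rfl

theorem hasLocalParam_of_ne (hp : 1 ≤ p) (hH : IsHyperbolicComponent p H) {w₁ : ℂ × ℂ} {t₁ : ℂ}
    (hw₁ : w₁ ∈ H) (ht : Tendsto (critOrbit p w₁) atTop (𝓝 0)) (hc : w₁.1 ≠ 0)
    (h : IsCritParam p w₁ t₁) : HasLocalParam p H w₁ t₁ := by
  have hHS : H ⊆ Sp p := fun w hw => (hH.subset hw).1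
  have hwS : (w₁.1, w₁.2) ∈ Sp p := hHS hw₁
  have hnz := h.critOrbit_ne_zero hp hwS.1 hc
  have hla₁ : retFactor p w₁.1 w₁.2 0 ≠ 0 := retFactor_zero_ne_zero hp hwS hc ht
  obtain ⟨c', a', hv₀⟩ := exists_varOrbit_ne hp hc hwS ht hnz
  obtain ⟨ℓ, hℓ⟩ := exists_transverse_coordinate (L := fderiv ℂ (periodEq p) w₁)
    ⟨(c', a'), by rw [fderiv_periodEq]; exact sub_ne_zero.2 hv₀⟩
  obtain ⟨γ, hγa, hγ₁, hγF, hγℓ⟩ := exists_curve (analyticAt_periodEq w₁) ℓ hℓ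
    (sub_eq_zero.2 hwS.1)
  set u₁ := ℓ w₁ with hu₁
  have hγH := eventually_curve_mem hp hH hw₁ ht hγa hγ₁ (hγF.mono fun u hu => hu.1)
  have hQc : Continuous fun x : (ℂ × ℂ) × ℂ => retFactor p x.1.1 x.1.2 x.2 :=
    ((contDiff_retFactor (n := 0) p).continuous).comp
      (show Continuous fun x : (ℂ × ℂ) × ℂ => (x.1.1, x.1.2, x.2) by fun_prop)
  have hQ0 : Continuous fun x : (ℂ × ℂ) × ℂ => retFactor p x.1.1 x.1.2 0 :=
    ((contDiff_retFactor (n := 0) p).continuous).comp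
      (show Continuous fun x : (ℂ × ℂ) × ℂ => (x.1.1, x.1.2, (0 : ℂ)) by fun_prop)
  have hR : ∀ᶠ x in 𝓝 (w₁, (0 : ℂ)),
      ‖retFactor p x.1.1 x.1.2 x.2 / retFactor p x.1.1 x.1.2 0 - 1‖ < 1 / 2 := by
    have h1 := (((hQc.continuousAt (x := (w₁, (0 : ℂ)))).div hQ0.continuousAt hla₁).sub
      (continuousAt_const (y := (1 : ℂ)))).norm
    refine h1.eventually_lt_const ?_
    simp [div_self hla₁]
  obtain ⟨ε, hε, N, htrap⟩ := exists_uniform_trap (R := fun w s =>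
    ‖retFactor p w.1 w.2 s / retFactor p w.1 w.2 0 - 1‖ < 1 / 2) ht hR
  have hla0 : ∀ᶠ w in 𝓝 w₁, retFactor p w.1 w.2 0 ≠ 0 := by
    have : Continuous fun w : ℂ × ℂ => retFactor p w.1 w.2 0 :=
      hQ0.comp (show Continuous fun w : ℂ × ℂ => (w, (0 : ℂ)) by fun_prop)
    exact this.continuousAt.eventually_ne hla₁
  have hγc := hγa.continuousAt
  rw [← hγ₁] at htrap hla0
  obtain ⟨δ, hδ, hball⟩ := Metric.eventually_nhds_iff_ball.1
    ((hγc.eventually htrap).and ((hγc.eventually hla0).and (hγH.and hγa.eventually_analyticAt)))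
  have hper : ∀ u ∈ ball u₁ δ, (cubic (γ u).1 (γ u).2)^[p] (γ u).1 = (γ u).1 := fun u hu =>
    (hHS (hball u hu).2.2.1).1
  have hγd : ∀ u ∈ ball u₁ δ, DifferentiableAt ℂ γ u := fun u hu =>
    (hball u hu).2.2.2.differentiableAt
  set la : ℂ → ℂ := fun u => retFactor p (γ u).1 (γ u).2 0 with hla
  set sg : ℕ → ℂ → ℂ := fun k u => critOrbit p (γ u) (N + k) with hsg
  have hsgd : ∀ k, DifferentiableOn ℂ (sg k) (ball u₁ δ) := fun k u hu =>
    (hasDerivAt_critOrbit (hγd u hu).hasDerivAt (N + k)).differentiableAt.differentiableWithinAt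
  have hQd : Differentiable ℂ (fun x : ℂ × ℂ × ℂ => retFactor p x.1 x.2.1 x.2.2) :=
    (contDiff_retFactor (n := 1) p).differentiable (by simp)
  have hret : ∀ s : ℂ → ℂ, DifferentiableOn ℂ s (ball u₁ δ) →
      DifferentiableOn ℂ (fun u => retFactor p (γ u).1 (γ u).2 (s u)) (ball u₁ δ) := by
    intro s hs u hu
    have h1 : DifferentiableWithinAt ℂ (fun u => ((γ u).1, (γ u).2, s u)) (ball u₁ δ) u :=
      (hγd u hu).fst.differentiableWithinAt.prodMk
        ((hγd u hu).snd.differentiableWithinAt.prodMk (hs u hu))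
    exact (hQd.differentiableAt (x := ((γ u).1, (γ u).2, s u))).comp_differentiableWithinAt u h1
  have hlad : DifferentiableOn ℂ la (ball u₁ δ) := hret (fun _ => 0) (differentiableOn_const 0)
  have hlan : ∀ u ∈ ball u₁ δ, la u ≠ 0 := fun u hu => (hball u hu).2.1
  have hsgε : ∀ k, ∀ u ∈ ball u₁ δ, ‖sg k u‖ < ε := fun k u hu =>
    norm_critOrbit_lt_trap hp (hper u hu) (fun s hs => ((hball u hu).1.1 s hs).1)
      (hball u hu).1.2 k
  have hsg0 : ∀ u ∈ ball u₁ δ, Tendsto (fun k => sg k u) atTop (𝓝 0) := fun u hu => by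
    have h1 := tendsto_critOrbit_of_trap hp (hper u hu)
      (fun s hs => ((hball u hu).1.1 s hs).1) (hball u hu).1.2
    have h2 := (tendsto_add_atTop_iff_nat N).2 h1
    exact h2.congr fun k => by rw [hsg, add_comm]
  have hu₁b : u₁ ∈ ball u₁ δ := mem_ball_self hδ
  have hγd₁ := (hγd u₁ hu₁b).hasDerivAt
  set γ' := deriv γ u₁ with hγ'
  obtain ⟨θ, hθa, hθ₁, hθd, hθt⟩ := exists_param_of_family (O := ball u₁ δ) isOpen_ball
    (β := fun k u => la u * sg k u)
    (q := fun k u => retFactor p (γ u).1 (γ u).2 (sg k u) / la u)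
    (fun k => (hret _ (hsgd k)).div hlad hlan)
    (fun k u hu => ((hball u hu).1.1 _ (hsgε k u hu)).2.le)
    (fun u hu => by
      have hq : Continuous fun s => retFactor p (γ u).1 (γ u).2 s :=
        hQc.comp (show Continuous fun s : ℂ => (γ u, s) by fun_prop)
      have h1 := ((hq.tendsto 0).comp (hsg0 u hu)).div_const (la u)
      rwa [div_self (hlan u hu)] at h1)
    (fun k u hu => by
      have h1 : sg (k + 1) u = sg k u ^ 2 * retFactor p (γ u).1 (γ u).2 (sg k u) :=
        critOrbit_succ_eq hp (hper u hu) (N + k)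
      have h2 := hlan u hu
      simp only [h1]
      field_simp)
    (fun k => hlad.mul (hsgd k)) hu₁b (h.ne_zero hc) (N + 1)
    (by
      rcases h with ⟨h0, -⟩ | ⟨-, h1⟩
      · exact absurd h0 hc
      have h2 := (tendsto_add_atTop_iff_nat N).2 h1
      refine h2.congr fun k => ?_
      simp only [hla, hsg, hγ₁, add_comm N k, ← add_assoc])
    (by
      by_contra! hcon
      obtain ⟨C, hC⟩ := hcon
      have hla' := (hlad.differentiableAt (ball_mem_nhds u₁ hδ)).hasDerivAt
      have hzero : γ'.1 = 0 ∧ γ'.2 = 0 := by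
        refine eq_zero_of_bounded_critVar hp hc hwS ht hnz ?_
          (M := (C * ‖la u₁‖ + ‖deriv la u₁‖) / ‖la u₁‖) ?_
        · have h1 := hasDerivAt_periodEq (p := p) hγd₁
          have h2 : HasDerivAt (fun v => periodEq p (γ v)) 0 u₁ :=
            (hasDerivAt_const u₁ (0 : ℂ)).congr_of_eventuallyEq (hγF.mono fun u hu => hu.1)
          have h3 := h1.unique h2
          rw [hγ₁] at h3
          exact sub_eq_zero.1 h3
        · filter_upwards [eventually_ge_atTop N] with n hn
          obtain ⟨k, rfl⟩ := Nat.exists_eq_add_of_le hn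
          have h1 : HasDerivAt (sg k) (critVar p w₁.1 w₁.2 γ'.1 γ'.2 (N + k)) u₁ := by
            have := hasDerivAt_critOrbit (p := p) hγd₁ (N + k)
            rwa [hγ₁] at this
          have h2 := hC k
          have h4 : deriv (fun u => la u * sg k u) u₁ = _ := (hla'.mul h1).deriv
          rw [h4, norm_mul] at h2
          have hsk : sg k u₁ = critOrbit p (w₁.1, w₁.2) (N + k) := by simp only [hsg, hγ₁]
          rw [hsk] at h2
          have hlp : 0 < ‖la u₁‖ := norm_pos_iff.2 (hlan u₁ hu₁b)
          rw [div_mul_eq_mul_div, le_div_iff₀ hlp]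
          have h3 := norm_sub_le (deriv la u₁ * critOrbit p (w₁.1, w₁.2) (N + k) +
            la u₁ * critVar p w₁.1 w₁.2 γ'.1 γ'.2 (N + k))
            (deriv la u₁ * critOrbit p (w₁.1, w₁.2) (N + k))
          rw [add_sub_cancel_left, norm_mul, norm_mul] at h3
          nlinarith
      have h1 : HasDerivAt (fun u => ℓ (γ u)) (ℓ γ') u₁ := ℓ.hasFDerivAt.comp_hasDerivAt u₁ hγd₁
      have h2 : HasDerivAt (fun u => ℓ (γ u)) 1 u₁ :=
        (hasDerivAt_id u₁).congr_of_eventuallyEq (hγF.mono fun u hu => hu.2)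
      have h3 := h1.unique h2
      rw [show γ' = 0 from Prod.ext hzero.1 hzero.2, map_zero] at h3
      exact zero_ne_one h3)
  have := hasLocalParam_of_curve hHS ℓ hγa hγ₁ (hγF.mono fun u hu => hu.2) hγℓ hγH hθa hθd ?_
  · rwa [hθ₁] at this
  have hc1 : (γ u₁).1 ≠ 0 := by rwa [hγ₁]
  filter_upwards [hθt, (hγc.fst).eventually_ne hc1] with u hu huc
  refine Or.inr ⟨huc, ?_⟩
  rw [← tendsto_add_atTop_iff_nat N]
  refine hu.congr fun k => ?_
  simp only [hla, hsg, add_comm N k, ← add_assoc]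

end NonCentral

section Central

variable {p : ℕ} {H : Set (ℂ × ℂ)}

/-- Gleason's argument: the centre equation of `z ^ 3 + a` has simple roots. -/
lemma varOrbit_central_ne_zero (hp : 1 ≤ p) {a : ℂ} (hper : (cubic 0 a)^[p] 0 = 0) :
    varOrbit 0 a 0 1 0 0 p ≠ 0 := by
  have hpoly : ∀ n, ∃ G : Polynomial ℤ, G.Monic ∧ G.natDegree = 3 ^ n ∧
      G.aeval a = (cubic 0 a)^[n + 1] 0 := by
    intro n
    induction n with
    | zero => exact ⟨.X, Polynomial.monic_X, by simp, by simp [cubic]⟩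
    | succ n ih =>
      obtain ⟨G, hG, hdeg, hGa⟩ := ih
      have hd3 : (G ^ 3).natDegree = 3 ^ (n + 1) := by rw [hG.natDegree_pow, hdeg]; ring
      have h3 : 1 < 3 ^ (n + 1) := Nat.one_lt_pow (by omega) (by norm_num)
      have hlt : (Polynomial.X : Polynomial ℤ).natDegree < (G ^ 3).natDegree := by
        rw [hd3, Polynomial.natDegree_X]; exact h3
      refine ⟨G ^ 3 + .X, (hG.pow 3).add_of_left (Polynomial.degree_lt_degree hlt), ?_, ?_⟩
      · rw [Polynomial.natDegree_add_eq_left_of_natDegree_lt hlt, hd3]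
      · rw [iterate_succ_apply', ← hGa]
        simp [cubic]
  have ha : IsIntegral ℤ a := by
    obtain ⟨G, hG, -, hGa⟩ := hpoly (p - 1)
    refine ⟨G, hG, ?_⟩
    rw [← Polynomial.aeval_def, hGa, Nat.sub_add_cancel hp, hper]
  have hx : ∀ n, IsIntegral ℤ ((cubic 0 a)^[n] 0) := by
    intro n
    induction n with
    | zero => exact isIntegral_zero
    | succ n ih =>
      rw [iterate_succ_apply']
      simpa [cubic] using (ih.pow 3).add ha
  have hA : ∀ n, IsIntegral ℤ (varOrbit 0 a 0 1 0 0 n) := by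
    intro n
    induction n with
    | zero => exact isIntegral_zero
    | succ n ih =>
      rw [varOrbit]
      have h3 : IsIntegral ℤ (3 : ℂ) := isIntegral_algebraMap (R := ℤ) (x := 3)
      have h := ((h3.mul ((hx n).pow 2)).mul ih).add (isIntegral_one (R := ℤ) (B := ℂ))
      simpa using h
  intro h0
  obtain ⟨n, rfl⟩ : ∃ n, p = n + 1 := ⟨p - 1, by omega⟩
  rw [varOrbit] at h0
  have h1 : ((cubic 0 a)^[n] 0) ^ 2 * varOrbit 0 a 0 1 0 0 n = algebraMap ℚ ℂ (-1 / 3) := by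
    simp at h0 ⊢
    linear_combination h0 / 3
  have h2 : IsIntegral ℤ (algebraMap ℚ ℂ (-1 / 3)) := h1 ▸ ((hx n).pow 2).mul (hA n)
  rw [isIntegral_algebraMap_iff (algebraMap ℚ ℂ).injective] at h2
  obtain ⟨y, hy⟩ := IsIntegrallyClosed.isIntegral_iff.1 h2
  have h3 : ((3 * y : ℤ) : ℚ) = ((-1 : ℤ) : ℚ) := by
    push_cast
    have : (y : ℚ) = -1 / 3 := hy
    rw [this]; norm_num
  have h4 : 3 * y = -1 := by exact_mod_cast h3
  omega

/-- An analytic fourth root. -/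
lemma exists_analytic_fourth_root {E : ℂ → ℂ} {u : ℂ} (hE : AnalyticAt ℂ E u) (h0 : E u ≠ 0) :
    ∃ r : ℂ → ℂ, AnalyticAt ℂ r u ∧ r u ≠ 0 ∧ ∀ᶠ v in 𝓝 u, r v ^ 4 = E v := by
  obtain ⟨ρ, hρ⟩ := IsAlgClosed.exists_pow_nat_eq (E u) (n := 4) (by norm_num)
  have hρ0 : ρ ≠ 0 := by
    rintro rfl
    exact h0 (by rw [← hρ]; simp)
  have hslit : E u / E u ∈ Complex.slitPlane := by
    rw [div_self h0]; exact Complex.one_mem_slitPlane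
  refine ⟨fun v => ρ * Complex.exp (Complex.log (E v / E u) / 4), ?_, ?_, ?_⟩
  · exact analyticAt_const.mul (((hE.div_const (c := E u)).clog hslit).div_const (c := 4)).cexp
  · exact mul_ne_zero hρ0 (Complex.exp_ne_zero _)
  · filter_upwards [hE.continuousAt.eventually_ne h0] with v hv
    rw [mul_pow, hρ, ← Complex.exp_nat_mul, show ((4 : ℕ) : ℂ) * (Complex.log (E v / E u) / 4) =
      Complex.log (E v / E u) by push_cast; ring, Complex.exp_log (div_ne_zero hv h0)]
    field_simp

theorem hasLocalParam_zero (hp : 1 ≤ p) (hH : IsHyperbolicComponent p H) {w₁ : ℂ × ℂ}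
    (hw₁ : w₁ ∈ H) (ht : Tendsto (critOrbit p w₁) atTop (𝓝 0)) (hc : w₁.1 = 0) :
    HasLocalParam p H w₁ 0 := by
  have hHS : H ⊆ Sp p := fun w hw => (hH.subset hw).1
  have hwS : w₁ ∈ Sp p := hHS hw₁
  have hper₁ : (cubic 0 w₁.2)^[p] 0 = 0 := by
    have := hwS.1
    rwa [hc] at this
  set ℓ : ℂ × ℂ →L[ℂ] ℂ := .fst ℂ ℂ ℂ with hℓ
  have hℓw : ℓ w₁ = 0 := hc
  obtain ⟨γ, hγa, hγ₁, hγF, hγℓ⟩ := exists_curve (analyticAt_periodEq w₁) ℓ (fun v hv hv1 => by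
    have hv1' : v.1 = 0 := hv1
    rw [fderiv_periodEq, hc, hv1', sub_zero] at hv
    have h1 := varOrbit_linear (c := 0) (a := w₁.2) v.2 0 0 1 0 0 0 0 0 p
    simp only [mul_zero, zero_mul, add_zero, mul_one] at h1
    rw [h1] at hv
    exact Prod.ext hv1' ((mul_eq_zero.1 hv).resolve_right (varOrbit_central_ne_zero hp hper₁)))
    (sub_eq_zero.2 hwS.1)
  have hγH := eventually_curve_mem hp hH hw₁ ht hγa hγ₁ (hγF.mono fun u hu => hu.1)
  have hγa0 := hγa
  have hγ0 := hγ₁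
  have hγF0 := hγF
  have hγH0 := hγH
  rw [hℓw] at hγa0 hγ0 hγF0 hγH0
  set P : ℂ → ℂ → ℂ := fun u s => critFactor (γ u).1 (γ u).2 s (p - 1) with hP
  have hP0 : P 0 0 ≠ 0 := by
    rw [hP]
    simp only
    rw [critFactor_zero_eq, hγ0, Finset.prod_ne_zero_iff]
    intro k hk
    have hk' := Finset.mem_range.1 hk
    rw [hc]
    have h1 := hwS.2 (k + 1) (by omega) (by omega)
    rw [hc] at h1
    simpa using h1
  have hPjc : Continuous fun x : ℂ × ℂ × ℂ => critFactor x.1 x.2.1 x.2.2 (p - 1) :=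
    (contDiff_critFactor (n := 0) (p - 1)).continuous
  have hPjd : Differentiable ℂ fun x : ℂ × ℂ × ℂ => critFactor x.1 x.2.1 x.2.2 (p - 1) :=
    (contDiff_critFactor (n := 1) (p - 1)).differentiable (by simp)
  have hPc : ∀ s : ℂ × ℂ → ℂ, ContinuousAt s (0, 0) →
      ContinuousAt (fun x : ℂ × ℂ => P x.1 (s x)) (0, 0) := by
    intro s hs
    have hγx : ContinuousAt (fun x : ℂ × ℂ => γ x.1) (0, 0) :=
      ContinuousAt.comp (g := γ) (f := Prod.fst) hγa0.continuousAt continuousAt_fst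
    exact ContinuousAt.comp (f := fun x : ℂ × ℂ => ((γ x.1).1, (γ x.1).2, s x))
      hPjc.continuousAt (hγx.fst.prodMk (hγx.snd.prodMk hs))
  have hq₀ : ∀ᶠ x in 𝓝 ((0 : ℂ), (0 : ℂ)),
      ‖(1 + x.2 / 3) * P x.1 (x.1 * x.2) / P x.1 0 - 1‖ < 1 / 2 := by
    have h1 : ContinuousAt (fun x : ℂ × ℂ => (1 + x.2 / 3) * P x.1 (x.1 * x.2) / P x.1 0 - 1)
        (0, 0) :=
      (((by fun_prop : ContinuousAt (fun x : ℂ × ℂ => 1 + x.2 / 3) (0, 0)).mul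
        (hPc (fun x => x.1 * x.2) (by fun_prop))).div (hPc (fun _ => 0) (by fun_prop)) hP0).sub
        continuousAt_const
    refine h1.norm.eventually_lt_const ?_
    simp [div_self hP0]
  have hd₀ : ∀ᶠ x in 𝓝 ((0 : ℂ), (0 : ℂ)),
      ‖x.1 ^ 2 * x.2 * (x.2 + 3) * P x.1 (x.1 * x.2)‖ < 1 / 2 := by
    have h1 : ContinuousAt (fun x : ℂ × ℂ => x.1 ^ 2 * x.2 * (x.2 + 3) * P x.1 (x.1 * x.2))
        (0, 0) :=
      (by fun_prop : ContinuousAt (fun x : ℂ × ℂ => x.1 ^ 2 * x.2 * (x.2 + 3)) (0, 0)).mul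
        (hPc (fun x => x.1 * x.2) (by fun_prop))
    refine h1.norm.eventually_lt_const ?_
    simp
  obtain ⟨η, hη, hηb⟩ := Metric.eventually_nhds_iff.1 (hq₀.and hd₀)
  set σ : ℕ → ℂ → ℂ := fun n u => Nat.rec (4 * u ^ 2 * P u (-2 * u))
    (fun _ s => u ^ 2 * s ^ 2 * (s + 3) * P u (u * s)) n with hσ
  have hσ0 : ∀ u, σ 0 u = 4 * u ^ 2 * P u (-2 * u) := fun u => rfl
  have hσs : ∀ n u, σ (n + 1) u = u ^ 2 * σ n u ^ 2 * (σ n u + 3) * P u (u * σ n u) :=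
    fun n u => rfl
  have hPu : ∀ s : ℂ → ℂ, ContinuousAt s 0 → ContinuousAt (fun u => P u (s u)) 0 := fun s hs =>
    ContinuousAt.comp (f := fun u => ((γ u).1, (γ u).2, s u)) hPjc.continuousAt
      (hγa0.continuousAt.fst.prodMk (hγa0.continuousAt.snd.prodMk hs))
  have hσ0s : ∀ᶠ u in 𝓝 (0 : ℂ), ‖σ 0 u‖ < η := by
    have h1 : ContinuousAt (fun u => σ 0 u) 0 :=
      (by fun_prop : ContinuousAt (fun u : ℂ => 4 * u ^ 2) 0).mul
        (hPu (fun u => -2 * u) (by fun_prop))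
    refine h1.norm.eventually_lt_const ?_
    simpa [hσ0] using hη
  have hP0u : ∀ᶠ u in 𝓝 (0 : ℂ), P u 0 ≠ 0 := (hPu (fun _ => 0) (by fun_prop)).eventually_ne hP0
  have hball0 : ∀ᶠ u in 𝓝 (0 : ℂ), ‖u‖ < η := by
    filter_upwards [ball_mem_nhds (0 : ℂ) hη] with u hu
    simpa using hu
  obtain ⟨δ, hδ, hball⟩ := Metric.eventually_nhds_iff_ball.1
    (hσ0s.and (hP0u.and (hball0.and (hγH0.and (hγF0.and hγa0.eventually_analyticAt)))))
  have hγd : ∀ u ∈ ball (0 : ℂ) δ, DifferentiableAt ℂ γ u := fun u hu =>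
    (hball u hu).2.2.2.2.2.differentiableAt
  have hγfst : ∀ u ∈ ball (0 : ℂ) δ, (γ u).1 = u := fun u hu => (hball u hu).2.2.2.2.1.2
  have hest : ∀ u ∈ ball (0 : ℂ) δ, ∀ s : ℂ, ‖s‖ < η →
      ‖(1 + s / 3) * P u (u * s) / P u 0 - 1‖ < 1 / 2 ∧
      ‖u ^ 2 * s * (s + 3) * P u (u * s)‖ < 1 / 2 := fun u hu s hs =>
    hηb (y := (u, s)) (by
      rw [Prod.dist_eq, dist_zero_right, dist_zero_right]
      exact max_lt (hball u hu).2.2.1 hs)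
  have hσb : ∀ u ∈ ball (0 : ℂ) δ, ∀ k, ‖σ k u‖ ≤ ‖σ 0 u‖ * (1 / 2) ^ k := by
    intro u hu k
    induction k with
    | zero => simp
    | succ k ih =>
      have h1 : ‖σ k u‖ < η := by
        refine lt_of_le_of_lt (ih.trans ?_) (hball u hu).1
        exact mul_le_of_le_one_right (norm_nonneg _) (pow_le_one₀ (by norm_num) (by norm_num))
      have h2 := (hest u hu _ h1).2
      rw [hσs, show u ^ 2 * σ k u ^ 2 * (σ k u + 3) * P u (u * σ k u) =
        σ k u * (u ^ 2 * σ k u * (σ k u + 3) * P u (u * σ k u)) by ring, norm_mul,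
        pow_succ (1 / 2 : ℝ)]
      nlinarith [norm_nonneg (σ k u)]
  have hση : ∀ u ∈ ball (0 : ℂ) δ, ∀ k, ‖σ k u‖ < η := fun u hu k =>
    lt_of_le_of_lt ((hσb u hu k).trans (mul_le_of_le_one_right (norm_nonneg _)
      (pow_le_one₀ (by norm_num) (by norm_num)))) (hball u hu).1
  have hσt : ∀ u ∈ ball (0 : ℂ) δ, Tendsto (fun k => σ k u) atTop (𝓝 0) := fun u hu => by
    refine squeeze_zero_norm (hσb u hu) ?_
    simpa using (tendsto_pow_atTop_nhds_zero_of_lt_one (r := (1 / 2 : ℝ)) (by norm_num)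
      (by norm_num)).const_mul ‖σ 0 u‖
  have hPd : ∀ s : ℂ → ℂ, DifferentiableOn ℂ s (ball 0 δ) →
      DifferentiableOn ℂ (fun u => P u (s u)) (ball 0 δ) := by
    intro s hs u hu
    have h1 : DifferentiableWithinAt ℂ (fun u => ((γ u).1, (γ u).2, s u)) (ball 0 δ) u :=
      (hγd u hu).fst.differentiableWithinAt.prodMk
        ((hγd u hu).snd.differentiableWithinAt.prodMk (hs u hu))
    exact (hPjd.differentiableAt (x := ((γ u).1, (γ u).2, s u))).comp_differentiableWithinAt u h1
  have hσd : ∀ k, DifferentiableOn ℂ (σ k) (ball 0 δ) := by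
    intro k
    induction k with
    | zero =>
      exact (by fun_prop : DifferentiableOn ℂ (fun u : ℂ => 4 * u ^ 2) (ball 0 δ)).mul
        (hPd (fun u => -2 * u) (by fun_prop))
    | succ k ih =>
      have h1 := hPd (fun u => u * σ k u) (differentiableOn_id.mul ih)
      have h2 : DifferentiableOn ℂ (fun u => u ^ 2 * σ k u ^ 2 * (σ k u + 3)) (ball 0 δ) := by
        fun_prop
      exact h2.mul h1
  set β : ℕ → ℂ → ℂ := fun k u => 3 * u * P u 0 * (u * σ k u) with hβ
  set q : ℕ → ℂ → ℂ := fun k u => (1 + σ k u / 3) * P u (u * σ k u) / P u 0 with hq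
  obtain ⟨S, hSd, hS1, hS⟩ := exists_bottcher_family (O := ball 0 δ) isOpen_ball (β := β) (q := q)
    (fun k => by
      have h1 := hPd (fun u => u * σ k u) (differentiableOn_id.mul (hσd k))
      have h2 : DifferentiableOn ℂ (fun u => 1 + σ k u / 3) (ball 0 δ) := by
        have := hσd k
        fun_prop
      exact (h2.mul h1).div (hPd (fun _ => 0) (by fun_prop)) fun u hu => (hball u hu).2.1)
    (fun k u hu => (hest u hu _ (hση u hu k)).1.le)
    (fun u hu => by
      have h1 : Continuous fun s : ℂ => (1 + s / 3) * P u (u * s) / P u 0 := by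
        have h2 : Continuous fun s : ℂ => P u (u * s) :=
          hPjc.comp (show Continuous fun s : ℂ => ((γ u).1, (γ u).2, u * s) by fun_prop)
        fun_prop
      have h2 := (h1.tendsto 0).comp (hσt u hu)
      have h3 : (1 + (0 : ℂ) / 3) * P u (u * 0) / P u 0 = 1 := by
        simp [div_self (hball u hu).2.1]
      simp only [h3] at h2
      exact h2)
    (fun k u hu => by
      have h1 := (hball u hu).2.1
      simp only [hβ, hq, hσs]
      field_simp
      ring)
  have hcrit : ∀ u ∈ ball (0 : ℂ) δ, ∀ k,
      retFactor p (γ u).1 (γ u).2 0 * critOrbit p (γ u) (k + 1) = β k u := by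
    intro u hu k
    have hperu : (cubic (γ u).1 (γ u).2)^[p] (γ u).1 = (γ u).1 :=
      (hHS (hball u hu).2.2.2.1).1
    have hsg : critOrbit p (γ u) (k + 1) = u * σ k u := by
      induction k with
      | zero =>
        have h0 : critOrbit p (γ u) 0 = -2 * u := by
          simp only [critOrbit, iterate_zero, id, hγfst u hu]; ring
        rw [critOrbit_succ_eq hp hperu, h0, hσ0, retFactor, hγfst u hu]
        simp only [hP, hγfst u hu]
        ring
      | succ k ih =>
        rw [critOrbit_succ_eq hp hperu, ih, hσs, retFactor, hγfst u hu]
        simp only [hP, hγfst u hu]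
        ring
    rw [hsg, retFactor, hγfst u hu]
    simp only [hβ, hP, hγfst u hu]
    ring
  set E : ℂ → ℂ := fun u => 12 * P u 0 * P u (-2 * u) * Complex.exp (S 0 u) with hE
  have hEd : DifferentiableOn ℂ E (ball 0 δ) :=
    ((((hPd (fun _ => 0) (by fun_prop)).const_mul 12)).mul
      (hPd (fun u => -2 * u) (by fun_prop))).mul (hSd 0).cexp
  have hE0 : E 0 ≠ 0 := by
    have h1 : P 0 (-2 * 0) = P 0 0 := by simp
    simp only [hE, h1]
    exact mul_ne_zero (mul_ne_zero (mul_ne_zero (by norm_num) hP0) hP0) (Complex.exp_ne_zero _)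
  have hEa : AnalyticAt ℂ E 0 := hEd.analyticAt (ball_mem_nhds 0 hδ)
  obtain ⟨r, hra, hr0, hr4⟩ := exists_analytic_fourth_root hEa hE0
  set θ : ℂ → ℂ := fun u => u * r u with hθ
  have hθa : AnalyticAt ℂ θ (ℓ w₁) := by
    rw [hℓw]; exact analyticAt_id.mul hra
  have hθd : deriv θ (ℓ w₁) ≠ 0 := by
    have h1 : HasDerivAt θ (1 * r 0 + 0 * deriv r 0) 0 :=
      (hasDerivAt_id (0 : ℂ)).mul hra.differentiableAt.hasDerivAt
    rw [hℓw, h1.deriv]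
    simpa using hr0
  have := hasLocalParam_of_curve hHS ℓ hγa hγ₁ (hγF.mono fun u hu => hu.2) hγℓ hγH hθa hθd ?_
  · simpa [hℓw, hθ] using this
  rw [hℓw]
  filter_upwards [ball_mem_nhds 0 hδ, hr4, hEa.continuousAt.eventually_ne hE0] with u hu hru hEu
  by_cases hu0 : u = 0
  · subst hu0
    exact Or.inl ⟨hγfst 0 hu, by simp [hθ]⟩
  refine Or.inr ⟨by rwa [hγfst u hu], ?_⟩
  rw [← tendsto_add_atTop_iff_nat 1]
  have h1 := (hS u hu).1.cexp
  rw [Complex.exp_zero] at h1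
  refine h1.congr fun k => ?_
  rw [hcrit u hu k]
  have h2 := (hS u hu).2 k
  have h3 : β 0 u * Complex.exp (S 0 u) = θ u ^ 4 := by
    simp only [hθ, mul_pow, hru, hE, hβ, hσ0]
    ring
  have h4 : θ u ^ 4 ≠ 0 := by
    rw [hθ]
    simp only
    rw [mul_pow, hru]
    exact mul_ne_zero (pow_ne_zero _ hu0) hEu
  rw [h3] at h2
  have h5 : β k u ≠ 0 := by
    intro h
    rw [h, zero_mul] at h2
    exact pow_ne_zero _ h4 h2
  rw [show 2 ^ (k + 1 + 1) = 4 * 2 ^ k by ring, pow_mul, h2]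
  field_simp

end Central

section Uniformization

variable {E : Type*} [NormedAddCommGroup E] [NormedSpace ℂ E]

/-- `t` is a local parameter of the set `H` at `w₁`, compatible with the relation `R`. -/
def IsLocalParam (R : E → ℂ → Prop) (H : Set E) (w₁ : E) (t₁ : ℂ) : Prop :=
  ∃ (ω : ℂ → E) (T : E → ℂ), AnalyticAt ℂ ω t₁ ∧ ω t₁ = w₁ ∧ AnalyticAt ℂ T w₁ ∧
    T w₁ = t₁ ∧ (∀ᶠ t in 𝓝 t₁, ω t ∈ H ∧ R (ω t) t ∧ T (ω t) = t) ∧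
    ∀ᶠ w in 𝓝 w₁, w ∈ H → ω (T w) = w

/-- A local parameter is inverse to every local section of the relation, away from the centre. -/
lemma exists_inverse_of_section {R : E → ℂ → Prop} {H : Set E}
    (hnorm : ∀ w t t', R w t → R w t' → ‖t'‖ = ‖t‖) {f : ℂ → E} {t₁ : ℂ} (ht₁ : t₁ ≠ 0)
    (hf : AnalyticAt ℂ f t₁) (hfR : ∀ᶠ t in 𝓝 t₁, f t ∈ H ∧ R (f t) t) {ω : ℂ → E} {T : E → ℂ}
    (hT : AnalyticAt ℂ T (f t₁)) (hT₁ : T (f t₁) = t₁)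
    (hω : ∀ᶠ t in 𝓝 t₁, ω t ∈ H ∧ R (ω t) t ∧ T (ω t) = t)
    (hωT : ∀ᶠ w in 𝓝 (f t₁), w ∈ H → ω (T w) = w) :
    ∀ᶠ t in 𝓝 t₁, T (f t) = t ∧ f t = ω t := by
  have hTf : AnalyticAt ℂ (fun t => T (f t)) t₁ := AnalyticAt.comp (g := T) (f := f) hT hf
  have hq : AnalyticAt ℂ (fun t => T (f t) / t) t₁ := hTf.div analyticAt_id ht₁
  have hTc : Tendsto (fun t => T (f t)) (𝓝 t₁) (𝓝 t₁) := by
    have h := hTf.continuousAt.tendsto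
    simp only [hT₁] at h
    exact h
  have hne : ∀ᶠ t : ℂ in 𝓝 t₁, t ≠ 0 := eventually_ne_nhds ht₁
  have hev : ∀ᶠ t in 𝓝 t₁, ω (T (f t)) = f t ∧ ‖T (f t)‖ = ‖t‖ := by
    filter_upwards [hfR, hTc.eventually hω, hf.continuousAt.eventually hωT] with t h1 h2 h3
    have h4 := h3 h1.1
    refine ⟨h4, hnorm (f t) _ _ h1.2 ?_⟩
    have := h2.2.1
    rwa [h4] at this
  have hmax : IsLocalMax (norm ∘ fun t => T (f t) / t) t₁ := by
    filter_upwards [hev, hne] with t h1 h2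
    have h3 : ‖t‖ ≠ 0 := norm_ne_zero_iff.2 h2
    have h4 : ‖t₁‖ ≠ 0 := norm_ne_zero_iff.2 ht₁
    simp only [comp_apply, norm_div, hT₁, h1.2, div_self h3, div_self h4, le_refl]
  have hconst := Complex.eventually_eq_of_isLocalMax_norm
    (hq.eventually_analyticAt.mono fun t h => h.differentiableAt) hmax
  filter_upwards [hconst, hne, hev] with t h1 h2 h3
  rw [hT₁, div_self ht₁, div_eq_one_iff_eq h2] at h1
  refine ⟨h1, ?_⟩
  have := h3.1
  rw [h1] at this
  exact this.symm

/-- The section through the centre exists: the smallest modulus of a parameter is zero. -/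
lemma exists_center {R : E → ℂ → Prop} {H : Set E} (hHne : H.Nonempty)
    (hex : ∀ w ∈ H, ∃ t, ‖t‖ < 1 ∧ R w t)
    (hnorm : ∀ w t t', R w t → R w t' → ‖t'‖ = ‖t‖)
    (hloc : ∀ w ∈ H, ∀ t, R w t → IsLocalParam R H w t)
    (hcpt : ∀ ρ < (1 : ℝ), ∃ K, IsCompact K ∧ K ⊆ H ∧ ∀ w ∈ H, ∀ t, R w t → ‖t‖ ≤ ρ → w ∈ K) :
    ∃ w ∈ H, R w 0 := by
  classical
  set N : E → ℝ := fun w => if h : ∃ t, R w t then ‖h.choose‖ else 0 with hN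
  have hNR : ∀ w t, R w t → N w = ‖t‖ := by
    intro w t h
    have h1 : ∃ t, R w t := ⟨t, h⟩
    simp only [hN, dif_pos h1]
    exact hnorm w _ _ h h1.choose_spec
  have hNc : ContinuousOn N H := by
    intro w hw
    obtain ⟨t, -, ht⟩ := hex w hw
    obtain ⟨ω, T, -, -, hT, hT₁, hω, hωT⟩ := hloc w hw t ht
    have hTc : Tendsto T (𝓝 w) (𝓝 t) := hT₁ ▸ hT.continuousAt.tendsto
    have h1 : (fun v => ‖T v‖) =ᶠ[𝓝[H] w] N := by
      filter_upwards [nhdsWithin_le_nhds hωT, nhdsWithin_le_nhds (hTc.eventually hω),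
        self_mem_nhdsWithin] with v h2 h3 h4
      have h5 := h3.2.1
      rw [h2 h4] at h5
      exact (hNR v _ h5).symm
    have h2 : ContinuousWithinAt (fun v => ‖T v‖) H w := hT.continuousAt.norm.continuousWithinAt
    exact h2.congr_of_eventuallyEq h1.symm (by rw [hNR w t ht, hT₁])
  obtain ⟨w₀, hw₀⟩ := hHne
  obtain ⟨t₀, ht₀, hR₀⟩ := hex w₀ hw₀
  obtain ⟨K, hK, hKH, hKm⟩ := hcpt ‖t₀‖ ht₀
  have hw₀K : w₀ ∈ K := hKm w₀ hw₀ t₀ hR₀ le_rfl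
  obtain ⟨w₁, hw₁K, hmin⟩ := hK.exists_isMinOn ⟨w₀, hw₀K⟩ (hNc.mono hKH)
  have hw₁ := hKH hw₁K
  obtain ⟨t₁, -, hR₁⟩ := hex w₁ hw₁
  by_cases h0 : t₁ = 0
  · exact ⟨w₁, hw₁, h0 ▸ hR₁⟩
  exfalso
  obtain ⟨ω, T, -, -, -, -, hω, -⟩ := hloc w₁ hw₁ t₁ hR₁
  have h1 : t₁ ∈ closure (ball (0 : ℂ) ‖t₁‖) := by
    rw [closure_ball _ (norm_ne_zero_iff.2 h0)]
    simp
  obtain ⟨t, ht, hωt⟩ := ((mem_closure_iff_frequently.1 h1).and_eventually hω).exists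
  rw [mem_ball_zero_iff] at ht
  have h2 : ‖t₁‖ ≤ ‖t₀‖ := by
    have := isMinOn_iff.1 hmin w₀ hw₀K
    rwa [hNR _ _ hR₁, hNR _ _ hR₀] at this
  have h3 := isMinOn_iff.1 hmin (ω t) (hKm _ hωt.1 t hωt.2.1 (ht.le.trans h2))
  rw [hNR _ _ hR₁, hNR _ _ hωt.2.1] at h3
  exact absurd h3 (not_le.2 ht)

variable [CompleteSpace E]

/-- A local section of the relation on a disc extends across every boundary point of modulus
smaller than one. -/
lemma exists_section_extension {R : E → ℂ → Prop} {H : Set E}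
    (hex : ∀ w ∈ H, ∃ t, ‖t‖ < 1 ∧ R w t)
    (hnorm : ∀ w t t', R w t → R w t' → ‖t'‖ = ‖t‖)
    (hrot : ∀ w t t', R w t → R w t' → t ≠ 0 → ∀ w' u, R w' u → R w' (t' / t * u))
    (hloc : ∀ w ∈ H, ∀ t, R w t → IsLocalParam R H w t)
    (hcpt : ∀ ρ < (1 : ℝ), ∃ K, IsCompact K ∧ K ⊆ H ∧ ∀ w ∈ H, ∀ t, R w t → ‖t‖ ≤ ρ → w ∈ K)
    {r : ℝ} (hr0 : 0 < r) (hr1 : r < 1) {f : ℂ → E} (hf : AnalyticOnNhd ℂ f (ball 0 r))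
    (hfR : ∀ b ∈ ball (0 : ℂ) r, f b ∈ H ∧ R (f b) b) {b₀ : ℂ} (hb₀ : ‖b₀‖ = r) :
    ∃ δ > 0, ∃ φ : ℂ → E, AnalyticOnNhd ℂ φ (ball b₀ δ) ∧
      (∀ b ∈ ball b₀ δ, φ b ∈ H ∧ R (φ b) b) ∧ ∀ b ∈ ball b₀ δ, ‖b‖ < r → φ b = f b := by
  obtain ⟨K, hK, hKH, hKm⟩ := hcpt r hr1
  have hb₀0 : b₀ ≠ 0 := norm_pos_iff.1 (hb₀ ▸ hr0)
  have hb₀c : b₀ ∈ closure (ball (0 : ℂ) r) := by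
    rw [closure_ball _ hr0.ne']
    simp [hb₀]
  have hne : (𝓝[ball (0 : ℂ) r] b₀).NeBot := mem_closure_iff_nhdsWithin_neBot.1 hb₀c
  obtain ⟨w₂, hw₂K, hw₂⟩ := hK.exists_mapClusterPt (f := 𝓝[ball (0 : ℂ) r] b₀) (u := f) (by
    rw [le_principal_iff, mem_map]
    filter_upwards [self_mem_nhdsWithin] with b hb
    exact hKm _ (hfR b hb).1 b (hfR b hb).2 (mem_ball_zero_iff.1 hb).le)
  have hw₂H := hKH hw₂K
  obtain ⟨t₂, -, ht₂⟩ := hex w₂ hw₂H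
  obtain ⟨ω, T, hωa, hω₁, hT, hT₁, hω, hωT⟩ := hloc w₂ hw₂H t₂ ht₂
  obtain ⟨δ, hδ, hδω⟩ := Metric.eventually_nhds_iff_ball.1 (hω.and hωa.eventually_analyticAt)
  have hTc : Tendsto T (𝓝 w₂) (𝓝 t₂) := hT₁ ▸ hT.continuousAt.tendsto
  -- a point of the disc close to `b₀` whose image is close to `w₂`
  obtain ⟨t, ⟨hVt, hTt⟩, ht, htb, htb0⟩ : ∃ t, ((∀ᶠ w in 𝓝 (f t), w ∈ H → ω (T w) = w) ∧
      AnalyticAt ℂ T (f t) ∧ T (f t) ∈ ball t₂ (δ / 4) ∧ T (f t) ∈ ball t₂ δ) ∧ t ∈ ball (0 : ℂ) r ∧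
      t ∈ ball b₀ (δ / 4) ∧ t ≠ 0 := by
    have h1 := hw₂.frequently (hωT.eventually_nhds.and (hT.eventually_analyticAt.and
      ((hTc.eventually (ball_mem_nhds t₂ (by positivity : 0 < δ / 4))).and
        (hTc.eventually (ball_mem_nhds t₂ hδ)))))
    have h2 : ∀ᶠ t in 𝓝[ball (0 : ℂ) r] b₀, t ∈ ball (0 : ℂ) r ∧ t ∈ ball b₀ (δ / 4) ∧ t ≠ 0 := by
      filter_upwards [self_mem_nhdsWithin, nhdsWithin_le_nhds (ball_mem_nhds b₀
        (by positivity : 0 < δ / 4)), nhdsWithin_le_nhds (eventually_ne_nhds hb₀0)] with t h1 h2 h3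
      exact ⟨h1, h2, h3⟩
    exact (h1.and_eventually h2).exists
  obtain ⟨hTa, hTt4, hTtδ⟩ := hTt
  have hft := hfR t ht
  have hωft : ω (T (f t)) = f t := hVt.self_of_nhds hft.1
  have hRT : R (f t) (T (f t)) := by
    have := (hδω _ hTtδ).1.2.1
    rwa [hωft] at this
  have hTn : ‖T (f t)‖ = ‖t‖ := hnorm _ _ _ hft.2 hRT
  have hT0 : T (f t) ≠ 0 := norm_pos_iff.1 (hTn ▸ norm_pos_iff.2 htb0)
  set ζ := T (f t) / t with hζ
  have hζn : ‖ζ‖ = 1 := by rw [hζ, norm_div, hTn, div_self (norm_ne_zero_iff.2 htb0)]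
  have hζ0 : ζ ≠ 0 := div_ne_zero hT0 htb0
  have hζt : ζ * t = T (f t) := div_mul_cancel₀ _ htb0
  have hmap : ∀ b ∈ ball b₀ (δ / 2), ζ * b ∈ ball t₂ δ := by
    intro b hb
    rw [mem_ball, dist_eq_norm] at hb htb hTt4 ⊢
    have h1 : ζ * b - t₂ = ζ * (b - b₀) - ζ * (t - b₀) + (T (f t) - t₂) := by
      rw [← hζt]; ring
    rw [h1]
    have h2 := norm_add_le (ζ * (b - b₀) - ζ * (t - b₀)) (T (f t) - t₂)
    have h3 := norm_sub_le (ζ * (b - b₀)) (ζ * (t - b₀))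
    rw [norm_mul, norm_mul, hζn] at h3
    linarith
  have hφa : AnalyticOnNhd ℂ (fun b => ω (ζ * b)) (ball b₀ (δ / 2)) := fun b hb =>
    AnalyticAt.comp (g := ω) (f := fun b => ζ * b) (hδω _ (hmap b hb)).2
      (analyticAt_const.mul analyticAt_id)
  have hφR : ∀ b ∈ ball b₀ (δ / 2), ω (ζ * b) ∈ H ∧ R (ω (ζ * b)) b := by
    intro b hb
    have h1 := (hδω _ (hmap b hb)).1
    refine ⟨h1.1, ?_⟩
    have h2 := hrot (f t) (T (f t)) t hRT hft.2 hT0 _ _ h1.2.1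
    have h3 : t / T (f t) * (ζ * b) = b := by
      rw [hζ]; field_simp
    rwa [h3] at h2
  refine ⟨δ / 2, by positivity, fun b => ω (ζ * b), hφa, hφR, ?_⟩
  have htb' : t ∈ ball b₀ (δ / 2) := ball_subset_ball (by linarith) htb
  obtain ⟨ω', T', -, -, hT', hT₁', hω', hωT'⟩ := hloc _ hft.1 t hft.2
  have hφt : ω (ζ * t) = f t := by rw [hζt, hωft]
  have h1 := exists_inverse_of_section hnorm htb0 (hf t ht)
    (by filter_upwards [isOpen_ball.mem_nhds ht] with b hb using hfR b hb) hT' hT₁' hω' hωT'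
  have h2 := exists_inverse_of_section (f := fun b => ω (ζ * b)) hnorm htb0 (hφa t htb')
    (by filter_upwards [isOpen_ball.mem_nhds htb'] with b hb using hφR b hb)
    (T := T') (ω := ω') (by simpa only [hφt] using hT') (by simp only [hφt, hT₁']) hω'
    (by simpa only [hφt] using hωT')
  have h3 : (fun b => ω (ζ * b)) =ᶠ[𝓝 t] f := by
    filter_upwards [h1, h2] with b h3 h4
    exact h4.2.trans h3.2.symm
  have h4 := (hφa.mono inter_subset_left).eqOn_of_preconnected_of_eventuallyEq
    (hf.mono (inter_subset_right (s := ball b₀ (δ / 2))))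
    ((convex_ball b₀ (δ / 2)).inter (convex_ball (0 : ℂ) r)).isPreconnected ⟨htb', ht⟩ h3
  intro b hb hbr
  exact h4 ⟨hb, mem_ball_zero_iff.2 hbr⟩

/-- A set carrying compatible local parameters is uniformized by the unit disc. -/
theorem exists_uniformization {R : E → ℂ → Prop} {H : Set E} (hHne : H.Nonempty)
    (hHc : IsPreconnected H) (hex : ∀ w ∈ H, ∃ t, ‖t‖ < 1 ∧ R w t)
    (hnorm : ∀ w t t', R w t → R w t' → ‖t'‖ = ‖t‖)
    (hrot : ∀ w t t', R w t → R w t' → t ≠ 0 → ∀ w' u, R w' u → R w' (t' / t * u))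
    (hloc : ∀ w ∈ H, ∀ t, R w t → IsLocalParam R H w t)
    (hcpt : ∀ ρ < (1 : ℝ), ∃ K, IsCompact K ∧ K ⊆ H ∧ ∀ w ∈ H, ∀ t, R w t → ‖t‖ ≤ ρ → w ∈ K) :
    ∃ (s : ℂ → E) (σ : E → ℂ), ContinuousOn s (ball 0 1) ∧ MapsTo s (ball 0 1) H ∧
      MapsTo σ H (ball 0 1) ∧ (∀ t ∈ ball (0 : ℂ) 1, σ (s t) = t) ∧ (∀ w ∈ H, s (σ w) = w) ∧
      (∀ w ∈ H, R w (σ w)) ∧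
      ∀ w ∈ H, ∃ T : E → ℂ, AnalyticAt ℂ T w ∧ ∀ᶠ v in 𝓝 w, v ∈ H → σ v = T v := by
  obtain ⟨w₁, hw₁, hR₁⟩ := exists_center hHne hex hnorm hloc hcpt
  obtain ⟨ω, T₀, hωa, hω₁, hT, hT₁, hω, hωT⟩ := hloc w₁ hw₁ 0 hR₁
  obtain ⟨ε', hε', hεω⟩ := Metric.eventually_nhds_iff_ball.1 (hω.and hωa.eventually_analyticAt)
  obtain ⟨ε, hε, hεε, hε1⟩ : ∃ ε > 0, ε ≤ ε' ∧ ε ≤ 1 :=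
    ⟨min ε' 1, lt_min hε' one_pos, min_le_left _ _, min_le_right _ _⟩
  obtain ⟨s, hsa, hsR, hsω⟩ := analytic_continuation_ball (fun t w => w ∈ H ∧ R w t) hε hε1
    (f₀ := ω) (fun b hb => (hεω b (ball_subset_ball hεε hb)).2)
    (fun b hb => ⟨(hεω b (ball_subset_ball hεε hb)).1.1, (hεω b (ball_subset_ball hεε hb)).1.2.1⟩)
    (fun r hεr hr1 f hf hfR _ b₀ hb₀ =>
      exists_section_extension hex hnorm hrot hloc hcpt (hε.trans_le hεr) hr1 hf hfR hb₀)
  have hsH : MapsTo s (ball 0 1) H := fun t ht => (hsR t ht).1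
  have hsc : ContinuousOn s (ball 0 1) := hsa.continuousOn
  -- local inverses of `s`
  have hinv : ∀ t ∈ ball (0 : ℂ) 1, ∃ T : E → ℂ, AnalyticAt ℂ T (s t) ∧ T (s t) = t ∧
      ∀ᶠ v in 𝓝 (s t), v ∈ H → s (T v) = v := by
    intro t ht
    by_cases h0 : t = 0
    · subst h0
      have h1 : s 0 = w₁ := by rw [hsω 0 (mem_ball_self hε), hω₁]
      rw [h1]
      refine ⟨T₀, hT, hT₁, ?_⟩
      have hTc : Tendsto T₀ (𝓝 w₁) (𝓝 0) := by simpa only [hT₁] using hT.continuousAt.tendsto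
      filter_upwards [hωT, hTc.eventually (ball_mem_nhds 0 hε)] with v h2 h3 h4
      rw [hsω _ h3, h2 h4]
    · obtain ⟨ω', T', -, -, hT', hT₁', hω', hωT'⟩ := hloc _ (hsR t ht).1 t (hsR t ht).2
      have h1 := exists_inverse_of_section hnorm h0 (hsa t ht)
        (by filter_upwards [isOpen_ball.mem_nhds ht] with b hb using hsR b hb) hT' hT₁' hω' hωT'
      refine ⟨T', hT', hT₁', ?_⟩
      have hTc : Tendsto T' (𝓝 (s t)) (𝓝 t) := by
        have := hT'.continuousAt.tendsto
        rwa [hT₁'] at this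
      filter_upwards [hωT', hTc.eventually h1] with v h2 h3 h4
      rw [h3.2, h2 h4]
  have hinj : InjOn s (ball 0 1) := by
    intro t ht t' ht' htt
    have hR' : R (s t) t' := htt ▸ (hsR t' ht').2
    have hnn := hnorm _ _ _ (hsR t ht).2 hR'
    by_cases h0 : t = 0
    · rw [h0, norm_zero, norm_eq_zero] at hnn
      rw [h0, hnn]
    have h0' : t' ≠ 0 := norm_pos_iff.1 (hnn ▸ norm_pos_iff.2 h0)
    set ζ := t' / t with hζ
    have hζn : ‖ζ‖ = 1 := by rw [hζ, norm_div, hnn, div_self (norm_ne_zero_iff.2 h0)]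
    have hζm : ∀ u ∈ ball (0 : ℂ) 1, ζ * u ∈ ball (0 : ℂ) 1 := by
      intro u hu
      rw [mem_ball_zero_iff] at hu ⊢
      rwa [norm_mul, hζn, one_mul]
    have hga : AnalyticOnNhd ℂ (fun u => s (ζ * u)) (ball 0 1) := fun u hu =>
      AnalyticAt.comp (g := s) (f := fun b => ζ * b) (hsa _ (hζm u hu))
        (analyticAt_const.mul analyticAt_id)
    have hgR : ∀ u ∈ ball (0 : ℂ) 1, s (ζ * u) ∈ H ∧ R (s (ζ * u)) u := by
      intro u hu
      refine ⟨hsH (hζm u hu), ?_⟩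
      have h1 := hrot _ t' t hR' (hsR t ht).2 h0' _ _ (hsR _ (hζm u hu)).2
      have h2 : t / t' * (ζ * u) = u := by rw [hζ]; field_simp
      rwa [h2] at h1
    have hgt : s (ζ * t) = s t := by rw [hζ, div_mul_cancel₀ _ h0, htt]
    obtain ⟨ω', T', -, -, hT', hT₁', hω', hωT'⟩ := hloc _ (hsR t ht).1 t (hsR t ht).2
    have h1 := exists_inverse_of_section hnorm h0 (hsa t ht)
      (by filter_upwards [isOpen_ball.mem_nhds ht] with b hb using hsR b hb) hT' hT₁' hω' hωT'
    have h2 := exists_inverse_of_section (f := fun b => s (ζ * b)) hnorm h0 (hga t ht)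
      (by filter_upwards [isOpen_ball.mem_nhds ht] with b hb using hgR b hb)
      (T := T') (ω := ω') (by simpa only [hgt] using hT') (by simp only [hgt, hT₁']) hω'
      (by simpa only [hgt] using hωT')
    have h3 : (fun b => s (ζ * b)) =ᶠ[𝓝 t] s := by
      filter_upwards [h1, h2] with b h3 h4
      exact h4.2.trans h3.2.symm
    have h4 := hga.eqOn_of_preconnected_of_eventuallyEq hsa
      (convex_ball (0 : ℂ) 1).isPreconnected ht h3
    have hu : ((ε / 2 : ℝ) : ℂ) ∈ ball (0 : ℂ) ε := by
      rw [mem_ball_zero_iff, Complex.norm_real, Real.norm_of_nonneg (by positivity)]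
      linarith
    have hu' : ζ * ((ε / 2 : ℝ) : ℂ) ∈ ball (0 : ℂ) ε := by
      rw [mem_ball_zero_iff] at hu ⊢
      rwa [norm_mul, hζn, one_mul]
    have h5 : s (ζ * ((ε / 2 : ℝ) : ℂ)) = s ((ε / 2 : ℝ) : ℂ) := h4 (ball_subset_ball hε1 hu)
    rw [hsω _ hu, hsω _ hu'] at h5
    have h6 := congrArg T₀ h5
    rw [(hεω _ (ball_subset_ball hεε hu)).1.2.2, (hεω _ (ball_subset_ball hεε hu')).1.2.2] at h6
    have h7 : ζ = 1 := by
      refine mul_right_cancel₀ (b := ((ε / 2 : ℝ) : ℂ)) ?_ (by rw [h6, one_mul])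
      exact_mod_cast (by positivity : (ε / 2 : ℝ) ≠ 0)
    rw [hζ, div_eq_one_iff_eq h0] at h7
    exact h7.symm
  have hopen : ∀ t ∈ ball (0 : ℂ) 1, ∀ᶠ v in 𝓝 (s t), v ∈ H → v ∈ s '' ball 0 1 := by
    intro t ht
    obtain ⟨T, hTa, hTt, hTs⟩ := hinv t ht
    have hTc : Tendsto T (𝓝 (s t)) (𝓝 t) := by
      have := hTa.continuousAt.tendsto
      rwa [hTt] at this
    filter_upwards [hTs, hTc.eventually (isOpen_ball.mem_nhds ht)] with v h1 h2 h3
    exact ⟨T v, h2, h1 h3⟩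
  have hclosed : H ∩ closure (s '' ball 0 1) ⊆ s '' ball 0 1 := by
    rintro w ⟨hw, hwc⟩
    obtain ⟨t, ht1, ht⟩ := hex w hw
    obtain ⟨ω', T, -, -, hT', hT₁', hω', hωT'⟩ := hloc w hw t ht
    obtain ⟨ρ, htρ, hρ1⟩ := exists_between ht1
    have hTc : Tendsto T (𝓝 w) (𝓝 t) := by
      have := hT'.continuousAt.tendsto
      rwa [hT₁'] at this
    have h1 : ∀ᶠ v in 𝓝 w, v ∈ s '' ball 0 1 → v ∈ s '' closedBall 0 ρ := by
      filter_upwards [hωT', hTc.eventually hω', hTc.norm.eventually (gt_mem_nhds htρ)]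
        with v h1 h2 h3
      rintro ⟨u, hu, rfl⟩
      refine ⟨u, ?_, rfl⟩
      have h4 := h2.2.1
      rw [h1 (hsH hu)] at h4
      rw [mem_closedBall_zero_iff, hnorm _ _ _ h4 (hsR u hu).2]
      exact h3.le
    have h2 : IsCompact (s '' closedBall 0 ρ) := (isCompact_closedBall _ _).image_of_continuousOn
      (hsc.mono (closedBall_subset_ball hρ1))
    have h3 : w ∈ closure (s '' closedBall 0 ρ) := mem_closure_iff_frequently.2
      (((mem_closure_iff_frequently.1 hwc).and_eventually h1).mono fun v h => h.2 h.1)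
    rw [h2.isClosed.closure_eq] at h3
    exact image_mono (closedBall_subset_ball hρ1) h3
  have hsurj : H ⊆ s '' ball 0 1 := by
    by_contra hcon
    obtain ⟨w, hw, hws⟩ := not_subset.1 hcon
    set u : Set E := interior {v | v ∈ H → v ∈ s '' ball 0 1} with hu
    have hsu : ∀ t ∈ ball (0 : ℂ) 1, s t ∈ u := fun t ht => mem_interior_iff_mem_nhds.2 (hopen t ht)
    obtain ⟨v, hvH, hvu, hvc⟩ := hHc u (closure (s '' ball 0 1))ᶜ isOpen_interior
      isClosed_closure.isOpen_compl (by
        intro v hv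
        by_cases h : v ∈ closure (s '' ball 0 1)
        · obtain ⟨t, ht, rfl⟩ := hclosed ⟨hv, h⟩
          exact Or.inl (hsu t ht)
        · exact Or.inr h)
      ⟨s 0, hsH (mem_ball_self one_pos), hsu 0 (mem_ball_self one_pos)⟩
      ⟨w, hw, fun h => hws (hclosed ⟨hw, h⟩)⟩
    exact hvc (subset_closure (interior_subset hvu hvH))
  set σ := invFunOn s (ball 0 1) with hσ
  have hσm : MapsTo σ H (ball 0 1) := fun w hw => invFunOn_mem (hsurj hw)
  have hsσ : ∀ w ∈ H, s (σ w) = w := fun w hw => invFunOn_eq (hsurj hw)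
  have hσs : ∀ t ∈ ball (0 : ℂ) 1, σ (s t) = t := fun t ht =>
    hinj (hσm (hsH ht)) ht (hsσ _ (hsH ht))
  refine ⟨s, σ, hsc, hsH, hσm, hσs, hsσ, fun w hw => ?_, fun w hw => ?_⟩
  · have := (hsR _ (hσm hw)).2
    rwa [hsσ w hw] at this
  · obtain ⟨T, hTa, hTt, hTs⟩ := hinv _ (hσm hw)
    rw [hsσ w hw] at hTa hTt hTs
    refine ⟨T, hTa, ?_⟩
    have hTc : Tendsto T (𝓝 w) (𝓝 (σ w)) := by
      have := hTa.continuousAt.tendsto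
      rwa [hTt] at this
    filter_upwards [hTs, hTc.eventually (isOpen_ball.mem_nhds (hσm hw))] with v h1 h2 h3
    have h4 := hσs _ h2
    rwa [h1 h3] at h4

end Uniformization

section BottcherCoordinate

/-- The restriction of a local Böttcher coordinate to a small invariant disc. -/
lemma isBottcherAt_ball {d : ℕ} (hd : 2 ≤ d) {g B : ℂ → ℂ} {c μ : ℂ} {ε ε' : ℝ} (hε : 0 < ε)
    (hεε' : ε ≤ ε') (hg : ∀ s : ℂ, ‖s‖ < ε' → ‖g (c + s) - c‖ ≤ ‖s‖ / 2)
    (hB : DifferentiableOn ℂ B (ball c ε')) (hBc : B c = 0) (hμ : μ ≠ 0) (hBd : HasDerivAt B μ c)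
    (hconj : ∀ z ∈ ball c ε', B (g z) = B z ^ d) : IsBottcherAt g c B (ball c ε) d := by
  have hBa := hB.analyticOnNhd isOpen_ball
  refine ⟨isOpen_ball, mem_ball_self hε, fun z hz => ?_, hBa.mono (ball_subset_ball hεε'), hBc, hd,
    fun z hz => hconj z (ball_subset_ball hεε' hz), ?_⟩
  · rw [mem_ball, dist_eq_norm] at hz ⊢
    have h1 := hg (z - c) (hz.trans_le hεε')
    rw [add_sub_cancel] at h1
    linarith [norm_nonneg (z - c)]
  · obtain ⟨h, -, -, -, hh⟩ := exists_analytic_localInverse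
      (hBa c (mem_ball_self (hε.trans_le hεε'))) (by rwa [hBd.deriv])
    obtain ⟨δ, hδ, hball⟩ := Metric.eventually_nhds_iff_ball.1 hh
    refine ⟨ball c (min δ ε), ball_subset_ball (min_le_right _ _), isOpen_ball,
      mem_ball_self (lt_min hδ hε), fun x hx y hy hxy => ?_⟩
    rw [← hball x (ball_subset_ball (min_le_left _ _) hx), hxy,
      hball y (ball_subset_ball (min_le_left _ _) hy)]

/-- A Böttcher coordinate extends to a small disc about a preimage, by a square root. -/
lemma IsBottcherAt.exists_extend {g B : ℂ → ℂ} {c z v : ℂ} {U : Set ℂ}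
    (h : IsBottcherAt g c B U 2) (hg : Continuous g) (hga : ∀ z, AnalyticAt ℂ g z)
    (hgz : g z ∈ U) (hz : z ∉ closure U) (hv : v ≠ 0) (hvB : v ^ 2 = B (g z)) {F : Set ℂ}
    (hF : F.Finite) (hzF : z ∉ F) (hFU : ∀ x ∈ F, x ∉ closure U) :
    ∃ (B' : ℂ → ℂ) (U' : Set ℂ), IsBottcherAt g c B' U' 2 ∧ z ∈ U' ∧ B' z = v ∧
      ∀ x ∈ F, x ∉ closure U' := by
  classical
  have hBg : ∀ y, g y ∈ U → AnalyticAt ℂ (fun y => B (g y) / v ^ 2) y := fun y hy =>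
    (AnalyticAt.comp (g := B) (f := g) (h.analytic _ hy) (hga y)).div analyticAt_const
      (pow_ne_zero 2 hv)
  have hz1 : B (g z) / v ^ 2 = 1 := by rw [hvB]; exact div_self (hvB ▸ pow_ne_zero 2 hv)
  have h1 : ∀ᶠ y in 𝓝 z, B (g y) / v ^ 2 ∈ Complex.slitPlane :=
    (hBg z hgz).continuousAt.eventually_mem
      (Complex.isOpen_slitPlane.mem_nhds (by simp only [hz1, Complex.one_mem_slitPlane]))
  have h2 : ∀ᶠ y in 𝓝 z, g y ∈ U := hg.continuousAt.eventually_mem (h.open_dom.mem_nhds hgz)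
  have h3 : ∀ᶠ y in 𝓝 z, y ∈ (closure U)ᶜ := isClosed_closure.isOpen_compl.mem_nhds hz
  have h4 : ∀ᶠ y in 𝓝 z, y ∈ Fᶜ := hF.isClosed.isOpen_compl.mem_nhds hzF
  obtain ⟨r, hr, hball⟩ := nhds_basis_closedBall.eventually_iff.1 (h1.and (h2.and (h3.and h4)))
  have hDU : ∀ y ∈ ball z r, y ∉ U := fun y hy hyU =>
    (hball (ball_subset_closedBall hy)).2.2.1 (subset_closure hyU)
  set b : ℂ → ℂ := fun y => v * Complex.exp (Complex.log (B (g y) / v ^ 2) / 2) with hb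
  set B' : ℂ → ℂ := fun y => if y ∈ U then B y else b y with hB'
  have hB'U : ∀ y ∈ U, B' y = B y := fun y hy => if_pos hy
  have hB'D : ∀ y ∈ ball z r, B' y = b y := fun y hy => if_neg (hDU y hy)
  refine ⟨B', U ∪ ball z r, ⟨h.open_dom.union isOpen_ball, Or.inl h.mem, ?_, ?_, ?_, le_rfl,
    ?_, ?_⟩,
    Or.inr (mem_ball_self hr), ?_, ?_⟩
  · rintro y (hy | hy)
    · exact Or.inl (h.mapsTo hy)
    · exact Or.inl (hball (ball_subset_closedBall hy)).2.1
  · rintro y (hy | hy)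
    · refine (h.analytic y hy).congr ?_
      filter_upwards [h.open_dom.mem_nhds hy] with x hx using (hB'U x hx).symm
    · have hy' := hball (ball_subset_closedBall hy)
      have ha : AnalyticAt ℂ b y :=
        analyticAt_const.mul (AnalyticAt.cexp (((hBg y hy'.2.1).clog hy'.1).div analyticAt_const
          two_ne_zero))
      refine ha.congr ?_
      filter_upwards [isOpen_ball.mem_nhds hy] with x hx using (hB'D x hx).symm
  · rw [hB'U c h.mem, h.zero]
  · rintro y (hy | hy)
    · rw [hB'U y hy, hB'U _ (h.mapsTo hy), h.conj y hy]
    · have hy' := hball (ball_subset_closedBall hy)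
      rw [hB'D y hy, hB'U _ hy'.2.1, hb]
      simp only
      rw [mul_pow, ← Complex.exp_nat_mul]
      have h5 : ((2 : ℕ) : ℂ) * (Complex.log (B (g y) / v ^ 2) / 2)
          = Complex.log (B (g y) / v ^ 2) := by push_cast; ring
      rw [h5, Complex.exp_log (Complex.slitPlane_ne_zero hy'.1)]
      field_simp
  · obtain ⟨V, hVU, hV, hcV, hinj⟩ := h.inj
    refine ⟨V, hVU.trans subset_union_left, hV, hcV, fun x hx y hy hxy => hinj hx hy ?_⟩
    rwa [hB'U x (hVU hx), hB'U y (hVU hy)] at hxy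
  · rw [hB'D z (mem_ball_self hr), hb]
    simp only [hz1, Complex.log_one, zero_div, Complex.exp_zero, mul_one]
  · intro x hx hxc
    rw [closure_union] at hxc
    rcases hxc with hxc | hxc
    · exact hFU x hx hxc
    · exact (hball (closure_ball_subset_closedBall hxc)).2.2.2 hx

variable {p : ℕ}

lemma critFactor_zero_ne_zero {w : ℂ × ℂ} (hw : w ∈ Sp p) (hc : w.1 = 0) :
    critFactor w.1 w.2 0 (p - 1) ≠ 0 := by
  rw [critFactor_zero_eq, Finset.prod_ne_zero_iff]
  intro k hk h
  rw [Finset.mem_range] at hk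
  have h' := hw.2 (k + 1) (by omega) (by omega)
  rw [hc] at h h'
  exact h' (by simpa using h)

lemma exists_isBottcherAt_of_eq_zero (hp : 1 ≤ p) {w : ℂ × ℂ} (hw : w ∈ Sp p) (hc : w.1 = 0) :
    ∃ B U d, IsBottcherAt ((cubic w.1 w.2)^[p]) w.1 B U d ∧ -w.1 ∈ U ∧ B (-w.1) = 0 := by
  obtain ⟨μ, hμ⟩ := IsAlgClosed.exists_pow_nat_eq (critFactor w.1 w.2 0 (p - 1)) two_pos
  have hμ0 : μ ≠ 0 := by
    rintro rfl
    exact critFactor_zero_ne_zero hw hc (by rw [← hμ]; simp)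
  have hqd : Differentiable ℂ fun s => critFactor w.1 w.2 s (p - 1) := by
    have h1 : Differentiable ℂ fun x : ℂ × ℂ × ℂ => critFactor x.1 x.2.1 x.2.2 (p - 1) :=
      (contDiff_critFactor (n := 1) (p - 1)).differentiable one_ne_zero
    exact h1.comp (show Differentiable ℂ fun s : ℂ => (w.1, w.2, s) by fun_prop)
  obtain ⟨ε, hε, hg, B, hB, hBc, hBd, hconj, -⟩ := exists_local_bottcher (d := 3) (by norm_num)
    (g := (cubic w.1 w.2)^[p]) (c := w.1) hqd hμ0 hμ (fun s => by
      rw [iterate_cubic_add_eq hp, hw.1, retFactor, hc]; ring)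
  refine ⟨B, ball w.1 ε, 3, isBottcherAt_ball (by norm_num) hε le_rfl hg hB hBc hμ0 hBd hconj,
    ?_, ?_⟩
  · rw [hc, neg_zero]; exact mem_ball_self hε
  · rw [hc] at hBc ⊢
    rwa [neg_zero]

lemma exists_isBottcherAt_of_ne_zero (hp : 1 ≤ p) {w : ℂ × ℂ} (hw : w ∈ Sp p) (hc : w.1 ≠ 0)
    (ht : Tendsto (critOrbit p w) atTop (𝓝 0)) {t : ℂ} (hR : IsCritParam p w t) :
    ∃ B U d, IsBottcherAt ((cubic w.1 w.2)^[p]) w.1 B U d ∧ -w.1 ∈ U ∧ B (-w.1) = t ^ 2 := by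
  have ht0 := hR.ne_zero hc
  have hR' := hR.resolve_left fun h => hc h.1
  have hμ0 : retFactor p w.1 w.2 0 ≠ 0 := retFactor_zero_ne_zero hp (c := w.1) (a := w.2) hw hc ht
  set μ := retFactor p w.1 w.2 0 with hμ
  set g := (cubic w.1 w.2)^[p] with hgdef
  set z : ℕ → ℂ := fun n => g^[n] (-w.1) with hz
  have hzs : ∀ n, z (n + 1) = g (z n) := fun n => iterate_succ_apply' g n _
  have hzc : ∀ n, z n - w.1 = critOrbit p w n := fun n => rfl
  have hqd : Differentiable ℂ fun s => retFactor p w.1 w.2 s := by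
    have h1 : Differentiable ℂ fun x : ℂ × ℂ × ℂ => retFactor p x.1 x.2.1 x.2.2 :=
      (contDiff_retFactor (n := 1) p).differentiable one_ne_zero
    exact h1.comp (show Differentiable ℂ fun s : ℂ => (w.1, w.2, s) by fun_prop)
  obtain ⟨ε, hε, hg, B, hB, hBc, hBd, hconj, hasymp⟩ := exists_local_bottcher (d := 2) le_rfl
    (g := g) (c := w.1) hqd hμ0 (by rw [← hμ]; ring) (fun s => by
      rw [hgdef, iterate_cubic_add_eq hp, hw.1])
  have hzt : Tendsto z atTop (𝓝 w.1) := by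
    have := ht.add_const w.1
    rw [zero_add] at this
    exact this.congr fun n => by rw [← hzc]; ring
  have hball := isBottcherAt_ball le_rfl hε le_rfl hg hB hBc hμ0 hBd hconj
  obtain ⟨N, hN⟩ := (hzt.eventually (ball_mem_nhds w.1 hε)).exists
  have hzN : ∀ k, z (N + k) ∈ ball w.1 ε ∧ B (z (N + k)) = B (z N) ^ 2 ^ k := by
    intro k
    induction k with
    | zero => exact ⟨hN, by simp⟩
    | succ k ih =>
      rw [← add_assoc, hzs]
      exact ⟨hball.mapsTo ih.1, by rw [hconj _ ih.1, ih.2, ← pow_mul, pow_succ]⟩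
  obtain ⟨S, hS, hSB⟩ := hasymp _ hN
  have hu : Tendsto (fun k => B (z N) ^ 2 ^ k / t ^ 2 ^ (N + k + 1)) atTop (𝓝 1) := by
    have h1 := (hR'.2.comp (tendsto_add_atTop_nat N)).inv₀ one_ne_zero
    have h2 := (Complex.continuous_exp.tendsto 0).comp hS
    have h3 := h1.mul h2
    simp only [inv_one, Complex.exp_zero, mul_one] at h3
    refine h3.congr fun k => ?_
    simp only [comp_apply, inv_div]
    rw [hSB k, ← iterate_add_apply, ← hzc, add_comm k N]
    ring
  obtain ⟨K, hK⟩ := eventually_eq_one_of_sq (fun k => by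
    rw [div_pow, ← pow_mul, ← pow_mul, ← pow_succ, ← pow_succ]; rfl) hu
  have hdeep : ∀ n ≥ N + K, z n ∈ ball w.1 ε ∧ B (z n) = t ^ 2 ^ (n + 1) := by
    intro n hn
    obtain ⟨k, rfl⟩ : ∃ k, n = N + k := ⟨n - N, by omega⟩
    have h1 := hK k (by omega)
    rw [div_eq_one_iff_eq (pow_ne_zero _ ht0)] at h1
    exact ⟨(hzN k).1, by rw [(hzN k).2, h1]⟩
  have hzne : ∀ n, z n ≠ w.1 := fun n h =>
    hR.critOrbit_ne_zero hp hw.1 hc n (by rw [← hzc, h, sub_self])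
  have hzinj : ∀ m n, m < n → z m ≠ z n := by
    intro m n hmn h
    have h1 : ∀ k, z (m + (n - m) * k) = z m := by
      intro k
      have h2 : IsFixedPt g^[n - m] (z m) := by
        simp only [IsFixedPt, hz, ← iterate_add_apply, Nat.sub_add_cancel hmn.le]
        exact h.symm
      have h3 := h2.iterate k
      rw [← iterate_mul] at h3
      simp only [hz, add_comm m, iterate_add_apply] at h3 ⊢
      exact h3
    have h4 : Tendsto (fun k => m + (n - m) * k) atTop atTop :=
      tendsto_atTop_mono (fun k => by
        have : 1 * k ≤ (n - m) * k := Nat.mul_le_mul_right k (by omega)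
        simp only [id]
        omega) tendsto_id
    exact hzne m (tendsto_nhds_unique (tendsto_const_nhds.congr fun k => (h1 k).symm)
      (hzt.comp h4))
  -- the first entrance of the free critical orbit into a small disc
  obtain ⟨ε₁, hε₁, hε₁ε, hfar⟩ : ∃ ε₁ > 0, ε₁ ≤ ε ∧ ∀ n < N + K, ε₁ ≤ dist (z n) w.1 := by
    have h1 : ∀ᶠ r : ℝ in 𝓝[>] 0, ∀ n ∈ Finset.range (N + K), r ≤ dist (z n) w.1 :=
      (Filter.eventually_all_finset _).2 fun n _ =>
        nhdsWithin_le_nhds (ge_mem_nhds (dist_pos.2 (hzne n)))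
    have h2 : ∀ᶠ r : ℝ in 𝓝[>] 0, r ≤ ε := nhdsWithin_le_nhds (ge_mem_nhds hε)
    have h3 : ∀ᶠ r : ℝ in 𝓝[>] 0, 0 < r := self_mem_nhdsWithin
    obtain ⟨r, hr, hr1, hr2⟩ := (h3.and (h1.and h2)).exists
    exact ⟨r, hr, hr2, fun n hn => hr1 n (Finset.mem_range.2 hn)⟩
  have hent : ∃ n, z n ∈ ball w.1 ε₁ := (hzt.eventually (ball_mem_nhds w.1 hε₁)).exists
  classical
  set M := Nat.find hent with hM
  have hMb : z M ∈ ball w.1 ε₁ := Nat.find_spec hent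
  have hMlt : ∀ n < M, ε₁ ≤ dist (z n) w.1 := fun n hn => not_lt.1 (Nat.find_min hent hn)
  have hMN : N + K ≤ M := by
    by_contra hlt
    exact absurd hMb (not_lt.2 (hfar M (not_le.1 hlt)))
  obtain ⟨ε₀, hzε₀, hε₀⟩ := exists_between (mem_ball.1 hMb)
  have key : ∀ j ≤ M, ∃ (B' : ℂ → ℂ) (U' : Set ℂ), IsBottcherAt g w.1 B' U' 2 ∧ z (M - j) ∈ U' ∧
      B' (z (M - j)) = t ^ 2 ^ (M - j + 1) ∧ ∀ x ∈ z '' Iio (M - j), x ∉ closure U' := by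
    intro j
    induction j with
    | zero =>
      intro _
      refine ⟨B, ball w.1 ε₀, isBottcherAt_ball le_rfl (dist_nonneg.trans_lt hzε₀)
        (hε₀.le.trans hε₁ε) hg hB hBc hμ0 hBd hconj, hzε₀, (hdeep M hMN).2, ?_⟩
      rintro - ⟨n, hn, rfl⟩ hcl
      have h1 := closure_ball_subset_closedBall hcl
      rw [mem_closedBall] at h1
      linarith [hMlt n hn]
    | succ j ih =>
      intro hj
      obtain ⟨B', U', hB', hzU, hBz, hcl⟩ := ih (by omega)
      have h1 : M - j = M - (j + 1) + 1 := by omega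
      have hgz : g (z (M - (j + 1))) = z (M - j) := by rw [h1, hzs]
      refine hB'.exists_extend (z := z (M - (j + 1))) ((continuous_cubic _ _).iterate p)
        (fun x => ((differentiable_cubic _ _).iterate p).analyticAt x)
        (hgz ▸ hzU) (hcl _ ⟨_, by simp only [mem_Iio]; omega, rfl⟩) (pow_ne_zero _ ht0) ?_
        ((finite_Iio _).image z) ?_ ?_
      · rw [hgz, hBz, ← pow_mul, ← pow_succ, h1]
      · rintro ⟨n, hn, h2⟩
        exact hzinj n _ hn h2
      · rintro - ⟨n, hn, rfl⟩
        refine hcl _ ⟨n, ?_, rfl⟩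
        simp only [mem_Iio] at hn ⊢
        omega
  obtain ⟨B', U', hB', hzU, hBz, -⟩ := key M le_rfl
  rw [Nat.sub_self] at hzU hBz
  refine ⟨B', U', 2, hB', hzU, hBz.trans ?_⟩
  rw [zero_add, pow_one]

end BottcherCoordinate

section DoubleCover

variable {p : ℕ} {H : Set (ℂ × ℂ)}

lemma IsCritParam.mul_div {w w' : ℂ × ℂ} {t t' u : ℂ} (h : IsCritParam p w t)
    (h' : IsCritParam p w t') (ht : t ≠ 0) (hu : IsCritParam p w' u) :
    IsCritParam p w' (t' / t * u) := by
  obtain ⟨N, hN⟩ := h.norm_eq_and h' ht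
  rcases hu with ⟨hc, rfl⟩ | ⟨hc, hu⟩
  · exact Or.inl ⟨hc, mul_zero _⟩
  · refine Or.inr ⟨hc, hu.congr' ?_⟩
    filter_upwards [eventually_ge_atTop N] with n hn
    have h1 : (t' / t) ^ 2 ^ (n + 1) = 1 := by
      obtain ⟨k, hk⟩ : ∃ k, n + 1 = N + k := ⟨n + 1 - N, by omega⟩
      rw [hk, pow_add, pow_mul, hN, one_pow]
    rw [mul_pow, h1, one_mul]

lemma isLocalParam_isCritParam (hp : 1 ≤ p) (hH : IsHyperbolicComponent p H)
    (htypeA : ∀ w ∈ H, -w.1 ∈ fatouComponent (cubic w.1 w.2) w.1) {w : ℂ × ℂ} (hw : w ∈ H) {t : ℂ}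
    (h : IsCritParam p w t) : IsLocalParam (IsCritParam p) H w t := by
  have ht := tendsto_critOrbit hp (hH.subset hw).1 (htypeA w hw)
  by_cases hc : w.1 = 0
  · rw [h.eq_zero hc]
    exact hasLocalParam_zero hp hH hw ht hc
  · exact hasLocalParam_of_ne hp hH hw ht hc h

lemma exists_isBottcherAt (hp : 1 ≤ p) {w : ℂ × ℂ} (hw : w ∈ Sp p)
    (ht : Tendsto (critOrbit p w) atTop (𝓝 0)) {t : ℂ} (h : IsCritParam p w t) :
    ∃ B U d, IsBottcherAt ((cubic w.1 w.2)^[p]) w.1 B U d ∧ -w.1 ∈ U ∧ t ^ 2 = B (-w.1) := by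
  by_cases hc : w.1 = 0
  · obtain ⟨B, U, d, hB, hU, h0⟩ := exists_isBottcherAt_of_eq_zero hp hw hc
    exact ⟨B, U, d, hB, hU, by rw [h0, h.eq_zero hc]; ring⟩
  · obtain ⟨B, U, d, hB, hU, h0⟩ := exists_isBottcherAt_of_ne_zero hp hw hc ht h
    exact ⟨B, U, d, hB, hU, h0.symm⟩

end DoubleCover

/-- On a bounded Type A hyperbolic component `H` of `S_p`, the map
`Φ(c,a) = B_{c,a}(-c)` (Böttcher coordinate of `f_{c,a}^p` at the superattracting fixed
point `c`, evaluated at the critical point `-c`) is a proper double cover of the unit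
disk, ramified at exactly one point. -/
theorem typeA_bottcher_is_double_cover
    (p : ℕ) (hp : 1 ≤ p) (H : Set (ℂ × ℂ))
    (hH : IsHyperbolicComponent p H) (hb : Bornology.IsBounded H)
    (htypeA : ∀ w ∈ H, -w.1 ∈ fatouComponent (cubic w.1 w.2) w.1) :
    ∃ Φ : ℂ × ℂ → ℂ,
      (∀ w ∈ H, ∃ B U d, IsBottcherAt ((cubic w.1 w.2)^[p]) w.1 B U d ∧
        -w.1 ∈ U ∧ Φ w = B (-w.1)) ∧
      ContinuousOn Φ H ∧ AnalyticOnSlice Φ H ∧ Φ '' H = ball (0 : ℂ) 1 ∧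
      (∀ K : Set ℂ, K ⊆ ball (0 : ℂ) 1 → IsCompact K → IsCompact (H ∩ Φ ⁻¹' K)) ∧
      ∃ w₀ ∈ H, {w ∈ H | Φ w = Φ w₀} = {w₀} ∧
        ∀ v ∈ ball (0 : ℂ) 1, v ≠ Φ w₀ → ({w ∈ H | Φ w = v}).ncard = 2 := by
  obtain ⟨s, σ, hs, hsH, hσH, hσs, hsσ, hσR, hσT⟩ := exists_uniformization (R := IsCritParam p)
    hH.nonempty hH.isPreconnected
    (fun w hw => exists_isCritParam_of_mem hp (hH.subset hw).1 (htypeA w hw))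
    (fun w t t' h h' => h.norm_eq h') (fun w t t' h h' ht w' u hu => h.mul_div h' ht hu)
    (fun w hw t h => isLocalParam_isCritParam hp hH htypeA hw h)
    (fun ρ hρ => ⟨_, isCompact_closure_param hb _,
      fun w hw => mem_of_mem_closure hp hH hb htypeA hρ hw,
      fun w hw t h ht => subset_closure ⟨hw, t, h, ht⟩⟩)
  have hσc : ContinuousOn σ H := by
    intro w hw
    obtain ⟨T, hT, hσ⟩ := hσT w hw
    refine hT.continuousAt.continuousWithinAt.congr_of_eventuallyEq ?_ (hσ.self_of_nhds hw)
    filter_upwards [nhdsWithin_le_nhds hσ, self_mem_nhdsWithin] with v h1 h2 using h1 h2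
  have hroot : ∀ v ∈ ball (0 : ℂ) 1, ∃ r ∈ ball (0 : ℂ) 1, r ^ 2 = v := by
    intro v hv
    obtain ⟨r, hr⟩ := IsAlgClosed.exists_pow_nat_eq v two_pos
    refine ⟨r, ?_, hr⟩
    rw [mem_ball_zero_iff] at hv ⊢
    rw [← hr, norm_pow] at hv
    exact lt_of_pow_lt_pow_left₀ 2 zero_le_one (by simpa using hv)
  have hsq : ∀ w ∈ H, σ w ^ 2 ∈ ball (0 : ℂ) 1 := by
    intro w hw
    have h1 := hσH hw
    rw [mem_ball_zero_iff] at h1 ⊢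
    rw [norm_pow]
    exact pow_lt_one₀ (norm_nonneg _) h1 two_ne_zero
  have h0 : (0 : ℂ) ∈ ball (0 : ℂ) 1 := mem_ball_self one_pos
  refine ⟨fun w => σ w ^ 2, fun w hw => ?_, hσc.pow 2, ?_, ?_, ?_, s 0, hsH h0, ?_, ?_⟩
  · exact exists_isBottcherAt hp (hH.subset hw).1
      (tendsto_critOrbit hp (hH.subset hw).1 (htypeA w hw)) (hσR w hw)
  · intro U γ hU hγ₁ hγ₂ hγH t ht
    obtain ⟨T, hT, hσ⟩ := hσT _ (hγH t ht)
    have hγ : AnalyticAt ℂ γ t := (hγ₁ t ht).prod (hγ₂ t ht)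
    have h1 : AnalyticAt ℂ (fun u => T (γ u)) t := AnalyticAt.comp (g := T) (f := γ) hT hγ
    refine (h1.pow 2).congr ?_
    filter_upwards [hγ.continuousAt.eventually hσ, hU.mem_nhds ht] with u h2 h3
    simp only [Pi.pow_apply, h2 (hγH u h3)]
  · refine Subset.antisymm (image_subset_iff.2 hsq) fun v hv => ?_
    obtain ⟨r, hr, rfl⟩ := hroot v hv
    exact ⟨s r, hsH hr, by simp only [hσs r hr]⟩
  · intro K hKb hK
    have hpre : (fun t : ℂ => t ^ 2) ⁻¹' K ⊆ ball 0 1 := by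
      intro t ht
      have h1 := hKb ht
      rw [mem_ball_zero_iff] at h1 ⊢
      rw [norm_pow] at h1
      exact lt_of_pow_lt_pow_left₀ 2 zero_le_one (by simpa using h1)
    have hcpt : IsCompact ((fun t : ℂ => t ^ 2) ⁻¹' K) := Metric.isCompact_of_isClosed_isBounded
      (hK.isClosed.preimage (by fun_prop)) (isBounded_ball.subset hpre)
    have heq : H ∩ (fun w => σ w ^ 2) ⁻¹' K = s '' ((fun t : ℂ => t ^ 2) ⁻¹' K) := by
      ext w
      constructor
      · rintro ⟨hw, hwK⟩
        exact ⟨σ w, hwK, hsσ w hw⟩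
      · rintro ⟨t, ht, rfl⟩
        refine ⟨hsH (hpre ht), ?_⟩
        simp only [mem_preimage, hσs t (hpre ht)]
        exact ht
    rw [heq]
    exact hcpt.image_of_continuousOn (hs.mono hpre)
  · ext w
    simp only [hσs 0 h0]
    constructor
    · rintro ⟨hw, h1⟩
      have h2 : σ w = 0 := by simpa using h1
      rw [mem_singleton_iff, ← hsσ w hw, h2]
    · rintro rfl
      exact ⟨hsH h0, by simp only [hσs 0 h0]⟩
  · intro v hv hv0
    obtain ⟨r, hr, rfl⟩ := hroot v hv
    have hr0 : r ≠ 0 := by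
      rintro rfl
      exact hv0 (by simp only [hσs 0 h0])
    have hnr : -r ∈ ball (0 : ℂ) 1 := by simpa using hr
    have h1 : {w ∈ H | σ w ^ 2 = r ^ 2} = {s r, s (-r)} := by
      ext w
      constructor
      · rintro ⟨hw, h1⟩
        rcases sq_eq_sq_iff_eq_or_eq_neg.1 h1 with h2 | h2
        · exact Or.inl (by rw [← h2, hsσ w hw])
        · exact Or.inr (by rw [← h2, hsσ w hw]; rfl)
      · rintro (rfl | rfl)
        · exact ⟨hsH hr, by rw [hσs r hr]⟩
        · exact ⟨hsH hnr, by rw [hσs _ hnr]; ring⟩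
    rw [h1, ncard_pair]
    intro h2
    have h3 := congrArg σ h2
    rw [hσs r hr, hσs _ hnr] at h3
    exact hr0 (by linear_combination h3 / 2)
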